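/- arXiv:1408.6979 — 2 statements merged into one kernel-verified Lean document; each statement's English description precedes it below -/
import Mathlib

section
/- For every dimension d ≥ 1 and every ε > 0 there exists δ₀ > 0, depending only on d and ε, such that for every δ ∈ (0, δ₀) the following holds. Let μ be a Radon measure on ℝ^d, let B₀ = B̄(x₀, r₀) be a closed ball, and let G(B₀,δ) be the set of points x ∈ ℝ^d such that ∫_{δ r₀}^{δ^{-1} r₀} Δ_μ(x,r)² (dr/r) ≤ δ⁴·Θ_μ(B₀)². If μ(B₀ ∩ G(B₀,δ)) > 0 and μ(δ^{-1}B₀ ∖ G(B₀,δ)) ≤ δ⁴·μ(δ^{-1}B₀), then α_μ(2B₀) < ε. -/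
open MeasureTheory Metric
open scoped ENNReal NNReal

/-- `Δ_μ(x,r) = |μ(B(x,r))/r − μ(B(x,2r))/(2r)|`. -/
noncomputable def ballDelta {d : ℕ} (μ : Measure (EuclideanSpace ℝ (Fin d)))
    (x : EuclideanSpace ℝ (Fin d)) (r : ℝ) : ℝ :=
  |(μ (ball x r)).toReal / r - (μ (ball x (2 * r))).toReal / (2 * r)|

/-- `L` is an affine line in `ℝ^d`. -/
def IsLine {d : ℕ} (L : Set (EuclideanSpace ℝ (Fin d))) : Prop :=
  ∃ x v : EuclideanSpace ℝ (Fin d), v ≠ 0 ∧ L = {y | ∃ t : ℝ, y = x + t • v}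

/-- `dist_B(σ,ν)`: supremum of `|∫ f dσ − ∫ f dν|` over 1-Lipschitz `f` supported in `B`. -/
noncomputable def distB {d : ℕ} (B : Set (EuclideanSpace ℝ (Fin d)))
    (σ ν : Measure (EuclideanSpace ℝ (Fin d))) : ℝ :=
  ⨆ f : {f : EuclideanSpace ℝ (Fin d) → ℝ // LipschitzWith 1 f ∧ Function.support f ⊆ B},
    |(∫ x, f.1 x ∂σ) - ∫ x, f.1 x ∂ν|

/-- The coefficient `α_μ(B)`, where `B` has radius `r`:
`(1/(r·μ(B))) · inf{ dist_B(μ, c·H^1|_L) : c ≥ 0, L a line }`. -/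
noncomputable def alphaMu {d : ℕ} (μ : Measure (EuclideanSpace ℝ (Fin d)))
    (B : Set (EuclideanSpace ℝ (Fin d))) (r : ℝ) : ℝ :=
  (1 / (r * (μ B).toReal)) *
    ⨅ p : {p : ℝ × Set (EuclideanSpace ℝ (Fin d)) // 0 ≤ p.1 ∧ IsLine p.2},
      distB B μ ((ENNReal.ofReal p.1.1) • (μH[1].restrict p.1.2))

/-- The set of points `x` with `∫_a^b Δ_μ(x,r)² dr/r ≤ c`. -/
def Gset {d : ℕ} (μ : Measure (EuclideanSpace ℝ (Fin d))) (a b c : ℝ) :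
    Set (EuclideanSpace ℝ (Fin d)) :=
  {x | (∫ r in Set.Ioc a b, (ballDelta μ x r) ^ 2 / r) ≤ c}

section AuxAll
open MeasureTheory Metric
open scoped ENNReal NNReal
open Filter Topology Set
set_option linter.unusedSectionVars false

open MeasureTheory Metric
open scoped ENNReal NNReal
open Filter Topology Set

set_option linter.unusedSectionVars false

section Part1
variable {V : Type*} [NormedAddCommGroup V] [InnerProductSpace ℝ V] [FiniteDimensional ℝ V]
  [MeasurableSpace V] [BorelSpace V]

open CompactlySupported in
theorem aux_ultralimit (𝒰 : Ultrafilter ℕ) (μ : ℕ → Measure V)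
    (hμ : ∀ n, IsLocallyFiniteMeasure (μ n))
    (hb : ∀ R : ℝ, ∃ C : ℝ, ∀ᶠ n in (𝒰 : Filter ℕ), (μ n).real (closedBall 0 R) ≤ C) :
    ∃ ν : Measure V, IsLocallyFiniteMeasure ν ∧ ∀ f : V → ℝ, Continuous f → HasCompactSupport f →
      Tendsto (fun n => ∫ x, f x ∂(μ n)) 𝒰 (𝓝 (∫ x, f x ∂ν)) := by
  have hlim : ∀ f : C_c(V, ℝ), ∃ l : ℝ, Tendsto (fun n => ∫ x, f x ∂(μ n)) 𝒰 (𝓝 l) := by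
    intro f
    obtain ⟨R, hR⟩ := f.hasCompactSupport.isCompact.isBounded.subset_closedBall (0 : V)
    obtain ⟨C, hC⟩ := hb R
    obtain ⟨M, hM⟩ := f.hasCompactSupport.exists_bound_of_continuous f.continuous
    have hbd : ∀ᶠ n in (𝒰 : Filter ℕ), (∫ x, f x ∂(μ n)) ∈ Icc (-(M * C)) (M * C) := by
      filter_upwards [hC] with n hn
      have hM0 : 0 ≤ M := (norm_nonneg _).trans (hM 0)
      have h1 : ∫ x, f x ∂(μ n) = ∫ x in closedBall 0 R, f x ∂(μ n) := by
        rw [setIntegral_eq_integral_of_forall_compl_eq_zero]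
        intro x hx
        by_contra h
        exact hx (hR (subset_tsupport _ h))
      have h2 : ‖∫ x in closedBall 0 R, f x ∂(μ n)‖ ≤ M * (μ n).real (closedBall 0 R) :=
        norm_setIntegral_le_of_norm_le_const ((isCompact_closedBall _ _).measure_lt_top)
          (fun x _ => hM x)
      rw [← h1, Real.norm_eq_abs] at h2
      have h3 := abs_le.1 (h2.trans (mul_le_mul_of_nonneg_left hn hM0))
      exact h3
    obtain ⟨l, -, hl⟩ := isCompact_Icc.ultrafilter_le_nhds (𝒰.map fun n => ∫ x, f x ∂(μ n))
      (le_principal_iff.2 hbd)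
    exact ⟨l, hl⟩
  choose L hL using hlim
  have hfint : ∀ (f : C_c(V, ℝ)) n, Integrable f (μ n) := fun f n =>
    f.continuous.integrable_of_hasCompactSupport f.hasCompactSupport
  let Λ₀ : C_c(V, ℝ) →ₗ[ℝ] ℝ :=
    { toFun := L
      map_add' := fun f g => by
        refine tendsto_nhds_unique (hL (f + g)) ?_
        have := (hL f).add (hL g)
        refine this.congr fun n => ?_
        simp only [CompactlySupportedContinuousMap.coe_add, Pi.add_apply]
        rw [integral_add (hfint f n) (hfint g n)]
      map_smul' := fun c f => by
        refine tendsto_nhds_unique (hL (c • f)) ?_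
        have := (hL f).const_mul c
        refine this.congr fun n => ?_
        simp only [CompactlySupportedContinuousMap.coe_smul, Pi.smul_apply, smul_eq_mul]
        rw [integral_const_mul] }
  let Λ : C_c(V, ℝ) →ₚ[ℝ] ℝ := PositiveLinearMap.mk₀ Λ₀ (by
    intro f hf
    refine ge_of_tendsto' (hL f) fun n => ?_
    exact integral_nonneg hf)
  refine ⟨RealRMK.rieszMeasure Λ, ?_, ?_⟩
  · have : (RealRMK.rieszMeasure Λ).Regular := inferInstance
    infer_instance
  · intro f hf hc
    have h := RealRMK.integral_rieszMeasure Λ ⟨⟨f, hf⟩, hc⟩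
    have h2 := hL ⟨⟨f, hf⟩, hc⟩
    have h3 : Λ ⟨⟨f, hf⟩, hc⟩ = L ⟨⟨f, hf⟩, hc⟩ := rfl
    rw [← h3, ← h] at h2
    exact h2

theorem aux_real_ball_mono (m : Measure V) [IsLocallyFiniteMeasure m] {s t : Set V} (x : V) (r : ℝ)
    (ht : t ⊆ closedBall x r) (hst : s ⊆ t) : m.real s ≤ m.real t :=
  measureReal_mono hst ((measure_mono ht).trans_lt (isCompact_closedBall _ _).measure_lt_top).ne

theorem aux_cutoff (x : V) {r1 r2 : ℝ} (h : r1 < r2) :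
    ∃ f : V → ℝ, Continuous f ∧ HasCompactSupport f ∧
      ∀ m : Measure V, IsLocallyFiniteMeasure m →
        m.real (ball x r1) ≤ ∫ z, f z ∂m ∧ ∫ z, f z ∂m ≤ m.real (ball x r2) := by
  let f : V → ℝ := fun z => max 0 (min 1 ((r2 - dist z x) / (r2 - r1)))
  have hf : Continuous f := by fun_prop
  have hpos : 0 < r2 - r1 := by linarith
  have hout : ∀ z, z ∉ ball x r2 → f z = 0 := by
    intro z hz
    have : r2 ≤ dist z x := by simpa using hz
    have h2 : (r2 - dist z x) / (r2 - r1) ≤ 0 := div_nonpos_of_nonpos_of_nonneg (by linarith) hpos.le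
    simp only [f]
    exact max_eq_left ((min_le_right _ _).trans h2)
  have hcs : HasCompactSupport f := by
    refine HasCompactSupport.intro (isCompact_closedBall x r2) fun z hz => hout z fun h => ?_
    exact hz (ball_subset_closedBall h)
  have hin : ∀ z, z ∈ ball x r1 → f z = 1 := by
    intro z hz
    have : dist z x < r1 := by simpa using hz
    have h2 : 1 ≤ (r2 - dist z x) / (r2 - r1) := by
      rw [le_div_iff₀ hpos]; linarith
    simp [f, min_eq_left h2]
  have h01 : ∀ z, 0 ≤ f z ∧ f z ≤ 1 := fun z => by
    refine ⟨le_max_left _ _, max_le zero_le_one (min_le_left _ _)⟩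
  refine ⟨f, hf, hcs, fun m hm => ?_⟩
  have hi : Integrable f m := hf.integrable_of_hasCompactSupport hcs
  have hib : ∀ r, IntegrableOn (fun _ => (1 : ℝ)) (ball x r) m := fun r =>
    integrableOn_const (measure_ball_lt_top.ne)
  constructor
  · have : m.real (ball x r1) = ∫ z, (ball x r1).indicator (fun _ => (1:ℝ)) z ∂m := by
      rw [integral_indicator measurableSet_ball]; simp
    rw [this]
    refine integral_mono ((integrable_indicator_iff measurableSet_ball).2 (hib _)) hi fun z => ?_
    by_cases hz : z ∈ ball x r1
    · rw [indicator_of_mem hz, hin z hz]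
    · rw [indicator_of_notMem hz]; exact (h01 z).1
  · have : m.real (ball x r2) = ∫ z, (ball x r2).indicator (fun _ => (1:ℝ)) z ∂m := by
      rw [integral_indicator measurableSet_ball]; simp
    rw [this]
    refine integral_mono hi ((integrable_indicator_iff measurableSet_ball).2 (hib _)) fun z => ?_
    by_cases hz : z ∈ ball x r2
    · rw [indicator_of_mem hz]; exact (h01 z).2
    · rw [indicator_of_notMem hz, hout z hz]

theorem aux_lim_le {𝒰 : Ultrafilter ℕ} {μ : ℕ → Measure V}
    (hμ : ∀ n, IsLocallyFiniteMeasure (μ n)) {ν : Measure V} (hν : IsLocallyFiniteMeasure ν)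
    (hlim : ∀ f : V → ℝ, Continuous f → HasCompactSupport f →
      Tendsto (fun n => ∫ x, f x ∂(μ n)) 𝒰 (𝓝 (∫ x, f x ∂ν)))
    (x : V) {r1 r2 : ℝ} (h : r1 < r2) {C : ℝ}
    (hC : ∀ᶠ n in (𝒰 : Filter ℕ), (μ n).real (ball x r2) ≤ C) : ν.real (ball x r1) ≤ C := by
  obtain ⟨f, hf, hc, hm⟩ := aux_cutoff x h
  refine (hm ν hν).1.trans (le_of_tendsto (hlim f hf hc) ?_)
  filter_upwards [hC] with n hn
  exact (hm _ (hμ n)).2.trans hn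

theorem aux_le_lim {𝒰 : Ultrafilter ℕ} {μ : ℕ → Measure V}
    (hμ : ∀ n, IsLocallyFiniteMeasure (μ n)) {ν : Measure V} (hν : IsLocallyFiniteMeasure ν)
    (hlim : ∀ f : V → ℝ, Continuous f → HasCompactSupport f →
      Tendsto (fun n => ∫ x, f x ∂(μ n)) 𝒰 (𝓝 (∫ x, f x ∂ν)))
    (x : V) {r1 r2 : ℝ} (h : r1 < r2) {C : ℝ}
    (hC : ∀ᶠ n in (𝒰 : Filter ℕ), C ≤ (μ n).real (ball x r1)) : C ≤ ν.real (ball x r2) := by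
  obtain ⟨f, hf, hc, hm⟩ := aux_cutoff x h
  refine le_trans (ge_of_tendsto (hlim f hf hc) ?_) (hm ν hν).2
  filter_upwards [hC] with n hn
  exact hn.trans (hm _ (hμ n)).1

theorem aux_left_cont (ν : Measure V) [IsLocallyFiniteMeasure ν] (x : V) {r C : ℝ}
    (h : ∀ r1 < r, ν.real (ball x r1) ≤ C) : ν.real (ball x r) ≤ C := by
  have hmono : Monotone (fun n : ℕ => ball x (r - 1 / ((n : ℝ) + 1))) := by
    intro m n hmn
    apply ball_subset_ball
    have := one_div_le_one_div_of_le (by positivity : (0:ℝ) < (m:ℝ) + 1)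
      (by exact_mod_cast Nat.succ_le_succ hmn : (m:ℝ) + 1 ≤ n + 1)
    linarith
  have hU : ⋃ n : ℕ, ball x (r - 1 / ((n : ℝ) + 1)) = ball x r := by
    ext z
    simp only [mem_iUnion, mem_ball]
    constructor
    · rintro ⟨n, hn⟩
      have : (0:ℝ) < 1 / ((n:ℝ) + 1) := by positivity
      linarith
    · intro hz
      obtain ⟨n, hn⟩ := exists_nat_one_div_lt (sub_pos.2 hz)
      exact ⟨n, by linarith⟩
  have ht := tendsto_measure_iUnion_atTop (μ := ν) hmono
  rw [hU] at ht
  have ht2 := (ENNReal.tendsto_toReal (measure_ball_lt_top (μ := ν) (x := x) (r := r)).ne).comp ht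
  refine le_of_tendsto' ht2 fun n => h _ ?_
  have : (0:ℝ) < 1 / ((n:ℝ) + 1) := by positivity
  linarith

theorem aux_exists_mem_support (ν : Measure V) {x : V} {ε : ℝ} (h : 0 < ν.real (ball x ε)) :
    ∃ y ∈ ν.support, dist y x < ε := by
  have h0 : 0 < ν (ball x ε) := by
    by_contra h1
    have : ν (ball x ε) = 0 := by simpa using h1
    simp [Measure.real, this] at h
  obtain ⟨y, hy1, hy2⟩ := Measure.nonempty_inter_support_of_pos h0
  exact ⟨y, hy2, hy1⟩

theorem aux_support_pos (ν : Measure V) [IsLocallyFiniteMeasure ν] {x : V} (hx : x ∈ ν.support)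
    {ε : ℝ} (hε : 0 < ε) : 0 < ν.real (ball x ε) := by
  have := (Measure.mem_support_iff_forall x).1 hx _ (ball_mem_nhds x hε)
  exact ENNReal.toReal_pos this.ne' measure_ball_lt_top.ne

end Part1

open MeasureTheory Metric
open scoped ENNReal NNReal
open Filter Topology Set
set_option linter.unusedSectionVars false

section Part2
variable {V : Type*} [NormedAddCommGroup V] [InnerProductSpace ℝ V] [FiniteDimensional ℝ V]
  [MeasurableSpace V] [BorelSpace V]

theorem aux_iter {μ : Measure V} {x : V}
    (h : ∀ r > 0, μ.real (ball x (2 * r)) = 2 * μ.real (ball x r)) (k : ℕ) {r : ℝ} (hr : 0 < r) :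
    μ.real (ball x (2 ^ k * r)) = 2 ^ k * μ.real (ball x r) := by
  induction k with
  | zero => simp
  | succ k ih =>
    rw [pow_succ', mul_assoc, h _ (by positivity), ih]; ring

theorem aux_T1 (μ : Measure V) [IsLocallyFiniteMeasure μ]
    (h : ∀ x ∈ μ.support, ∀ r > 0, μ.real (ball x (2 * r)) = 2 * μ.real (ball x r))
    {x y : V} (hx : x ∈ μ.support) (hy : y ∈ μ.support) (r : ℝ) :
    μ.real (ball x r) = μ.real (ball y r) := by
  have key : ∀ x ∈ μ.support, ∀ y ∈ μ.support, ∀ r, μ.real (ball y r) ≤ μ.real (ball x r) := by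
    intro x hx y hy r
    refine aux_left_cont μ y fun r1 hr1 => ?_
    rcases le_or_gt r1 0 with h0 | h0
    · rw [ball_eq_empty.2 h0]; simp
    obtain ⟨k, hk⟩ := pow_unbounded_of_one_lt (dist x y / (r - r1)) (one_lt_two : (1:ℝ) < 2)
    have hr0 : 0 < r - r1 := by linarith
    rw [div_lt_iff₀ hr0] at hk
    have h1 := aux_iter (h x hx) k (h0.trans hr1)
    have h2 := aux_iter (h y hy) k h0
    have h3 : μ.real (ball y (2 ^ k * r1)) ≤ μ.real (ball x (2 ^ k * r)) := by
      refine aux_real_ball_mono μ x (2 ^ k * r) ball_subset_closedBall (ball_subset_ball' ?_)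
      rw [dist_comm]; nlinarith
    rw [h1, h2] at h3
    exact le_of_mul_le_mul_left h3 (by positivity)
  exact le_antisymm (key y hy x hx r) (key x hx y hy r)

theorem aux_ext_Iio (m m' : Measure ℝ) (h : ∀ r, m (Iio r) = m' (Iio r))
    (hf : ∀ r, m (Iio r) ≠ ∞) : m = m' := by
  refine Measure.ext_of_generateFrom_of_iUnion (range Iio) (fun n : ℕ => Iio (n : ℝ)) ?_
    (by
      have := isPiSystem_Iio (α := ℝ)
      exact this) ?_ (fun i => ⟨_, rfl⟩) (fun i => hf _) ?_
  · rw [← borel_eq_generateFrom_Iio]; exact BorelSpace.measurable_eq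
  · refine eq_univ_of_forall fun x => ?_
    obtain ⟨n, hn⟩ := exists_nat_gt x
    exact mem_iUnion.2 ⟨n, hn⟩
  · rintro _ ⟨r, rfl⟩; exact h r

theorem aux_map_norm_Iio (μ : Measure V) (x : V) (r : ℝ) :
    (μ.map (fun z => ‖z - x‖)) (Iio r) = μ (ball x r) := by
  rw [Measure.map_apply (by fun_prop) measurableSet_Iio]
  congr 1
  ext z; simp [mem_ball, dist_eq_norm]

theorem aux_radial (μ : Measure V) [IsLocallyFiniteMeasure μ] {x : V}
    (h : ∀ r, μ (ball x r) = μ (ball 0 r)) :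
    μ.map (fun z => ‖z - x‖) = μ.map (fun z => ‖z‖) := by
  have h0 := aux_map_norm_Iio μ 0
  simp only [sub_zero] at h0
  refine aux_ext_Iio _ _ (fun r => ?_) fun r => ?_
  · rw [aux_map_norm_Iio, h0, h]
  · rw [aux_map_norm_Iio]; exact measure_ball_lt_top.ne

theorem aux_scale (μ : Measure V) [IsLocallyFiniteMeasure μ]
    (h : ∀ r > 0, μ (ball 0 (2 * r)) = 2 * μ (ball 0 r)) :
    (μ.map (fun z => ‖z‖)).map (fun ρ => ρ / 2) = (2 : ℝ≥0∞) • μ.map (fun z => ‖z‖) := by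
  have h0 := aux_map_norm_Iio μ 0
  simp only [sub_zero] at h0
  have h1 : ∀ r, ((μ.map (fun z => ‖z‖)).map (fun ρ => ρ / 2)) (Iio r) = μ (ball 0 (2 * r)) := by
    intro r
    rw [Measure.map_apply (by fun_prop) measurableSet_Iio, ← h0]
    congr 1
    ext z; simp only [mem_preimage, mem_Iio]; rw [div_lt_iff₀ two_pos, mul_comm]
  refine aux_ext_Iio _ _ (fun r => ?_) fun r => ?_
  · rw [h1, Measure.smul_apply, h0, smul_eq_mul]
    rcases le_or_gt r 0 with hr | hr
    · rw [ball_eq_empty.2 hr, ball_eq_empty.2 (by linarith)]; simp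
    · exact h r hr
  · rw [h1]; exact measure_ball_lt_top.ne

theorem aux_growth (μ : Measure V) [IsLocallyFiniteMeasure μ]
    (h : ∀ r > 0, μ (ball 0 (2 * r)) = 2 * μ (ball 0 r)) (n : ℕ) :
    μ (ball 0 ((n : ℝ) + 1)) ≤ ENNReal.ofReal (2 * μ.real (ball 0 1) * (n + 1)) := by
  have hr : ∀ r > 0, μ.real (ball 0 (2 * r)) = 2 * μ.real (ball 0 r) := fun r hr => by
    simp [Measure.real, h r hr]
  obtain ⟨k, hk1, hk2⟩ := exists_nat_pow_near (x := (n:ℝ) + 1) (y := 2) (by simp) one_lt_two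
  have h1 := aux_iter hr (k + 1) one_pos
  rw [mul_one] at h1
  have h2 : μ.real (ball 0 ((n : ℝ) + 1)) ≤ μ.real (ball 0 (2 ^ (k + 1))) :=
    aux_real_ball_mono μ 0 (2 ^ (k+1)) ball_subset_closedBall (ball_subset_ball hk2.le)
  have h3 : μ.real (ball 0 ((n : ℝ) + 1)) ≤ 2 * μ.real (ball 0 1) * (n + 1) := by
    have h4 : 0 ≤ μ.real (ball (0:V) 1) := measureReal_nonneg
    rw [h1, pow_succ] at h2
    nlinarith
  rw [← ENNReal.ofReal_toReal (measure_ball_lt_top (μ := μ) (x := (0:V)) (r := (n:ℝ)+1)).ne]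
  exact ENNReal.ofReal_le_ofReal h3

theorem aux_integrable (μ : Measure V) [IsLocallyFiniteMeasure μ]
    (h : ∀ r > 0, μ (ball 0 (2 * r)) = 2 * μ (ball 0 r)) {f : V → ℝ}
    (hf : AEStronglyMeasurable f μ) {K : ℝ} (hK : ∀ z, ‖f z‖ ≤ K / (1 + ‖z‖) ^ 4) :
    Integrable f μ := by
  refine ⟨hf, ?_⟩
  have hK0 : 0 ≤ K := by
    have := (norm_nonneg _).trans (hK 0)
    simpa using this
  have hpt : ∀ z, ‖f z‖ₑ ≤ ∑' n : ℕ, (ball (0:V) ((n:ℝ) + 1)).indicator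
      (fun _ => ENNReal.ofReal (K * 16 / ((n:ℝ) + 1) ^ 4)) z := by
    intro z
    refine le_trans ?_ (ENNReal.le_tsum ⌊‖z‖⌋₊)
    have hmem : z ∈ ball (0:V) ((⌊‖z‖⌋₊ : ℝ) + 1) := by
      simpa using Nat.lt_floor_add_one ‖z‖
    rw [indicator_of_mem hmem, ← ofReal_norm]
    refine ENNReal.ofReal_le_ofReal ((hK z).trans ?_)
    have hfl := Nat.floor_le (norm_nonneg z)
    rw [div_le_div_iff₀ (by positivity) (by positivity)]
    have : ((⌊‖z‖⌋₊ : ℝ) + 1) ^ 4 ≤ (1 + ‖z‖) ^ 4 := by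
      refine pow_le_pow_left₀ (by positivity) ?_ 4
      linarith
    nlinarith [pow_nonneg (add_nonneg zero_le_one (norm_nonneg z)) 4]
  refine (lintegral_mono hpt).trans_lt ?_
  rw [lintegral_tsum (fun n => (measurable_const.indicator measurableSet_ball).aemeasurable)]
  have hterm : ∀ n : ℕ, ∫⁻ z, (ball (0:V) ((n:ℝ) + 1)).indicator
      (fun _ => ENNReal.ofReal (K * 16 / ((n:ℝ) + 1) ^ 4)) z ∂μ ≤
      ENNReal.ofReal (32 * K * μ.real (ball 0 1) * (1 / ((n + 1 : ℕ):ℝ) ^ 3)) := by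
    intro n
    rw [lintegral_indicator measurableSet_ball, setLIntegral_const]
    refine (mul_le_mul_right (aux_growth μ h n) _).trans ?_
    rw [← ENNReal.ofReal_mul (by positivity)]
    refine ENNReal.ofReal_le_ofReal (le_of_eq ?_)
    push_cast
    field_simp
    ring
  refine (ENNReal.tsum_le_tsum hterm).trans_lt ?_
  have hs : Summable (fun n : ℕ => 32 * K * μ.real (ball (0:V) 1) * (1 / ((n + 1 : ℕ):ℝ) ^ 3)) := by
    refine Summable.mul_left _ ?_
    exact (summable_nat_add_iff 1).2 (Real.summable_one_div_nat_pow.2 (by norm_num))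
  exact (Ne.lt_top (by exact hs.tsum_ofReal_ne_top))

theorem aux_exp_bound (s : ℝ) (hs : 0 < s) (n : ℕ) : ∃ K : ℝ, ∀ ρ : ℝ, 0 ≤ ρ →
    (1 + ρ) ^ n * Real.exp (-(s * ρ ^ 2)) ≤ K / (1 + ρ) ^ 4 := by
  refine ⟨(n + 4).factorial * Real.exp (1 + 1 / s), fun ρ hρ => ?_⟩
  rw [le_div_iff₀ (by positivity)]
  have h1 := Real.pow_div_factorial_le_exp (1 + ρ) (by positivity) (n + 4)
  rw [div_le_iff₀ (by positivity)] at h1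
  have h2 : Real.exp (-(s * ρ ^ 2)) ≤ Real.exp (1 / s - 2 * ρ) := by
    apply Real.exp_le_exp.2
    have : 0 ≤ s * (ρ - 1 / s) ^ 2 := by positivity
    have h3 : s * (ρ - 1 / s) ^ 2 = s * ρ ^ 2 - 2 * ρ + 1 / s := by field_simp; ring
    linarith
  calc (1 + ρ) ^ n * Real.exp (-(s * ρ ^ 2)) * (1 + ρ) ^ 4
      = (1 + ρ) ^ (n + 4) * Real.exp (-(s * ρ ^ 2)) := by ring
    _ ≤ (Real.exp (1 + ρ) * (n + 4).factorial) * Real.exp (1 / s - 2 * ρ) := by gcongr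
    _ = (n + 4).factorial * Real.exp (1 + 1 / s - ρ) := by
        rw [mul_right_comm, ← Real.exp_add]; ring_nf
    _ ≤ _ := by gcongr; linarith

theorem aux_int_gauss (μ : Measure V) [IsLocallyFiniteMeasure μ]
    (h : ∀ r > 0, μ (ball 0 (2 * r)) = 2 * μ (ball 0 r)) {s : ℝ} (hs : 0 < s) {p : V → ℝ}
    (hp : Continuous p) (n : ℕ) {C : ℝ} (hC : ∀ z, |p z| ≤ C * (1 + ‖z‖) ^ n) :
    Integrable (fun z => p z * Real.exp (-(s * ‖z‖ ^ 2))) μ := by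
  obtain ⟨K, hK⟩ := aux_exp_bound s hs n
  have hC0 : 0 ≤ C := by simpa using (abs_nonneg _).trans (hC 0)
  refine aux_integrable μ h (K := C * K) (by
    apply Continuous.aestronglyMeasurable; fun_prop) fun z => ?_
  rw [norm_mul, Real.norm_eq_abs, Real.norm_eq_abs, Real.abs_exp]
  calc |p z| * Real.exp (-(s * ‖z‖ ^ 2)) ≤ C * (1 + ‖z‖) ^ n * Real.exp (-(s * ‖z‖ ^ 2)) := by
        gcongr; exact hC z
    _ ≤ C * (K / (1 + ‖z‖) ^ 4) := by
        rw [mul_assoc]; exact mul_le_mul_of_nonneg_left (hK _ (norm_nonneg z)) hC0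
    _ = _ := by ring

theorem aux_int_pow (μ : Measure V) [IsLocallyFiniteMeasure μ]
    (h : ∀ r > 0, μ (ball 0 (2 * r)) = 2 * μ (ball 0 r)) {s : ℝ} (hs : 0 < s) (k : ℕ) :
    Integrable (fun z => ‖z‖ ^ k * Real.exp (-(s * ‖z‖ ^ 2))) μ := by
  refine aux_int_gauss μ h hs (p := fun z => ‖z‖ ^ k) (by fun_prop) k (C := 1) fun z => ?_
  rw [abs_of_nonneg (by positivity), one_mul]
  gcongr; linarith

theorem aux_moment_scale (μ : Measure V) [IsLocallyFiniteMeasure μ]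
    (h : ∀ r > 0, μ (ball 0 (2 * r)) = 2 * μ (ball 0 r)) (s : ℝ) (k : ℕ) :
    ∫ z, ‖z‖ ^ k * Real.exp (-(s / 4 * ‖z‖ ^ 2)) ∂μ =
      2 ^ (k + 1) * ∫ z, ‖z‖ ^ k * Real.exp (-(s * ‖z‖ ^ 2)) ∂μ := by
  have e1 : ∀ φ : ℝ → ℝ, Continuous φ → ∫ z, φ ‖z‖ ∂μ = ∫ ρ, φ ρ ∂(μ.map (fun z => ‖z‖)) := by
    intro φ hφ
    rw [integral_map (by fun_prop) hφ.aestronglyMeasurable]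
  rw [e1 (fun ρ => ρ ^ k * Real.exp (-(s / 4 * ρ ^ 2))) (by fun_prop),
    e1 (fun ρ => ρ ^ k * Real.exp (-(s * ρ ^ 2))) (by fun_prop)]
  have h2 : ∫ ρ, (2 * ρ) ^ k * Real.exp (-(s * ρ ^ 2)) ∂((μ.map (fun z => ‖z‖)).map (fun ρ => ρ / 2))
      = ∫ ρ, ρ ^ k * Real.exp (-(s / 4 * ρ ^ 2)) ∂(μ.map (fun z => ‖z‖)) := by
    rw [integral_map (by fun_prop) (by apply Continuous.aestronglyMeasurable; fun_prop)]
    refine integral_congr_ae (Eventually.of_forall fun ρ => ?_)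
    simp only
    congr 1
    · congr 1; ring
    · congr 1; ring
  rw [← h2, aux_scale μ h, integral_smul_measure]
  simp only [mul_pow, mul_assoc, integral_const_mul]
  simp [pow_succ]; ring

theorem aux_zero_pos (μ : Measure V) [IsLocallyFiniteMeasure μ]
    (h : ∀ r > 0, μ (ball 0 (2 * r)) = 2 * μ (ball 0 r)) (h0 : (0:V) ∈ μ.support)
    {s : ℝ} (hs : 0 < s) : 0 < ∫ z, Real.exp (-(s * ‖z‖ ^ 2)) ∂μ := by
  have hi : Integrable (fun z : V => Real.exp (-(s * ‖z‖ ^ 2))) μ := by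
    simpa using aux_int_pow μ h hs 0
  rw [integral_pos_iff_support_of_nonneg (fun z => (Real.exp_pos _).le) hi]
  have : Function.support (fun z : V => Real.exp (-(s * ‖z‖ ^ 2))) = univ := by
    ext z; simp [Real.exp_ne_zero]
  rw [this]
  exact (Measure.mem_support_iff_forall _).1 h0 _ univ_mem

theorem aux_exists_s (μ : Measure V) [IsLocallyFiniteMeasure μ]
    (h : ∀ r > 0, μ (ball 0 (2 * r)) = 2 * μ (ball 0 r)) :
    ∃ s : ℝ, 0 < s ∧ 2 * s * ∫ z, ‖z‖ ^ 2 * Real.exp (-(s * ‖z‖ ^ 2)) ∂μ =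
      ∫ z, Real.exp (-(s * ‖z‖ ^ 2)) ∂μ := by
  let I : ℝ → ℝ := fun u => ∫ z, Real.exp (-(u ^ 2 * ‖z‖ ^ 2)) ∂μ
  have hd : ∀ u : ℝ, 0 < u → HasDerivAt I
      (∫ z, -(2 * u * ‖z‖ ^ 2) * Real.exp (-(u ^ 2 * ‖z‖ ^ 2)) ∂μ) u := by
    intro u hu
    have hball : Ioo (u / 2) (2 * u) ∈ 𝓝 u := Ioo_mem_nhds (by linarith) (by linarith)
    refine (hasDerivAt_integral_of_dominated_loc_of_deriv_le (μ := μ)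
      (bound := fun z => 4 * u * (‖z‖ ^ 2 * Real.exp (-((u / 2) ^ 2 * ‖z‖ ^ 2))))
      (F := fun u z => Real.exp (-(u ^ 2 * ‖z‖ ^ 2)))
      (F' := fun u z => -(2 * u * ‖z‖ ^ 2) * Real.exp (-(u ^ 2 * ‖z‖ ^ 2)))
      hball ?_ ?_ ?_ ?_ ?_ ?_).2
    · exact Eventually.of_forall fun x => by apply Continuous.aestronglyMeasurable; fun_prop
    · simpa using aux_int_pow μ h (pow_pos hu 2) 0
    · apply Continuous.aestronglyMeasurable; fun_prop
    · refine Eventually.of_forall fun z x hx => ?_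
      have hx0 : 0 < x := by have := hx.1; linarith
      rw [norm_mul, norm_neg, Real.norm_eq_abs, Real.norm_eq_abs, Real.abs_exp,
        abs_of_nonneg (by positivity)]
      have h1 : Real.exp (-(x ^ 2 * ‖z‖ ^ 2)) ≤ Real.exp (-((u / 2) ^ 2 * ‖z‖ ^ 2)) := by
        apply Real.exp_le_exp.2
        have : (u / 2) ^ 2 ≤ x ^ 2 := by
          have := hx.1; gcongr
        nlinarith [sq_nonneg ‖z‖]
      calc 2 * x * ‖z‖ ^ 2 * Real.exp (-(x ^ 2 * ‖z‖ ^ 2)) ≤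
          2 * (2 * u) * ‖z‖ ^ 2 * Real.exp (-((u / 2) ^ 2 * ‖z‖ ^ 2)) := by
            have := hx.2.le
            gcongr
        _ = _ := by ring
    · exact (aux_int_pow μ h (by positivity) 2).const_mul _
    · refine Eventually.of_forall fun z x hx => ?_
      have h1 : HasDerivAt (fun x : ℝ => -(x ^ 2 * ‖z‖ ^ 2)) (-(2 * x * ‖z‖ ^ 2)) x := by
        have := ((hasDerivAt_pow 2 x).mul_const (‖z‖ ^ 2)).fun_neg
        refine this.congr_deriv ?_
        simp
      exact h1.exp.congr_deriv (mul_comm _ _)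
  have hF : ∀ u : ℝ, 0 < u → HasDerivAt (fun u => u * I u)
      (1 * I u + u * ∫ z, -(2 * u * ‖z‖ ^ 2) * Real.exp (-(u ^ 2 * ‖z‖ ^ 2)) ∂μ) u :=
    fun u hu => (hasDerivAt_id u).mul (hd u hu)
  have hends : (1:ℝ) * I 1 = 2 * I 2 := by
    have := aux_moment_scale μ h 4 0
    simp only [pow_zero, one_mul, zero_add, pow_one] at this
    simp only [I]
    norm_num at this ⊢
    exact this
  obtain ⟨u, hu, hz⟩ := exists_hasDerivAt_eq_zero (f := fun u => u * I u) one_lt_two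
    (fun u hu => ((hF u (by linarith [hu.1])).continuousAt).continuousWithinAt) hends
    (fun u hu => hF u (by linarith [hu.1]))
  refine ⟨u ^ 2, by have := hu.1; positivity, ?_⟩
  have e : ∫ z, -(2 * u * ‖z‖ ^ 2) * Real.exp (-(u ^ 2 * ‖z‖ ^ 2)) ∂μ =
      -(2 * u) * ∫ z, ‖z‖ ^ 2 * Real.exp (-(u ^ 2 * ‖z‖ ^ 2)) ∂μ := by
    rw [← integral_const_mul]; congr 1; ext z; ring
  rw [e] at hz
  simp only [I] at hz
  linarith
end Part2

open MeasureTheory Metric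
open scoped ENNReal NNReal
open Filter Topology Set
set_option linter.unusedSectionVars false

section Part3
variable {V : Type*} [NormedAddCommGroup V] [InnerProductSpace ℝ V] [FiniteDimensional ℝ V]
  [MeasurableSpace V] [BorelSpace V]

theorem aux_exp3 (w : ℝ) :
    |Real.exp w - 1 - w - w ^ 2 / 2| ≤ 3 * |w| ^ 3 * (1 + Real.exp w) := by
  have key : |Real.exp w - 1 - w - w ^ 2 / 2| ≤ |w| ^ 3 * Real.exp |w| := by
    have h := Complex.norm_exp_sub_sum_le_norm_mul_exp (w : ℂ) 3
    have e : Complex.exp (w : ℂ) - ∑ m ∈ Finset.range 3, (w : ℂ) ^ m / (m.factorial : ℂ) =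
        ((Real.exp w - 1 - w - w ^ 2 / 2 : ℝ) : ℂ) := by
      simp [Finset.sum_range_succ]
      ring
    rw [e, Complex.norm_real, Complex.norm_real] at h
    exact h
  have hp := Real.exp_pos w
  have h3 : 0 ≤ |w| ^ 3 := by positivity
  rcases le_or_gt 0 w with hw | hw
  · rw [abs_of_nonneg hw] at key h3 ⊢
    nlinarith
  · rcases le_or_gt (-1) w with hw1 | hw1
    · have : Real.exp |w| ≤ 3 := by
        rw [abs_of_neg hw]
        have := Real.exp_one_lt_d9
        have h2 : Real.exp (-w) ≤ Real.exp 1 := Real.exp_le_exp.2 (by linarith)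
        linarith
      nlinarith
    · rw [abs_of_neg hw]
      have hle : Real.exp w ≤ 1 := Real.exp_le_one_iff.2 hw.le
      have h5 : |Real.exp w - 1 - w - w ^ 2 / 2| ≤ 3 * (-w) ^ 3 := by
        have : (-w) ^ 3 ≥ (-w)^2 := by nlinarith [sq_nonneg w]
        have : (-w) ^ 2 ≥ -w := by nlinarith
        rw [abs_le]; constructor <;> nlinarith
      nlinarith [pow_pos (neg_pos.2 hw) 3]

/-- Gaussian moments. -/
noncomputable def aGM (μ : Measure V) (k : ℕ) (s : ℝ) : ℝ :=
  ∫ z, ‖z‖ ^ k * Real.exp (-(s * ‖z‖ ^ 2)) ∂μ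

theorem aux_radial_int (μ : Measure V) [IsLocallyFiniteMeasure μ] {x : V}
    (h : ∀ r, μ (ball x r) = μ (ball 0 r)) {φ : ℝ → ℝ} (hφ : Continuous φ) :
    ∫ z, φ ‖z - x‖ ∂μ = ∫ z, φ ‖z‖ ∂μ := by
  have h1 : ∫ z, φ ‖z - x‖ ∂μ = ∫ ρ, φ ρ ∂(μ.map (fun z => ‖z - x‖)) := by
    rw [integral_map (by fun_prop) hφ.aestronglyMeasurable]
  have h2 : ∫ z, φ ‖z‖ ∂μ = ∫ ρ, φ ρ ∂(μ.map (fun z => ‖z‖)) := by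
    rw [integral_map (by fun_prop) hφ.aestronglyMeasurable]
  rw [h1, h2, aux_radial μ h]

theorem aux_radial_integrable (μ : Measure V) [IsLocallyFiniteMeasure μ] {x : V}
    (h : ∀ r, μ (ball x r) = μ (ball 0 r)) {φ : ℝ → ℝ} (hφ : Continuous φ)
    (hi : Integrable (fun z => φ ‖z‖) μ) :
    Integrable (fun z => φ ‖z - x‖) μ := by
  have h1 := (integrable_map_measure (μ := μ) (f := fun z : V => ‖z - x‖) (g := φ)
    hφ.aestronglyMeasurable (by fun_prop))
  have h2 := (integrable_map_measure (μ := μ) (f := fun z : V => ‖z‖) (g := φ)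
    hφ.aestronglyMeasurable (by fun_prop))
  rw [aux_radial μ h] at h1
  exact h1.1 (h2.2 hi)

theorem aux_expand (μ : Measure V) [IsLocallyFiniteMeasure μ]
    (h : ∀ r > 0, μ (ball 0 (2 * r)) = 2 * μ (ball 0 r)) {x : V}
    (hx : ∀ r, μ (ball x r) = μ (ball 0 r)) {s : ℝ} (hs : 0 < s) :
    |2 * s * (∫ z, inner ℝ x z * Real.exp (-(s * ‖z‖ ^ 2)) ∂μ)
      + 2 * s ^ 2 * (∫ z, (inner ℝ x z) ^ 2 * Real.exp (-(s * ‖z‖ ^ 2)) ∂μ)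
      - s * ‖x‖ ^ 2 * aGM μ 0 s| ≤
    24 * s ^ 3 * ‖x‖ ^ 3 * (8 * aGM μ 3 s + ‖x‖ ^ 3 * aGM μ 0 s) + 2 * s ^ 2 * ‖x‖ ^ 3 * aGM μ 1 s
      + s ^ 2 * ‖x‖ ^ 4 * aGM μ 0 s / 2 := by
  set a := ‖x‖ with ha
  have ha0 : 0 ≤ a := norm_nonneg x
  set G : V → ℝ := fun z => Real.exp (-(s * ‖z‖ ^ 2)) with hG
  set Gx : V → ℝ := fun z => Real.exp (-(s * ‖z - x‖ ^ 2)) with hGx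
  set w : V → ℝ := fun z => 2 * s * inner ℝ x z - s * a ^ 2 with hw
  have hcw : Continuous w := by fun_prop
  have hwG : ∀ z, Real.exp (w z) * G z = Gx z := by
    intro z
    simp only [hG, hGx, hw]
    rw [← Real.exp_add, norm_sub_sq_real, real_inner_comm]
    congr 1; ring
  have hw0 : ∀ z, w z = s * (‖z‖ ^ 2 - ‖z - x‖ ^ 2) := by
    intro z
    simp only [hw]
    rw [norm_sub_sq_real, real_inner_comm]; ring
  have hw1 : ∀ z, |w z| ≤ s * a * (2 * ‖z‖ + a) := by
    intro z
    rw [hw0, abs_mul, abs_of_pos hs, mul_assoc]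
    refine mul_le_mul_of_nonneg_left ?_ hs.le
    have h1 : ‖z - x‖ ≤ ‖z‖ + a := norm_sub_le z x
    have h2 : ‖z‖ ≤ ‖z - x‖ + a := by
      have := norm_add_le (z - x) x; simpa using this
    have := norm_nonneg z
    have := norm_nonneg (z - x)
    rw [abs_le]; constructor <;> nlinarith
  have hw2 : ∀ z, |w z| ≤ s * a * (2 * ‖z - x‖ + a) := by
    intro z
    rw [hw0, abs_mul, abs_of_pos hs, mul_assoc]
    refine mul_le_mul_of_nonneg_left ?_ hs.le
    have h1 : ‖z - x‖ ≤ ‖z‖ + a := norm_sub_le z x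
    have h2 : ‖z‖ ≤ ‖z - x‖ + a := by
      have := norm_add_le (z - x) x; simpa using this
    have := norm_nonneg z
    have := norm_nonneg (z - x)
    rw [abs_le]; constructor <;> nlinarith
  -- integrability
  have hin : ∀ z, |inner ℝ x z| ≤ a * (1 + ‖z‖) := fun z => by
    have := abs_real_inner_le_norm x z
    nlinarith [norm_nonneg z]
  have hA : ∀ k, Integrable (fun z => ‖z‖ ^ k * G z) μ := aux_int_pow μ h hs
  have iG : Integrable G μ := by simpa using hA 0
  have iP1 : Integrable (fun z => inner ℝ x z * G z) μ :=
    aux_int_gauss μ h hs (by fun_prop) 1 (C := a) (by simpa using hin)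
  have iP2 : Integrable (fun z => (inner ℝ x z) ^ 2 * G z) μ :=
    aux_int_gauss μ h hs (p := fun z => (inner ℝ x z) ^ 2) (by fun_prop) 2 (C := a ^ 2) (fun z => by
      rw [abs_pow, ← mul_pow]
      exact pow_le_pow_left₀ (abs_nonneg _) (hin z) 2)
  let φ : ℝ → ℝ := fun ρ => 3 * (s * a * (2 * ρ + a)) ^ 3 * Real.exp (-(s * ρ ^ 2))
  have hφ : Continuous φ := by fun_prop
  have iφ : Integrable (fun z : V => φ ‖z‖) μ := by
    have e : (fun z : V => φ ‖z‖) = fun z => 3 * (s * a) ^ 3 * (8 * (‖z‖ ^ 3 * G z)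
        + 12 * a * (‖z‖ ^ 2 * G z) + 6 * a ^ 2 * (‖z‖ ^ 1 * G z) + a ^ 3 * (‖z‖ ^ 0 * G z)) := by
      ext z; simp only [φ, hG]; ring
    rw [e]
    exact (((((hA 3).const_mul _).add ((hA 2).const_mul _)).add ((hA 1).const_mul _)).add
      ((hA 0).const_mul _)).const_mul _
  have iφx := aux_radial_integrable μ hx hφ iφ
  have eφx := aux_radial_int μ hx hφ
  have iGx : Integrable Gx μ :=
    aux_radial_integrable μ hx (φ := fun ρ => Real.exp (-(s * ρ ^ 2))) (by fun_prop) iG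
  have eGx : ∫ z, Gx z ∂μ = ∫ z, G z ∂μ :=
    aux_radial_int μ hx (φ := fun ρ => Real.exp (-(s * ρ ^ 2))) (by fun_prop)
  -- upper bound of ∫ φ
  have hφle : ∫ z, φ ‖z‖ ∂μ ≤ 12 * s ^ 3 * a ^ 3 * (8 * aGM μ 3 s + a ^ 3 * aGM μ 0 s) := by
    have e : 12 * s ^ 3 * a ^ 3 * (8 * aGM μ 3 s + a ^ 3 * aGM μ 0 s) =
        ∫ z, 12 * s ^ 3 * a ^ 3 * (8 * (‖z‖ ^ 3 * G z) + a ^ 3 * (‖z‖ ^ 0 * G z)) ∂μ := by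
      rw [integral_const_mul, integral_add ((hA 3).const_mul _) ((hA 0).const_mul _),
        integral_const_mul, integral_const_mul]
      rfl
    rw [e]
    refine integral_mono iφ ((((hA 3).const_mul _).add ((hA 0).const_mul _)).const_mul _)
      fun z => ?_
    simp only [φ]
    have hr := norm_nonneg z
    have hGp : 0 ≤ G z := (Real.exp_pos _).le
    have h1 : (2 * ‖z‖ + a) ^ 3 ≤ 4 * (8 * ‖z‖ ^ 3 + a ^ 3) := by
      have : 0 ≤ (2 * ‖z‖ + a) * (2 * ‖z‖ - a) ^ 2 := by positivity
      nlinarith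
    calc 3 * (s * a * (2 * ‖z‖ + a)) ^ 3 * Real.exp (-(s * ‖z‖ ^ 2))
        = 3 * s ^ 3 * a ^ 3 * G z * (2 * ‖z‖ + a) ^ 3 := by simp only [hG]; ring
      _ ≤ 3 * s ^ 3 * a ^ 3 * G z * (4 * (8 * ‖z‖ ^ 3 + a ^ 3)) := by gcongr
      _ = _ := by ring
  -- main identity
  have iwww : Integrable (fun z => (w z + w z ^ 2 / 2) * G z) μ := by
    have e : (fun z => (w z + w z ^ 2 / 2) * G z) = fun z =>
        (2 * s - 2 * s ^ 2 * a ^ 2) * (inner ℝ x z * G z) + 2 * s ^ 2 * ((inner ℝ x z) ^ 2 * G z)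
          + (s ^ 2 * a ^ 4 / 2 - s * a ^ 2) * G z := by
      ext z; simp only [hw]; ring
    rw [e]
    exact ((iP1.const_mul _).add (iP2.const_mul _)).add (iG.const_mul _)
  have ewww : ∫ z, (w z + w z ^ 2 / 2) * G z ∂μ =
      (2 * s - 2 * s ^ 2 * a ^ 2) * (∫ z, inner ℝ x z * G z ∂μ)
        + 2 * s ^ 2 * (∫ z, (inner ℝ x z) ^ 2 * G z ∂μ)
          + (s ^ 2 * a ^ 4 / 2 - s * a ^ 2) * ∫ z, G z ∂μ := by
    have i12 : Integrable (fun z => (2 * s - 2 * s ^ 2 * a ^ 2) * (inner ℝ x z * G z)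
        + 2 * s ^ 2 * ((inner ℝ x z) ^ 2 * G z)) μ := (iP1.const_mul _).add (iP2.const_mul _)
    rw [← integral_const_mul, ← integral_const_mul, ← integral_const_mul,
      ← integral_add (iP1.const_mul _) (iP2.const_mul _),
      ← integral_add i12 (iG.const_mul _)]
    congr 1
    ext z; simp only [hw]; ring
  have hmain : |∫ z, (w z + w z ^ 2 / 2) * G z ∂μ| ≤ 2 * ∫ z, φ ‖z‖ ∂μ := by
    have e1 : ∫ z, (w z + w z ^ 2 / 2) * G z ∂μ =
        ∫ z, ((w z + w z ^ 2 / 2) * G z - (Gx z - G z)) ∂μ := by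
      have iGG : Integrable (fun z => Gx z - G z) μ := iGx.sub iG
      rw [integral_sub iwww iGG, integral_sub iGx iG, eGx]; ring
    rw [e1, ← Real.norm_eq_abs]
    have e2 : 2 * ∫ z, φ ‖z‖ ∂μ = ∫ z, (φ ‖z‖ + φ ‖z - x‖) ∂μ := by
      rw [integral_add iφ iφx, eφx]; ring
    rw [e2]
    refine norm_integral_le_of_norm_le (iφ.add iφx) (Eventually.of_forall fun z => ?_)
    have hGp : 0 ≤ G z := (Real.exp_pos _).le
    have hGxp : 0 ≤ Gx z := (Real.exp_pos _).le
    have e3 : (w z + w z ^ 2 / 2) * G z - (Gx z - G z) =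
        -((Real.exp (w z) - 1 - w z - w z ^ 2 / 2) * G z) := by
      rw [← hwG]; ring
    rw [e3, norm_neg, norm_mul, Real.norm_eq_abs, Real.norm_eq_abs, abs_of_nonneg hGp]
    calc |Real.exp (w z) - 1 - w z - w z ^ 2 / 2| * G z
        ≤ 3 * |w z| ^ 3 * (1 + Real.exp (w z)) * G z :=
          mul_le_mul_of_nonneg_right (aux_exp3 _) hGp
      _ = 3 * |w z| ^ 3 * G z + 3 * |w z| ^ 3 * Gx z := by rw [← hwG]; ring
      _ ≤ _ := by
          simp only [φ]
          have h1 := pow_le_pow_left₀ (abs_nonneg _) (hw1 z) 3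
          have h2 := pow_le_pow_left₀ (abs_nonneg _) (hw2 z) 3
          exact add_le_add (mul_le_mul_of_nonneg_right (by linarith) hGp)
            (mul_le_mul_of_nonneg_right (by linarith) hGxp)
  have eA0 : aGM μ 0 s = ∫ z, G z ∂μ := by simp [aGM, hG]
  have hP1 : |∫ z, inner ℝ x z * G z ∂μ| ≤ a * aGM μ 1 s := by
    rw [aGM, ← integral_const_mul, ← Real.norm_eq_abs]
    refine norm_integral_le_of_norm_le ((hA 1).const_mul _) (Eventually.of_forall fun z => ?_)
    rw [norm_mul, Real.norm_eq_abs, Real.norm_eq_abs, abs_of_nonneg (Real.exp_pos _).le, pow_one,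
      ← mul_assoc]
    exact mul_le_mul_of_nonneg_right (abs_real_inner_le_norm x z) (Real.exp_pos _).le
  have hA0 : 0 ≤ ∫ z, G z ∂μ := integral_nonneg fun z => (Real.exp_pos _).le
  rw [ewww] at hmain
  rw [eA0] at hφle ⊢
  have hb := hmain.trans (mul_le_mul_of_nonneg_left hφle two_pos.le)
  rw [abs_le] at hb hP1 ⊢
  have hc : 0 ≤ 2 * s ^ 2 * a ^ 2 := by positivity
  have hd1 := mul_le_mul_of_nonneg_left hP1.1 hc
  have hd2 := mul_le_mul_of_nonneg_left hP1.2 hc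
  have hd3 : 0 ≤ s ^ 2 * a ^ 4 * ∫ z, G z ∂μ := by positivity
  constructor
  · nlinarith [hb.1]
  · nlinarith [hb.2]

theorem aux_aGM_scale (μ : Measure V) [IsLocallyFiniteMeasure μ]
    (h : ∀ r > 0, μ (ball 0 (2 * r)) = 2 * μ (ball 0 r)) (s : ℝ) (k j : ℕ) :
    aGM μ k (s / 4 ^ j) = (2 ^ (k + 1)) ^ j * aGM μ k s := by
  induction j with
  | zero => simp
  | succ j ih =>
    have := aux_moment_scale μ h (s / 4 ^ j) k
    unfold aGM at *
    rw [pow_succ, ← div_div, this, ih]; ring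
end Part3

open MeasureTheory Metric
open scoped ENNReal NNReal
open Filter Topology Set
set_option linter.unusedSectionVars false

section Part4
variable {V : Type*} [NormedAddCommGroup V] [InnerProductSpace ℝ V] [FiniteDimensional ℝ V]
  [MeasurableSpace V] [BorelSpace V]

/-- Normalized second moments. -/
noncomputable def aQ (μ : Measure V) (s : ℝ) (x : V) : ℝ :=
  2 * s * (∫ z, (inner ℝ x z) ^ 2 * Real.exp (-(s * ‖z‖ ^ 2)) ∂μ) / aGM μ 0 s

/-- Normalized first moments. -/
noncomputable def aM (μ : Measure V) (s : ℝ) (x : V) : ℝ :=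
  2 * (∫ z, inner ℝ x z * Real.exp (-(s * ‖z‖ ^ 2)) ∂μ) / aGM μ 0 s

theorem aux_i1 (μ : Measure V) [IsLocallyFiniteMeasure μ]
    (h : ∀ r > 0, μ (ball 0 (2 * r)) = 2 * μ (ball 0 r)) {s : ℝ} (hs : 0 < s) (x : V) :
    Integrable (fun z => inner ℝ x z * Real.exp (-(s * ‖z‖ ^ 2))) μ :=
  aux_int_gauss μ h hs (by fun_prop) 1 (C := ‖x‖) (fun z => by
    have := abs_real_inner_le_norm x z
    nlinarith [norm_nonneg z, norm_nonneg x])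

theorem aux_i2 (μ : Measure V) [IsLocallyFiniteMeasure μ]
    (h : ∀ r > 0, μ (ball 0 (2 * r)) = 2 * μ (ball 0 r)) {s : ℝ} (hs : 0 < s) (x : V) :
    Integrable (fun z => (inner ℝ x z) ^ 2 * Real.exp (-(s * ‖z‖ ^ 2))) μ :=
  aux_int_gauss μ h hs (p := fun z => (inner ℝ x z) ^ 2) (by fun_prop) 2 (C := ‖x‖ ^ 2)
    (fun z => by
      have := abs_real_inner_le_norm x z
      rw [abs_pow, ← mul_pow]
      exact pow_le_pow_left₀ (abs_nonneg _) (by nlinarith [norm_nonneg z, norm_nonneg x]) 2)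

theorem aux_aGM0 (μ : Measure V) (s : ℝ) : aGM μ 0 s = ∫ z, Real.exp (-(s * ‖z‖ ^ 2)) ∂μ := by
  simp [aGM]

theorem aux_MQ (μ : Measure V) [IsLocallyFiniteMeasure μ]
    (h : ∀ r > 0, μ (ball 0 (2 * r)) = 2 * μ (ball 0 r)) {x : V}
    (hx : ∀ r, μ (ball x r) = μ (ball 0 r)) {s : ℝ} (hs : 0 < s) (hA : 0 < aGM μ 0 s) :
    |aM μ s x + aQ μ s x - ‖x‖ ^ 2| ≤
      24 * s ^ 2 * ‖x‖ ^ 3 * (8 * (aGM μ 3 s / aGM μ 0 s) + ‖x‖ ^ 3)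
        + 2 * s * ‖x‖ ^ 3 * (aGM μ 1 s / aGM μ 0 s) + s * ‖x‖ ^ 4 / 2 := by
  have h1 := aux_expand μ h hx hs
  have hsA : 0 < s * aGM μ 0 s := by positivity
  have e1 : aM μ s x + aQ μ s x - ‖x‖ ^ 2 = (2 * s * (∫ z, inner ℝ x z * Real.exp (-(s * ‖z‖ ^ 2)) ∂μ)
      + 2 * s ^ 2 * (∫ z, (inner ℝ x z) ^ 2 * Real.exp (-(s * ‖z‖ ^ 2)) ∂μ)
      - s * ‖x‖ ^ 2 * aGM μ 0 s) / (s * aGM μ 0 s) := by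
    unfold aM aQ; field_simp
  rw [e1, abs_div, abs_of_pos hsA, div_le_iff₀ hsA]
  refine h1.trans (le_of_eq ?_)
  field_simp

theorem aux_Q_nonneg (μ : Measure V) {s : ℝ} (hs : 0 < s) (hA : 0 < aGM μ 0 s) (x : V) :
    0 ≤ aQ μ s x := by
  unfold aQ
  have : 0 ≤ ∫ z, (inner ℝ x z) ^ 2 * Real.exp (-(s * ‖z‖ ^ 2)) ∂μ :=
    integral_nonneg fun z => by positivity
  positivity

theorem aux_Q_diff (μ : Measure V) [IsLocallyFiniteMeasure μ]
    (h : ∀ r > 0, μ (ball 0 (2 * r)) = 2 * μ (ball 0 r)) {s : ℝ} (hs : 0 < s)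
    (hA : 0 < aGM μ 0 s) (hs2 : 2 * s * aGM μ 2 s = aGM μ 0 s) (x y : V) :
    |aQ μ s x - aQ μ s y| ≤ ‖x - y‖ * ‖x + y‖ := by
  have e1 : aQ μ s x - aQ μ s y =
      2 * s * (∫ z, (inner ℝ (x - y) z * inner ℝ (x + y) z) * Real.exp (-(s * ‖z‖ ^ 2)) ∂μ)
        / aGM μ 0 s := by
    have : ∫ z, (inner ℝ (x - y) z * inner ℝ (x + y) z) * Real.exp (-(s * ‖z‖ ^ 2)) ∂μ =
        (∫ z, (inner ℝ x z) ^ 2 * Real.exp (-(s * ‖z‖ ^ 2)) ∂μ) -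
        ∫ z, (inner ℝ y z) ^ 2 * Real.exp (-(s * ‖z‖ ^ 2)) ∂μ := by
      rw [← integral_sub (aux_i2 μ h hs x) (aux_i2 μ h hs y)]
      congr 1; ext z; rw [inner_sub_left, inner_add_left]; ring
    rw [this]; unfold aQ; ring
  have h2 : |∫ z, (inner ℝ (x - y) z * inner ℝ (x + y) z) * Real.exp (-(s * ‖z‖ ^ 2)) ∂μ| ≤
      ‖x - y‖ * ‖x + y‖ * aGM μ 2 s := by
    rw [aGM, ← integral_const_mul, ← Real.norm_eq_abs]
    refine norm_integral_le_of_norm_le ((aux_int_pow μ h hs 2).const_mul _)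
      (Eventually.of_forall fun z => ?_)
    rw [norm_mul, Real.norm_eq_abs, Real.norm_eq_abs, abs_of_nonneg (Real.exp_pos _).le, abs_mul,
      ← mul_assoc]
    refine mul_le_mul_of_nonneg_right ?_ (Real.exp_pos _).le
    calc _ ≤ (‖x - y‖ * ‖z‖) * (‖x + y‖ * ‖z‖) := by
          gcongr <;> exact abs_real_inner_le_norm _ _
      _ = _ := by ring
  rw [e1, abs_div, abs_of_pos hA, div_le_iff₀ hA, abs_mul, abs_of_pos (by positivity : 0 < 2 * s)]
  calc _ ≤ 2 * s * (‖x - y‖ * ‖x + y‖ * aGM μ 2 s) := by gcongr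
    _ = ‖x - y‖ * ‖x + y‖ * (2 * s * aGM μ 2 s) := by ring
    _ = _ := by rw [hs2]

theorem aux_Q_smul (μ : Measure V) (s c : ℝ) (x : V) : aQ μ s (c • x) = c ^ 2 * aQ μ s x := by
  unfold aQ
  have : ∫ z, (inner ℝ (c • x) z) ^ 2 * Real.exp (-(s * ‖z‖ ^ 2)) ∂μ =
      c ^ 2 * ∫ z, (inner ℝ x z) ^ 2 * Real.exp (-(s * ‖z‖ ^ 2)) ∂μ := by
    rw [← integral_const_mul]; congr 1; ext z; rw [real_inner_smul_left]; ring
  rw [this]; ring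

theorem aux_Q_par (μ : Measure V) [IsLocallyFiniteMeasure μ]
    (h : ∀ r > 0, μ (ball 0 (2 * r)) = 2 * μ (ball 0 r)) {s : ℝ} (hs : 0 < s) (x y : V) :
    aQ μ s (x + y) + aQ μ s (x - y) = 2 * aQ μ s x + 2 * aQ μ s y := by
  have : (∫ z, (inner ℝ (x + y) z) ^ 2 * Real.exp (-(s * ‖z‖ ^ 2)) ∂μ)
      + ∫ z, (inner ℝ (x - y) z) ^ 2 * Real.exp (-(s * ‖z‖ ^ 2)) ∂μ =
      2 * (∫ z, (inner ℝ x z) ^ 2 * Real.exp (-(s * ‖z‖ ^ 2)) ∂μ)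
      + 2 * ∫ z, (inner ℝ y z) ^ 2 * Real.exp (-(s * ‖z‖ ^ 2)) ∂μ := by
    rw [← integral_add (aux_i2 μ h hs _) (aux_i2 μ h hs _), ← integral_const_mul,
      ← integral_const_mul, ← integral_add ((aux_i2 μ h hs _).const_mul _)
      ((aux_i2 μ h hs _).const_mul _)]
    congr 1; ext z; rw [inner_sub_left, inner_add_left]; ring
  unfold aQ
  rw [← add_div, ← mul_add, this]; ring

theorem aux_bessel2 {x y : V} (hx : ‖x‖ = 1) (hy : ‖y‖ = 1) (hxy : inner ℝ x y = 0) (z : V) :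
    (inner ℝ x z) ^ 2 + (inner ℝ y z) ^ 2 ≤ ‖z‖ ^ 2 := by
  have h := norm_sub_sq_real z ((inner ℝ x z) • x + (inner ℝ y z) • y)
  have h0 := sq_nonneg ‖z - ((inner ℝ x z) • x + (inner ℝ y z) • y)‖
  have h1 := norm_add_sq_real ((inner ℝ x z : ℝ) • x) ((inner ℝ y z : ℝ) • y)
  rw [norm_smul, norm_smul, hx, hy, real_inner_smul_left, real_inner_smul_right, hxy] at h1
  rw [inner_add_right, real_inner_smul_right, real_inner_smul_right, real_inner_comm x z,
    real_inner_comm y z, h1] at h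
  simp only [mul_one, Real.norm_eq_abs, sq_abs] at h
  nlinarith

theorem aux_Q_ortho (μ : Measure V) [IsLocallyFiniteMeasure μ]
    (h : ∀ r > 0, μ (ball 0 (2 * r)) = 2 * μ (ball 0 r)) {s : ℝ} (hs : 0 < s)
    (hA : 0 < aGM μ 0 s) (hs2 : 2 * s * aGM μ 2 s = aGM μ 0 s) {x y : V}
    (hx : ‖x‖ = 1) (hy : ‖y‖ = 1) (hxy : inner ℝ x y = 0) :
    aQ μ s x + aQ μ s y ≤ 1 := by
  unfold aQ
  rw [← add_div, ← mul_add, div_le_one hA, ← hs2]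
  refine mul_le_mul_of_nonneg_left ?_ (by positivity)
  rw [← integral_add (aux_i2 μ h hs _) (aux_i2 μ h hs _), aGM]
  refine integral_mono ((aux_i2 μ h hs _).add (aux_i2 μ h hs _)) (aux_int_pow μ h hs 2) fun z => ?_
  simp only [Pi.add_apply]
  rw [← add_mul]
  exact mul_le_mul_of_nonneg_right (aux_bessel2 hx hy hxy z) (Real.exp_pos _).le

theorem aux_M_add (μ : Measure V) [IsLocallyFiniteMeasure μ]
    (h : ∀ r > 0, μ (ball 0 (2 * r)) = 2 * μ (ball 0 r)) {s : ℝ} (hs : 0 < s) (x y : V) :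
    aM μ s (x + y) = aM μ s x + aM μ s y := by
  unfold aM
  rw [← add_div, ← mul_add, ← integral_add (aux_i1 μ h hs _) (aux_i1 μ h hs _)]
  congr 2; congr 1; ext z; rw [inner_add_left]; ring

theorem aux_M_smul (μ : Measure V) (s c : ℝ) (x : V) : aM μ s (c • x) = c * aM μ s x := by
  unfold aM
  have : ∫ z, (inner ℝ (c • x) z) * Real.exp (-(s * ‖z‖ ^ 2)) ∂μ =
      c * ∫ z, (inner ℝ x z) * Real.exp (-(s * ‖z‖ ^ 2)) ∂μ := by
    rw [← integral_const_mul]; congr 1; ext z; rw [real_inner_smul_left]; ring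
  rw [this]; ring

theorem aux_T2 (μ : Measure V) [IsLocallyFiniteMeasure μ] (h0 : (0:V) ∈ μ.support)
    (h : ∀ r > 0, μ (ball 0 (2 * r)) = 2 * μ (ball 0 r))
    (hE : ∀ x ∈ μ.support, ∀ r, μ (ball x r) = μ (ball 0 r)) :
    ∃ (Q : V → ℝ) (C : ℝ), (∀ x ∈ μ.support, |‖x‖ ^ 2 - Q x| ≤ C * ‖x‖) ∧
      (∀ x, 0 ≤ Q x) ∧ (∀ x, Q x ≤ ‖x‖ ^ 2) ∧ (∀ (c : ℝ) x, Q (c • x) = c ^ 2 * Q x) ∧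
      (∀ x y, Q (x + y) + Q (x - y) = 2 * Q x + 2 * Q y) ∧
      (∀ x y, ‖x‖ = 1 → ‖y‖ = 1 → inner ℝ x y = 0 → Q x + Q y ≤ 1) ∧
      (∀ x y, |Q x - Q y| ≤ ‖x - y‖ * ‖x + y‖) := by
  obtain ⟨s0, hs0, hs00⟩ := aux_exists_s μ h
  have hA0 : 0 < aGM μ 0 s0 := by rw [aux_aGM0]; exact aux_zero_pos μ h h0 hs0
  rw [← aux_aGM0] at hs00
  change 2 * s0 * aGM μ 2 s0 = aGM μ 0 s0 at hs00
  let s : ℕ → ℝ := fun j => s0 / 4 ^ j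
  have hs : ∀ j, 0 < s j := fun j => by positivity
  have hsc : ∀ k j, aGM μ k (s j) = (2 ^ (k + 1)) ^ j * aGM μ k s0 := fun k j =>
    aux_aGM_scale μ h s0 k j
  have hA : ∀ j, 0 < aGM μ 0 (s j) := fun j => by rw [hsc]; positivity
  have hs2 : ∀ j, 2 * s j * aGM μ 2 (s j) = aGM μ 0 (s j) := fun j => by
    rw [hsc, hsc, ← hs00]
    simp only [s]
    have : ((2:ℝ) ^ (2 + 1)) ^ j = 4 ^ j * (2 ^ (0 + 1)) ^ j := by
      rw [← mul_pow]; norm_num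
    rw [this]; field_simp
  -- error estimate
  have herr : ∀ x ∈ μ.support, ∃ e : ℕ → ℝ, Tendsto e atTop (𝓝 0) ∧
      ∀ j, |aM μ (s j) x + aQ μ (s j) x - ‖x‖ ^ 2| ≤ e j := by
    intro x hx
    refine ⟨fun j => 24 * s0 ^ 2 * ‖x‖ ^ 3 * (8 * (aGM μ 3 s0 / aGM μ 0 s0) * (1 / 2) ^ j
        + ‖x‖ ^ 3 * (1 / 16) ^ j)
        + 2 * s0 * ‖x‖ ^ 3 * (aGM μ 1 s0 / aGM μ 0 s0) * (1 / 2) ^ j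
        + s0 * ‖x‖ ^ 4 / 2 * (1 / 4) ^ j, ?_, fun j => ?_⟩
    · have t : ∀ q : ℝ, 0 ≤ q → q < 1 → Tendsto (fun j : ℕ => q ^ j) atTop (𝓝 0) := fun q h1 h2 =>
        tendsto_pow_atTop_nhds_zero_of_lt_one h1 h2
      have t1 := t (1 / 2) (by norm_num) (by norm_num)
      have t2 := t (1 / 16) (by norm_num) (by norm_num)
      have t3 := t (1 / 4) (by norm_num) (by norm_num)
      have := (((((t1.const_mul (8 * (aGM μ 3 s0 / aGM μ 0 s0))).add
        (t2.const_mul (‖x‖ ^ 3))).const_mul (24 * s0 ^ 2 * ‖x‖ ^ 3)).add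
        (t1.const_mul (2 * s0 * ‖x‖ ^ 3 * (aGM μ 1 s0 / aGM μ 0 s0)))).add
        (t3.const_mul (s0 * ‖x‖ ^ 4 / 2)))
      simpa using this
    · refine (aux_MQ μ h (hE x hx) (hs j) (hA j)).trans (le_of_eq ?_)
      rw [hsc, hsc, hsc]
      simp only [s]
      have e3 : ((2:ℝ) ^ (3 + 1)) ^ j = 2 ^ j * 2 ^ j * 2 ^ j * 2 ^ j := by
        rw [← mul_pow, ← mul_pow, ← mul_pow]; norm_num
      have e1 : ((2:ℝ) ^ (1 + 1)) ^ j = 2 ^ j * 2 ^ j := by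
        rw [← mul_pow]; norm_num
      have e4 : (4:ℝ) ^ j = 2 ^ j * 2 ^ j := by
        rw [← mul_pow]; norm_num
      have e16 : (16:ℝ) ^ j = 2 ^ j * 2 ^ j * 2 ^ j * 2 ^ j := by
        rw [← mul_pow, ← mul_pow, ← mul_pow]; norm_num
      have e0 : ((2:ℝ) ^ (0 + 1)) ^ j = 2 ^ j := by norm_num
      rw [e3, e1, e0, one_div_pow, one_div_pow, one_div_pow, e4, e16]
      field_simp
  have hQle : ∀ j x, aQ μ (s j) x ≤ ‖x‖ ^ 2 := fun j x => by
    have h1 := aux_Q_diff μ h (hs j) (hA j) (hs2 j) x 0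
    have h2 : aQ μ (s j) 0 = 0 := by simp [aQ]
    rw [h2, sub_zero, sub_zero, add_zero] at h1
    have := (abs_le.1 h1).2
    nlinarith
  -- boundedness of first moments
  let S : Submodule ℝ V :=
    { carrier := {x | ∃ C, ∀ j, |aM μ (s j) x| ≤ C}
      add_mem' := by
        rintro x y ⟨C, hC⟩ ⟨D, hD⟩
        refine ⟨C + D, fun j => ?_⟩
        rw [aux_M_add μ h (hs j)]
        exact (abs_add_le _ _).trans (add_le_add (hC j) (hD j))
      zero_mem' := ⟨0, fun j => by simp [aM]⟩
      smul_mem' := by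
        rintro c x ⟨C, hC⟩
        refine ⟨|c| * C, fun j => ?_⟩
        rw [aux_M_smul, abs_mul]
        exact mul_le_mul_of_nonneg_left (hC j) (abs_nonneg _) }
  have hSE : Submodule.span ℝ μ.support ≤ S := by
    refine Submodule.span_le.2 fun x hx => ?_
    obtain ⟨e, he, hej⟩ := herr x hx
    obtain ⟨B, hB⟩ := he.bddAbove_range
    refine ⟨B + 2 * ‖x‖ ^ 2, fun j => ?_⟩
    have h1 := (hej j).trans (hB ⟨j, rfl⟩)
    have h2 := hQle j x
    have h3 := aux_Q_nonneg μ (hs j) (hA j) x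
    rw [abs_le] at h1 ⊢
    constructor <;> nlinarith [sq_nonneg ‖x‖]
  have hSo : (Submodule.span ℝ μ.support)ᗮ ≤ S := by
    intro x hx
    refine ⟨0, fun j => ?_⟩
    have : ∫ z, inner ℝ x z * Real.exp (-(s j * ‖z‖ ^ 2)) ∂μ = 0 := by
      refine integral_eq_zero_of_ae ?_
      filter_upwards [Measure.support_mem_ae (μ := μ)] with z hz
      rw [Submodule.inner_left_of_mem_orthogonal (Submodule.subset_span hz) hx]; simp
    unfold aM
    rw [this]; simp
  have hS : S = ⊤ := by
    rw [eq_top_iff, ← Submodule.sup_orthogonal_of_hasOrthogonalProjection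
      (K := Submodule.span ℝ μ.support)]
    exact sup_le hSE hSo
  let L : ℕ → V →ₗ[ℝ] ℝ := fun j =>
    { toFun := aM μ (s j)
      map_add' := aux_M_add μ h (hs j)
      map_smul' := aux_M_smul μ (s j) }
  obtain ⟨C, hC⟩ := banach_steinhaus (g := fun j => LinearMap.toContinuousLinearMap (L j)) (by
    intro x
    have : x ∈ S := by rw [hS]; trivial
    exact this)
  have hM : ∀ j x, |aM μ (s j) x| ≤ C * ‖x‖ := fun j x => by
    have := (LinearMap.toContinuousLinearMap (L j)).le_of_opNorm_le (hC j) x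
    exact this
  -- ultralimit
  let 𝒰 : Ultrafilter ℕ := hyperfilter ℕ
  have hU : (𝒰 : Filter ℕ) ≤ atTop := by
    rw [← Nat.cofinite_eq_atTop]; exact hyperfilter_le_cofinite
  have hex : ∀ x, ∃ q, Tendsto (fun j => aQ μ (s j) x) 𝒰 (𝓝 q) := by
    intro x
    obtain ⟨q, -, hq⟩ := (isCompact_Icc (a := (0:ℝ)) (b := ‖x‖ ^ 2)).ultrafilter_le_nhds
      (𝒰.map (fun j => aQ μ (s j) x)) (by
        rw [le_principal_iff]
        exact mem_map.2 (Filter.mem_of_superset univ_mem fun j _ =>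
          ⟨aux_Q_nonneg μ (hs j) (hA j) x, hQle j x⟩))
    exact ⟨q, hq⟩
  choose Q hQ using hex
  refine ⟨Q, C, fun x hx => ?_, fun x => ?_, fun x => ?_, fun c x => ?_, fun x y => ?_,
    fun x y hx hy hxy => ?_, fun x y => ?_⟩
  · obtain ⟨e, he, hej⟩ := herr x hx
    have t1 : Tendsto (fun j => |‖x‖ ^ 2 - aQ μ (s j) x|) 𝒰 (𝓝 |‖x‖ ^ 2 - Q x|) :=
      (tendsto_const_nhds.sub (hQ x)).abs
    have t2 : Tendsto (fun j => e j + C * ‖x‖) 𝒰 (𝓝 (0 + C * ‖x‖)) :=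
      (he.mono_left hU).add tendsto_const_nhds
    rw [zero_add] at t2
    refine le_of_tendsto_of_tendsto' t1 t2 fun j => ?_
    have h1 := hej j
    have h2 := hM j x
    rw [abs_le] at h1 h2 ⊢
    constructor <;> linarith
  · exact ge_of_tendsto' (hQ x) fun j => aux_Q_nonneg μ (hs j) (hA j) x
  · exact le_of_tendsto' (hQ x) fun j => hQle j x
  · refine tendsto_nhds_unique (hQ (c • x)) ?_
    simp_rw [aux_Q_smul]
    exact (hQ x).const_mul _
  · refine tendsto_nhds_unique ((hQ (x + y)).add (hQ (x - y))) ?_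
    simp_rw [aux_Q_par μ h (hs _)]
    exact ((hQ x).const_mul _).add ((hQ y).const_mul _)
  · exact le_of_tendsto' ((hQ x).add (hQ y)) fun j =>
      aux_Q_ortho μ h (hs j) (hA j) (hs2 j) hx hy hxy
  · exact le_of_tendsto' ((hQ x).sub (hQ y)).abs fun j =>
      aux_Q_diff μ h (hs j) (hA j) (hs2 j) x y
end Part4

open MeasureTheory Metric
open scoped ENNReal NNReal
open Filter Topology Set
set_option linter.unusedSectionVars false

section Part5
variable {V : Type*} [NormedAddCommGroup V] [InnerProductSpace ℝ V] [FiniteDimensional ℝ V]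
  [MeasurableSpace V] [BorelSpace V]

theorem aux_tend_half (c : ℝ) : Tendsto (fun n : ℕ => c / 2 ^ n) atTop (𝓝 0) := by
  have := (tendsto_pow_atTop_nhds_zero_of_lt_one (r := (1 / 2 : ℝ)) (by norm_num)
    (by norm_num)).const_mul c
  simpa [div_eq_mul_inv] using this

theorem aux_g_half {g : ℝ → ℝ} (h2 : ∀ r > 0, g (2 * r) = 2 * g r) (n : ℕ) :
    g (1 / 2 ^ n) = g 1 / 2 ^ n := by
  induction n with
  | zero => simp
  | succ n ih =>
    have := h2 (1 / 2 ^ (n + 1)) (by positivity)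
    have e : (2:ℝ) * (1 / 2 ^ (n + 1)) = 1 / 2 ^ n := by rw [pow_succ]; field_simp
    rw [e, ih] at this
    generalize g (1 / 2 ^ (n + 1)) = u at this ⊢
    rw [pow_succ]; field_simp at this ⊢; linarith

theorem aux_additive {g : ℝ → ℝ} (hpos : ∀ r > 0, 0 < g r) (hmono : ∀ a b, 0 < a → a ≤ b → g a ≤ g b)
    (hadd : ∀ a b, 0 < a → 0 < b → g (a + b) = g a + g b) {r : ℝ} (hr : 0 < r) :
    g r = r * g 1 := by
  have hn : ∀ n : ℕ, ∀ r > 0, g ((n + 1) * r) = (n + 1) * g r := by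
    intro n r hr
    induction n with
    | zero => simp
    | succ n ih =>
      push_cast
      rw [show ((n:ℝ) + 1 + 1) * r = (n + 1) * r + r by ring, hadd _ _ (by positivity) hr, ih]
      ring
  have key : ∀ n : ℕ, |g r - r * g 1| ≤ g 1 / (n + 1) := by
    intro n
    rw [le_div_iff₀ (by positivity)]
    have hp : 0 < ((n:ℝ) + 1) * r := by positivity
    have h1 := Nat.floor_le hp.le
    have h2 := Nat.lt_floor_add_one (((n:ℝ) + 1) * r)
    set m := ⌊((n:ℝ) + 1) * r⌋₊
    have hg1 := hpos 1 one_pos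
    have u : g (((n:ℝ) + 1) * r) ≤ (m + 1) * g 1 := by
      refine (hmono _ _ hp h2.le).trans ?_
      have := hn m 1 one_pos
      rw [mul_one] at this; exact this.le
    have l : m * g 1 ≤ g (((n:ℝ) + 1) * r) := by
      rcases Nat.eq_zero_or_pos m with hm | hm
      · rw [hm]; simp only [Nat.cast_zero, zero_mul]; exact (hpos _ hp).le
      · obtain ⟨k, hk⟩ := Nat.exists_eq_succ_of_ne_zero hm.ne'
        rw [hk] at h1 ⊢
        have := hn k 1 one_pos
        rw [mul_one] at this
        push_cast at h1 ⊢
        rw [← this]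
        exact hmono _ _ (by positivity) h1
    rw [hn n r hr] at u l
    have hn1 : (0:ℝ) < n + 1 := by positivity
    rw [← abs_of_pos hn1, ← abs_mul, abs_le]
    constructor <;> nlinarith
  have hz : |g r - r * g 1| ≤ 0 := by
    have t := (tendsto_one_div_add_atTop_nhds_zero_nat (𝕜 := ℝ)).const_mul (g 1)
    rw [mul_zero] at t
    refine ge_of_tendsto' t fun n => ?_
    have := key n
    rwa [mul_one_div]
  have := abs_nonpos_iff.1 hz
  linarith

theorem aux_1D (ρ : Measure ℝ) {F : Set ℝ} (hF : IsClosed F) (h0 : (0:ℝ) ∈ F) (hFc : ρ Fᶜ = 0)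
    {g : ℝ → ℝ} (hpos : ∀ r > 0, 0 < g r) (h2 : ∀ r > 0, g (2 * r) = 2 * g r)
    (hρ : ∀ t ∈ F, ∀ r > 0, ρ (Ioo (t - r) (t + r)) = ENNReal.ofReal (g r)) {r : ℝ} (hr : 0 < r) :
    g r = r * g 1 := by
  have hat : ∀ t, ρ {t} = 0 := by
    intro t
    by_cases ht : t ∈ F
    · have h1 : ∀ n : ℕ, ρ {t} ≤ ENNReal.ofReal (g 1 / 2 ^ n) := by
        intro n
        rw [← aux_g_half h2, ← hρ t ht _ (by positivity)]
        refine measure_mono (singleton_subset_iff.2 ?_)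
        have : (0:ℝ) < 1 / 2 ^ n := by positivity
        constructor <;> linarith
      have t1 := ENNReal.tendsto_ofReal (aux_tend_half (g 1))
      rw [ENNReal.ofReal_zero] at t1
      exact le_antisymm (ge_of_tendsto' t1 h1) zero_le
    · exact measure_mono_null (singleton_subset_iff.2 ht) hFc
  have hall : ∀ t > 0, t ∈ F := by
    intro t ht
    by_contra htF
    have hne : (F ∩ Iic t).Nonempty := ⟨0, h0, ht.le⟩
    have hbd : BddAbove (F ∩ Iic t) := ⟨t, fun x hx => hx.2⟩
    have hα := (hF.inter isClosed_Iic).csSup_mem hne hbd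
    set α := sSup (F ∩ Iic t) with hαd
    have hαt : α < t := lt_of_le_of_ne hα.2 (fun h => htF (h ▸ hα.1))
    have hgap : ρ (Ioo α t) = 0 := by
      refine measure_mono_null (t := Fᶜ) (fun x hx hxF => ?_) hFc
      have := le_csSup hbd ⟨hxF, hx.2.le⟩
      exact absurd hx.1 (not_lt.2 this)
    have hr0 : 0 < (t - α) / 2 := by linarith
    have h3 : ρ (Ioo (α - (t - α) / 2) α) ≠ 0 := by
      intro hz
      have h4 := hρ α hα.1 _ hr0
      have h5 : ρ (Ioo (α - (t - α) / 2) (α + (t - α) / 2)) = 0 := by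
        refine measure_mono_null (t := Ioo (α - (t - α) / 2) α ∪ {α} ∪ Ioo α t) ?_
          (measure_union_null (measure_union_null hz (hat α)) hgap)
        intro x hx
        rcases lt_trichotomy x α with h | h | h
        · exact Or.inl (Or.inl ⟨hx.1, h⟩)
        · exact Or.inl (Or.inr h)
        · exact Or.inr ⟨h, by linarith [hx.2]⟩
      rw [h5] at h4
      have := ENNReal.ofReal_pos.2 (hpos _ hr0)
      rw [← h4] at this
      exact lt_irrefl _ this
    obtain ⟨y, hy, hyF⟩ : ∃ y ∈ Ioo (α - (t - α) / 2) α, y ∈ F := by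
      by_contra hcon
      push Not at hcon
      exact h3 (measure_mono_null (fun y hy => hcon y hy) hFc)
    have hr1 : 0 < α - y := by linarith [hy.2]
    have h6 := hρ α hα.1 (2 * (α - y)) (by linarith)
    have h7 := hρ y hyF (α - y) hr1
    have h8 : ρ (Ioo (α - 2 * (α - y)) (α + 2 * (α - y))) ≤ ρ (Ioo (y - (α - y)) (y + (α - y))) := by
      calc _ ≤ ρ (Ioo (y - (α - y)) (y + (α - y)) ∪ ({α} ∪ Ioo α t)) := by
            refine measure_mono fun x hx => ?_
            rcases lt_trichotomy x α with h | h | h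
            · exact Or.inl ⟨by linarith [hx.1], by linarith⟩
            · exact Or.inr (Or.inl h)
            · exact Or.inr (Or.inr ⟨h, by linarith [hx.2, hy.1]⟩)
        _ ≤ ρ (Ioo (y - (α - y)) (y + (α - y))) + ρ ({α} ∪ Ioo α t) := measure_union_le _ _
        _ = _ := by rw [measure_union_null (hat α) hgap, add_zero]
    have hg := hpos _ hr1
    rw [h6, h7, h2 _ hr1, ENNReal.ofReal_le_ofReal_iff hg.le] at h8
    linarith
  have hball : ∀ a b, 0 ≤ a → a < b → ρ (Ioo a b) = ENNReal.ofReal (g ((b - a) / 2)) := by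
    intro a b ha hab
    rw [← hρ ((a + b) / 2) (hall _ (by linarith)) _ (by linarith)]
    congr 2 <;> ring
  refine aux_additive hpos (fun a b ha hab => ?_) (fun a b ha hb => ?_) hr
  · rw [← ENNReal.ofReal_le_ofReal_iff (hpos _ (ha.trans_le hab)).le, ← hρ 0 h0 a ha,
      ← hρ 0 h0 b (ha.trans_le hab)]
    exact measure_mono (Ioo_subset_Ioo (by linarith) (by linarith))
  · have e1 := hball 0 (2 * (a + b)) le_rfl (by linarith)
    have e2 := hball 0 (2 * a) le_rfl (by linarith)
    have e3 := hball (2 * a) (2 * (a + b)) (by linarith) (by linarith)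
    rw [show (2 * (a + b) - 0) / 2 = a + b by ring] at e1
    rw [show (2 * a - 0) / 2 = a by ring] at e2
    rw [show (2 * (a + b) - 2 * a) / 2 = b by ring] at e3
    have e4 : ρ (Ioo 0 (2 * (a + b))) = ρ (Ioo 0 (2 * a)) + ρ (Ioo (2 * a) (2 * (a + b))) := by
      rw [← measure_union (Set.disjoint_left.2 fun x h1 h2 => by linarith [h1.2, h2.1])
        measurableSet_Ioo]
      refine le_antisymm ?_ (measure_mono ?_)
      · calc _ ≤ ρ ((Ioo 0 (2 * a) ∪ Ioo (2 * a) (2 * (a + b))) ∪ {2 * a}) := by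
              refine measure_mono fun x hx => ?_
              rcases lt_trichotomy x (2 * a) with h | h | h
              · exact Or.inl (Or.inl ⟨hx.1, h⟩)
              · exact Or.inr h
              · exact Or.inl (Or.inr ⟨h, hx.2⟩)
          _ ≤ _ := measure_union_le _ _
          _ = _ := by rw [hat, add_zero]
      · rintro x (hx | hx)
        · exact ⟨hx.1, by linarith [hx.2]⟩
        · exact ⟨by linarith [hx.1], hx.2⟩
    rw [e1, e2, e3, ← ENNReal.ofReal_add (hpos a ha).le (hpos b hb).le] at e4
    exact (ENNReal.ofReal_eq_ofReal_iff (hpos _ (by linarith)).le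
      (add_nonneg (hpos a ha).le (hpos b hb).le)).1 e4

/-- Rescaled measures. -/
noncomputable def aSc (μ : Measure V) (a : ℝ≥0∞) (x0 : V) (c : ℝ) : Measure V :=
  a • μ.map (fun y => c • (y - x0))

theorem aSc_apply (μ : Measure V) (a : ℝ≥0∞) (x0 : V) (c : ℝ) {s : Set V} (hs : MeasurableSet s) :
    aSc μ a x0 c s = a * μ ((fun y => c • (y - x0)) ⁻¹' s) := by
  rw [aSc, Measure.smul_apply, Measure.map_apply (by fun_prop) hs, smul_eq_mul]

theorem aux_dist_scale (x0 z y : V) {c : ℝ} (hc : 0 < c) :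
    dist (c • (y - x0)) z = c * dist y (x0 + c⁻¹ • z) := by
  rw [dist_eq_norm, dist_eq_norm]
  have : c • (y - x0) - z = c • (y - (x0 + c⁻¹ • z)) := by
    simp only [smul_sub, smul_add]; rw [smul_inv_smul₀ hc.ne']; abel
  rw [this, norm_smul, Real.norm_of_nonneg hc.le]

theorem aSc_ball (μ : Measure V) (a : ℝ≥0∞) (x0 : V) {c : ℝ} (hc : 0 < c) (z : V) (r : ℝ) :
    aSc μ a x0 c (ball z r) = a * μ (ball (x0 + c⁻¹ • z) (r / c)) := by
  rw [aSc_apply _ _ _ _ measurableSet_ball]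
  congr 2
  ext y
  simp only [mem_preimage, mem_ball]
  rw [aux_dist_scale x0 z y hc, lt_div_iff₀ hc, mul_comm]

theorem aSc_closedBall (μ : Measure V) (a : ℝ≥0∞) (x0 : V) {c : ℝ} (hc : 0 < c) (z : V) (r : ℝ) :
    aSc μ a x0 c (closedBall z r) = a * μ (closedBall (x0 + c⁻¹ • z) (r / c)) := by
  rw [aSc_apply _ _ _ _ measurableSet_closedBall]
  congr 2
  ext y
  simp only [mem_preimage, mem_closedBall]
  rw [aux_dist_scale x0 z y hc, le_div_iff₀ hc, mul_comm]

theorem aSc_lf (μ : Measure V) [IsLocallyFiniteMeasure μ] {a : ℝ≥0∞} (ha : a ≠ ∞) (x0 : V) {c : ℝ}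
    (hc : 0 < c) : IsLocallyFiniteMeasure (aSc μ a x0 c) := by
  refine ⟨fun x => ⟨ball x 1, ball_mem_nhds x one_pos, ?_⟩⟩
  rw [aSc_ball μ a x0 hc]
  exact ENNReal.mul_lt_top ha.lt_top measure_ball_lt_top

theorem aux_null_parallel {Q : V → ℝ} (hle : ∀ x, Q x ≤ ‖x‖ ^ 2)
    (hsm : ∀ (c : ℝ) x, Q (c • x) = c ^ 2 * Q x)
    (hpar : ∀ x y, Q (x + y) + Q (x - y) = 2 * Q x + 2 * Q y)
    (hort : ∀ x y, ‖x‖ = 1 → ‖y‖ = 1 → inner ℝ x y = 0 → Q x + Q y ≤ 1)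
    {e x : V} (he : ‖e‖ = 1) (hQe : Q e = 1) (hQx : Q x = ‖x‖ ^ 2) :
    x = (inner ℝ e x) • e := by
  by_contra hne
  set t : ℝ := inner ℝ e x with ht
  set y := x - t • e with hy
  have hy0 : y ≠ 0 := sub_ne_zero.2 hne
  have hQt : Q (t • e) = ‖t • e‖ ^ 2 := by
    rw [hsm, hQe, norm_smul, he]; simp
  have hQy : Q y = ‖y‖ ^ 2 := by
    have h1 := hpar x (t • e)
    have h2 := parallelogram_law_with_norm ℝ x (t • e)
    have h3 := hle (x + t • e)
    have h4 := hle (x - t • e)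
    rw [hQx, hQt] at h1
    have : Q (x - t • e) = ‖x - t • e‖ ^ 2 := by nlinarith
    exact this
  have hn : 0 < ‖y‖ := norm_pos_iff.2 hy0
  have h5 := hort e (‖y‖⁻¹ • y) he (by rw [norm_smul, norm_inv, norm_norm, inv_mul_cancel₀ hn.ne'])
    (by
      rw [real_inner_smul_right, hy, inner_sub_right, real_inner_smul_right,
        real_inner_self_eq_norm_sq, he]
      simp [ht])
  rw [hsm, hQe, hQy] at h5
  have : ‖y‖⁻¹ ^ 2 * ‖y‖ ^ 2 = 1 := by rw [← mul_pow, inv_mul_cancel₀ hn.ne', one_pow]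
  linarith

end Part5

open MeasureTheory Metric
open scoped ENNReal NNReal
open Filter Topology Set
set_option linter.unusedSectionVars false

section Part6
variable {V : Type*} [NormedAddCommGroup V] [InnerProductSpace ℝ V] [FiniteDimensional ℝ V]
  [MeasurableSpace V] [BorelSpace V]

theorem aux_ball_ofReal (μ : Measure V) [IsLocallyFiniteMeasure μ] (x : V) (r : ℝ) :
    μ (ball x r) = ENNReal.ofReal (μ.real (ball x r)) :=
  (ENNReal.ofReal_toReal measure_ball_lt_top.ne).symm

theorem aux_supp_near (μ : Measure V) {x : V} {ε : ℝ} (h : μ (ball x ε) ≠ 0) :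
    ∃ y ∈ μ.support, dist y x < ε := by
  by_contra hcon
  push Not at hcon
  refine h (measure_mono_null (t := μ.supportᶜ) (fun y hy hys => ?_) (by
    have := Measure.support_mem_ae (μ := μ)
    rwa [mem_ae_iff] at this))
  exact absurd hy (not_lt.2 (hcon y hys))

theorem aux_T3 (μ : Measure V) [IsLocallyFiniteMeasure μ] (h0 : (0:V) ∈ μ.support)
    (h : ∀ x ∈ μ.support, ∀ r > 0, μ.real (ball x (2 * r)) = 2 * μ.real (ball x r)) {r : ℝ}
    (hr : 0 < r) : μ.real (ball 0 r) = r * μ.real (ball 0 1) := by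
  have hE : ∀ x ∈ μ.support, ∀ r, μ.real (ball x r) = μ.real (ball 0 r) := fun x hx r =>
    aux_T1 μ h hx h0 r
  obtain ⟨Q, C, hQE, hQ0, hQle, hQsm, hQpar, hQort, hQdiff⟩ := aux_T2 μ h0
    (fun r hr => by
      rw [aux_ball_ofReal, aux_ball_ofReal μ 0 r, h 0 h0 r hr, ENNReal.ofReal_mul two_pos.le]
      simp)
    (fun x hx r => by rw [aux_ball_ofReal, aux_ball_ofReal μ 0 r, hE x hx r])
  set g : ℝ → ℝ := fun r => μ.real (ball 0 r) with hg
  have hg2 : ∀ r > 0, g (2 * r) = 2 * g r := fun r hr => h 0 h0 r hr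
  have hgpos : ∀ r > 0, 0 < g r := fun r hr => aux_support_pos μ h0 hr
  have hgmono : ∀ a b, a ≤ b → g a ≤ g b := fun a b hab =>
    aux_real_ball_mono μ 0 b ball_subset_closedBall (ball_subset_ball hab)
  let c : ℕ → ℝ := fun k => 1 / 2 ^ k
  have hc : ∀ k, 0 < c k := fun k => by positivity
  let M : ℕ → Measure V := fun k => aSc μ (ENNReal.ofReal (c k)) 0 (c k)
  have hM : ∀ k, IsLocallyFiniteMeasure (M k) := fun k => aSc_lf μ ENNReal.ofReal_ne_top 0 (hc k)
  have hMball : ∀ k x r, (M k).real (ball x r) = c k * μ.real (ball ((c k)⁻¹ • x) (r / c k)) := by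
    intro k x r
    simp only [Measure.real, M]
    rw [aSc_ball μ _ _ (hc k), ENNReal.toReal_mul, ENNReal.toReal_ofReal (hc k).le, zero_add]
  have hMg : ∀ k, ∀ y ∈ μ.support, ∀ r > 0, (M k).real (ball (c k • y) r) = g r := by
    intro k y hy r hr
    rw [hMball, smul_smul, inv_mul_cancel₀ (hc k).ne', one_smul, hE y hy]
    have := aux_iter hg2 k hr
    simp only [c]
    rw [div_div_eq_mul_div, div_one, mul_comm r, this]
    field_simp
    rfl
  let 𝒰 : Ultrafilter ℕ := hyperfilter ℕ
  have hU : (𝒰 : Filter ℕ) ≤ atTop := by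
    rw [← Nat.cofinite_eq_atTop]; exact hyperfilter_le_cofinite
  obtain ⟨ν, hν, hlim⟩ := aux_ultralimit 𝒰 M hM (fun R => ⟨g (|R| + 1), Eventually.of_forall
    fun k => by
      rw [← hMg k 0 h0 (|R| + 1) (by positivity), smul_zero]
      exact aux_real_ball_mono _ 0 (|R| + 1) ball_subset_closedBall
        (closedBall_subset_ball (by linarith [le_abs_self R]))⟩)
  -- approximation of the support
  have happ : ∀ x ∈ ν.support, ∀ η > 0, ∀ᶠ k in (𝒰 : Filter ℕ), ∃ y ∈ μ.support,
      dist (c k • y) x < η := by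
    intro x hx η hη
    have h1 := aux_support_pos ν hx (half_pos hη)
    have h2 : ¬ ∀ᶠ k in (𝒰 : Filter ℕ), (M k).real (ball x η) ≤ 0 := fun hcon => by
      have := aux_lim_le hM hν hlim x (half_lt_self hη) hcon
      linarith
    rw [← Ultrafilter.eventually_not] at h2
    filter_upwards [h2] with k hk
    rw [hMball, not_le] at hk
    have h3 : μ (ball ((c k)⁻¹ • x) (η / c k)) ≠ 0 := by
      intro hz
      simp [Measure.real, hz] at hk
    obtain ⟨y, hy, hyd⟩ := aux_supp_near μ h3
    refine ⟨y, hy, ?_⟩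
    have := aux_dist_scale 0 x y (hc k)
    rw [sub_zero, zero_add] at this
    rw [this]
    rw [lt_div_iff₀ (hc k)] at hyd
    linarith
  have hνg : ∀ x ∈ ν.support, ∀ r > 0, ν.real (ball x r) = g r := by
    intro x hx r hr
    apply le_antisymm
    · refine aux_left_cont ν x fun r1 hr1 => ?_
      refine aux_lim_le hM hν hlim x (r2 := (r1 + r) / 2) (by linarith) ?_
      filter_upwards [happ x hx ((r - r1) / 2) (by linarith)] with k hk
      obtain ⟨y, hy, hyd⟩ := hk
      rw [← hMg k y hy r hr]
      exact aux_real_ball_mono _ _ _ ball_subset_closedBall (ball_subset_ball' (by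
        rw [dist_comm]; linarith))
    · refine aux_left_cont μ 0 fun r1 hr1 => ?_
      rcases le_or_gt r1 0 with hr10 | hr10
      · rw [ball_eq_empty.2 hr10]; simp
      refine aux_le_lim hM hν hlim x (r1 := (r1 + r) / 2) (by linarith) ?_
      filter_upwards [happ x hx ((r - r1) / 2) (by linarith)] with k hk
      obtain ⟨y, hy, hyd⟩ := hk
      change g r1 ≤ _
      rw [← hMg k y hy r1 hr10]
      exact aux_real_ball_mono _ _ _ ball_subset_closedBall (ball_subset_ball' (by linarith))
  have h0ν : (0:V) ∈ ν.support := by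
    have h1 : ∀ η > 0, 0 < ν.real (ball (0:V) η) := by
      intro η hη
      refine (hgpos (η / 2) (by linarith)).trans_le ?_
      refine aux_le_lim hM hν hlim 0 (half_lt_self hη) (Eventually.of_forall fun k => ?_)
      have := hMg k 0 h0 (η / 2) (by linarith)
      rw [smul_zero] at this
      exact this.ge
    have h2 : (0:V) ∈ closure ν.support := by
      refine Metric.mem_closure_iff.2 fun ε hε => ?_
      obtain ⟨y, hy, hd⟩ := aux_exists_mem_support ν (h1 ε hε)
      exact ⟨y, hy, by rwa [dist_comm]⟩
    rwa [Measure.isClosed_support.closure_eq] at h2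
  have hνQ : ∀ x ∈ ν.support, Q x = ‖x‖ ^ 2 := by
    intro x hx
    have hC : 0 ≤ |C| := abs_nonneg C
    have key : ∀ η : ℝ, 0 < η → η < 1 → |‖x‖ ^ 2 - Q x| ≤ η * (4 * (‖x‖ + 1) + |C| * (‖x‖ + 1)) := by
      intro η hη hη1
      have hcs : ∀ᶠ k in (𝒰 : Filter ℕ), c k < η :=
        ((aux_tend_half 1).mono_left hU).eventually (gt_mem_nhds hη)
      obtain ⟨k, ⟨y, hy, hyd⟩, hck⟩ := ((happ x hx η hη).and hcs).exists
      set w := c k • y with hw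
      have h1 : |‖w‖ ^ 2 - Q w| ≤ |C| * (c k * ‖w‖) := by
        rw [hw, hQsm, norm_smul, Real.norm_of_nonneg (hc k).le, mul_pow, ← mul_sub, abs_mul,
          abs_of_nonneg (by positivity : 0 ≤ c k ^ 2)]
        calc c k ^ 2 * |‖y‖ ^ 2 - Q y| ≤ c k ^ 2 * (|C| * ‖y‖) := by
              refine mul_le_mul_of_nonneg_left ((hQE y hy).trans ?_) (by positivity)
              exact mul_le_mul_of_nonneg_right (le_abs_self C) (norm_nonneg _)
          _ = _ := by ring
      rw [dist_eq_norm] at hyd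
      have hwn : ‖w‖ ≤ ‖x‖ + 1 := by
        have := norm_sub_norm_le w x; linarith
      have hsum : ‖w + x‖ ≤ 2 * (‖x‖ + 1) := by
        have := norm_add_le w x; linarith
      have hsub : |‖w‖ - ‖x‖| ≤ η := (abs_norm_sub_norm_le w x).trans hyd.le
      have h2 : |Q w - Q x| ≤ η * (2 * (‖x‖ + 1)) :=
        (hQdiff w x).trans (mul_le_mul hyd.le hsum (norm_nonneg _) hη.le)
      have h3 : |‖x‖ ^ 2 - ‖w‖ ^ 2| ≤ η * (2 * (‖x‖ + 1)) := by
        rw [show ‖x‖ ^ 2 - ‖w‖ ^ 2 = -((‖w‖ - ‖x‖) * (‖w‖ + ‖x‖)) by ring, abs_neg, abs_mul]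
        refine mul_le_mul hsub ?_ (abs_nonneg _) hη.le
        rw [abs_of_nonneg (by positivity)]; linarith
      have h4 : |C| * (c k * ‖w‖) ≤ η * (|C| * (‖x‖ + 1)) := by
        calc |C| * (c k * ‖w‖) ≤ |C| * (η * (‖x‖ + 1)) := by gcongr
          _ = _ := by ring
      have h5 := h1.trans h4
      rw [abs_le] at h2 h3 h5 ⊢
      constructor <;> linarith [h2.1, h2.2, h3.1, h3.2, h5.1, h5.2]
    have hz : |‖x‖ ^ 2 - Q x| ≤ 0 := by
      have t := (aux_tend_half (4 * (‖x‖ + 1) + |C| * (‖x‖ + 1)))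
      refine ge_of_tendsto t (eventually_atTop.2 ⟨1, fun n hn => ?_⟩)
      have h1 : (1:ℝ) < 2 ^ n := one_lt_pow₀ one_lt_two (by omega)
      have := key (1 / 2 ^ n) (by positivity) (by rw [div_lt_one (by positivity)]; exact h1)
      rwa [one_div_mul_eq_div] at this
    have := abs_nonpos_iff.1 hz
    linarith
  -- a nonzero point
  obtain ⟨x1, hx1, hx10⟩ : ∃ x ∈ ν.support, x ≠ 0 := by
    by_contra hcon
    push Not at hcon
    have h1 : ∀ n : ℕ, ν.real (ball 0 1) ≤ g 1 / 2 ^ n := by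
      intro n
      rw [← aux_g_half hg2, ← hνg 0 h0ν _ (by positivity)]
      refine ENNReal.toReal_mono measure_ball_lt_top.ne ?_
      refine measure_mono_ae ?_
      filter_upwards [Measure.support_mem_ae (μ := ν)] with z hz _
      rw [hcon z hz]
      exact mem_ball_self (by positivity)
    have h2 := ge_of_tendsto' (aux_tend_half (g 1)) h1
    rw [hνg 0 h0ν 1 one_pos] at h2
    linarith [hgpos 1 one_pos]
  set e := ‖x1‖⁻¹ • x1 with he
  have hn1 : 0 < ‖x1‖ := norm_pos_iff.2 hx10
  have hen : ‖e‖ = 1 := by rw [he, norm_smul, norm_inv, norm_norm, inv_mul_cancel₀ hn1.ne']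
  have hQe : Q e = 1 := by
    rw [he, hQsm, hνQ x1 hx1, ← mul_pow, inv_mul_cancel₀ hn1.ne', one_pow]
  have hline : ∀ x ∈ ν.support, x = (inner ℝ e x : ℝ) • e := fun x hx =>
    aux_null_parallel hQle hQsm hQpar hQort hen hQe (hνQ x hx)
  have hae : ∀ᵐ z ∂ν, z = (inner ℝ e z : ℝ) • e := by
    filter_upwards [Measure.support_mem_ae (μ := ν)] with z hz using hline z hz
  refine aux_1D (ν.map (fun z => (inner ℝ e z : ℝ))) (F := (fun t : ℝ => t • e) ⁻¹' ν.support)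
    (Measure.isClosed_support.preimage (by fun_prop)) (by simpa using h0ν) ?_ hgpos hg2 ?_ hr
  · rw [Measure.map_apply (by fun_prop)
      (Measure.isClosed_support.preimage (by fun_prop)).measurableSet.compl]
    refine measure_mono_null (t := ν.supportᶜ) (fun z hz hzs => hz ?_) (by
      have := Measure.support_mem_ae (μ := ν)
      rwa [mem_ae_iff] at this)
    simp only [mem_preimage]
    rwa [← hline z hzs]
  · intro t ht r hr
    rw [← hνg _ ht r hr, ← aux_ball_ofReal, Measure.map_apply (by fun_prop) measurableSet_Ioo]
    refine measure_congr ?_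
    filter_upwards [hae] with z hz
    apply propext
    change inner ℝ e z ∈ Ioo (t - r) (t + r) ↔ z ∈ ball (t • e) r
    rw [mem_ball, dist_eq_norm]
    conv_rhs => rw [hz]
    rw [← sub_smul, norm_smul, hen, mul_one, Real.norm_eq_abs, abs_lt, mem_Ioo]
    constructor <;> rintro ⟨h1, h2⟩ <;> constructor <;> linarith
end Part6

open MeasureTheory Metric
open scoped ENNReal NNReal
open Filter Topology Set
set_option linter.unusedSectionVars false

section Part7
variable {V : Type*} [NormedAddCommGroup V] [InnerProductSpace ℝ V] [FiniteDimensional ℝ V]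
  [MeasurableSpace V] [BorelSpace V]

theorem aux_annulus (μ : Measure V) [IsLocallyFiniteMeasure μ] {c : ℝ}
    (hb : ∀ x ∈ μ.support, ∀ r > 0, μ.real (ball x r) = c * r) {x : V} (hx : x ∈ μ.support)
    {r ρ : ℝ} (hρ : 0 < ρ) (hr : ρ < r) :
    μ.real (ball x (r + ρ) \ ball x (r - ρ)) = 2 * c * ρ := by
  rw [measureReal_sdiff (ball_subset_ball (by linarith)) measurableSet_ball
    measure_ball_lt_top.ne, hb x hx _ (by linarith), hb x hx _ (by linarith)]
  ring

theorem aux_K (μ : Measure V) [IsLocallyFiniteMeasure μ] {c : ℝ} (hc : 0 < c)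
    (hb : ∀ x ∈ μ.support, ∀ r > 0, μ.real (ball x r) = c * r) {x y1 y2 w : V} {r : ℝ} (hr : 0 < r)
    (hx : x ∈ μ.support) (hy1 : y1 ∈ μ.support) (hy2 : y2 ∈ μ.support) (hw : w ∈ μ.support)
    (h1 : dist y1 x = r) (h2 : dist y2 x = r) (hτ : |dist w x - r| < dist y1 y2 / 2) :
    dist w y1 ≤ |dist w x - r| ∨ dist w y2 ≤ |dist w x - r| := by
  by_contra hcon
  push Not at hcon
  obtain ⟨ρ, hρ1, hρ2⟩ := exists_between (lt_min (lt_min hcon.1 hcon.2) hτ)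
  obtain ⟨hρ3, hρ4⟩ := lt_min_iff.1 hρ2
  obtain ⟨hρ5, hρ6⟩ := lt_min_iff.1 hρ3
  have hρ0 : 0 < ρ := (abs_nonneg _).trans_lt hρ1
  obtain ⟨η, hη0, hη⟩ := exists_between
    (lt_min (lt_min (sub_pos.2 hρ1) (sub_pos.2 hρ5)) (sub_pos.2 hρ6))
  obtain ⟨hη1, hη2⟩ := lt_min_iff.1 hη
  obtain ⟨hη3, hη4⟩ := lt_min_iff.1 hη1
  have hD : dist y1 y2 ≤ 2 * r := by
    have := dist_triangle_right y1 y2 x; linarith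
  have hA := aux_annulus μ hb hx hρ0 (by linarith : ρ < r)
  have d12 : Disjoint (ball y1 ρ) (ball y2 ρ) := ball_disjoint_ball (by linarith)
  have d3 : Disjoint (ball y1 ρ ∪ ball y2 ρ) (ball w η) := by
    rw [disjoint_union_left]
    exact ⟨ball_disjoint_ball (by rw [dist_comm]; linarith),
      ball_disjoint_ball (by rw [dist_comm]; linarith)⟩
  have hsub : (ball y1 ρ ∪ ball y2 ρ) ∪ ball w η ⊆ ball x (r + ρ) \ ball x (r - ρ) := by
    rintro z ((hz | hz) | hz) <;> rw [mem_ball] at hz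
    · have t1 := dist_triangle z y1 x
      have t2 := dist_triangle_left y1 x z
      refine ⟨?_, ?_⟩ <;> simp only [mem_ball, not_lt] <;> linarith
    · have t1 := dist_triangle z y2 x
      have t2 := dist_triangle_left y2 x z
      refine ⟨?_, ?_⟩ <;> simp only [mem_ball, not_lt] <;> linarith
    · have t1 := dist_triangle z w x
      have t2 := dist_triangle_left w x z
      have t3 := abs_le.1 (le_refl |dist w x - r|)
      refine ⟨?_, ?_⟩ <;> simp only [mem_ball, not_lt] <;> linarith
  have hm := aux_real_ball_mono μ x (r + ρ) (sdiff_subset.trans ball_subset_closedBall) hsub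
  have hfin : ∀ z s, μ (ball z s) ≠ ∞ := fun z s => measure_ball_lt_top.ne
  rw [measureReal_union d3 measurableSet_ball
      (measure_union_ne_top (hfin _ _) (hfin _ _)) (hfin _ _),
    measureReal_union d12 measurableSet_ball (hfin _ _) (hfin _ _), hA, hb _ hy1 _ hρ0,
    hb _ hy2 _ hρ0, hb _ hw _ hη0] at hm
  nlinarith

theorem aux_ray {x y w : V} (h : dist w y ≤ |dist w x - dist y x|) (hy : dist y x ≠ 0) :
    w = x + (dist w x / dist y x) • (y - x) := by
  have h1 : SameRay ℝ (w - x) (y - x) := by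
    rw [sameRay_iff_norm_sub]
    simp only [dist_eq_norm] at h
    refine le_antisymm ?_ (abs_norm_sub_norm_le _ _)
    rwa [sub_sub_sub_cancel_right]
  have h2 := h1.norm_smul_eq
  rw [← dist_eq_norm, ← dist_eq_norm] at h2
  have h3 : w - x = (dist w x / dist y x) • (y - x) := by
    rw [div_eq_inv_mul, mul_smul, h2, inv_smul_smul₀ hy]
  rw [← h3]; abel

theorem aux_step (μ : Measure V) [IsLocallyFiniteMeasure μ] {c : ℝ} (hc : 0 < c)
    (hb : ∀ x ∈ μ.support, ∀ r > 0, μ.real (ball x r) = c * r) {x a1 a2 : V} {r r' : ℝ} (hr : 0 < r)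
    (hx : x ∈ μ.support) (ha1 : ‖a1‖ = 1) (ha2 : ‖a2‖ = 1)
    (hy1 : x + r • a1 ∈ μ.support) (hy2 : x + r • a2 ∈ μ.support)
    (hr' : |r' - r| < r * (‖a1 - a2‖ / 2)) : x + r' • a1 ∈ μ.support := by
  by_contra hp
  have hn : ‖a1 - a2‖ ≤ 2 := by have := norm_sub_le a1 a2; linarith
  have hr'0 : 0 < r' := by
    have := (abs_lt.1 hr').1; nlinarith
  have hd1 : ∀ a : V, ‖a‖ = 1 → dist (x + r • a) x = r := fun a ha => by
    simp [dist_eq_norm, norm_smul, ha, abs_of_pos hr]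
  have hd12 : dist (x + r • a1) (x + r • a2) / 2 = r * (‖a1 - a2‖ / 2) := by
    rw [dist_add_left, dist_eq_norm, ← smul_sub, norm_smul, Real.norm_of_nonneg hr.le]; ring
  -- points of the support near the sphere of radius `r'` lie on rays
  have hray : ∀ w ∈ μ.support, |dist w x - r| < r * (‖a1 - a2‖ / 2) →
      w = x + dist w x • a1 ∨ w = x + dist w x • a2 := by
    intro w hw hwr
    have hsm : ∀ t : ℝ, ∀ a : V, (t / r) • (x + r • a - x) = t • a := fun t a => by
      rw [add_sub_cancel_left, smul_smul, div_mul_cancel₀ _ hr.ne']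
    rcases aux_K μ hc hb hr hx hy1 hy2 hw (hd1 a1 ha1) (hd1 a2 ha2) (by rw [hd12]; exact hwr)
      with h | h
    · left
      have := aux_ray (x := x) (y := x + r • a1) (w := w) (by rwa [hd1 a1 ha1])
        (by rw [hd1 a1 ha1]; exact hr.ne')
      rwa [hd1 a1 ha1, hsm] at this
    · right
      have := aux_ray (x := x) (y := x + r • a2) (w := w) (by rwa [hd1 a2 ha2])
        (by rw [hd1 a2 ha2]; exact hr.ne')
      rwa [hd1 a2 ha2, hsm] at this
  obtain ⟨ρ0, hρ0, hball⟩ := Metric.isOpen_iff.1 Measure.isClosed_support.isOpen_compl _ hp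
  obtain ⟨ρ, hρ, hρ1⟩ := exists_between (lt_min (lt_min hρ0 hr'0) (sub_pos.2 hr'))
  obtain ⟨hρ2, hρ3⟩ := lt_min_iff.1 hρ1
  obtain ⟨hρ4, hρ5⟩ := lt_min_iff.1 hρ2
  have hon2 : ∀ w ∈ μ.support, |dist w x - r'| ≤ ρ → w = x + dist w x • a2 := by
    intro w hw hwr
    rcases hray w hw (by
      have := abs_sub_le (dist w x) r' r; linarith) with h | h
    · exfalso
      refine hball (a := w) ?_ hw
      rw [mem_ball, h, dist_add_left, dist_eq_norm, ← sub_smul, norm_smul, ha1, mul_one,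
        Real.norm_eq_abs]
      linarith
    · exact h
  -- a point
  have hA := aux_annulus μ hb hx (half_pos hρ) (by linarith : ρ / 2 < r')
  have hApos : μ (ball x (r' + ρ / 2) \ ball x (r' - ρ / 2)) ≠ 0 := by
    intro hz
    simp only [Measure.real, hz, ENNReal.toReal_zero] at hA
    have : 0 < 2 * c * (ρ / 2) := by positivity
    linarith
  obtain ⟨q, hqE, hqA⟩ : ∃ q ∈ μ.support, q ∈ ball x (r' + ρ / 2) \ ball x (r' - ρ / 2) := by
    by_contra hcon
    push Not at hcon
    refine hApos (measure_mono_null (t := μ.supportᶜ) (fun y hy hys => hcon y hys hy) (by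
      have := Measure.support_mem_ae (μ := μ)
      rwa [mem_ae_iff] at this))
  have hq1 := mem_ball.1 hqA.1
  have hq2 := not_lt.1 (fun h => hqA.2 (mem_ball.2 h))
  have hqeq := hon2 q hqE (by rw [abs_le]; constructor <;> linarith)
  have hA2 := aux_annulus μ hb hx (half_pos hρ) (by linarith : ρ / 2 < dist q x + ρ / 2)
  have hA3 := aux_annulus μ hb hx (r := dist q x) (ρ := ρ / 8) (by linarith) (by linarith)
  have hle : μ (ball x (dist q x + ρ / 8) \ ball x (dist q x - ρ / 8)) ≤ μ (ball q (3 * ρ / 16)) := by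
    refine measure_mono_ae ?_
    filter_upwards [Measure.support_mem_ae (μ := μ)] with z hz hzA
    have hz1 := mem_ball.1 hzA.1
    have hz2 := not_lt.1 (fun h => hzA.2 (mem_ball.2 h))
    have hzeq := hon2 z hz (by rw [abs_le]; constructor <;> linarith)
    change z ∈ ball q (3 * ρ / 16)
    rw [mem_ball, hzeq, hqeq, dist_add_left, dist_eq_norm, ← sub_smul, norm_smul, ha2, mul_one,
      Real.norm_eq_abs, abs_lt]
    constructor <;> linarith
  have hle2 := ENNReal.toReal_mono measure_ball_lt_top.ne hle
  change μ.real _ ≤ μ.real _ at hle2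
  rw [hA3, hb q hqE _ (by linarith)] at hle2
  nlinarith

theorem aux_two_rays (μ : Measure V) [IsLocallyFiniteMeasure μ] {c : ℝ} (hc : 0 < c)
    (hb : ∀ x ∈ μ.support, ∀ r > 0, μ.real (ball x r) = c * r) {x a1 a2 : V} {r : ℝ} (hr : 0 < r)
    (hx : x ∈ μ.support) (ha1 : ‖a1‖ = 1) (ha2 : ‖a2‖ = 1) (ha : a1 ≠ a2)
    (hy1 : x + r • a1 ∈ μ.support) (hy2 : x + r • a2 ∈ μ.support) :
    (∀ t : ℝ, 0 < t → x + t • a1 ∈ μ.support ∧ x + t • a2 ∈ μ.support) ∧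
    ∀ w ∈ μ.support, w ≠ x → w = x + dist w x • a1 ∨ w = x + dist w x • a2 := by
  have hκ : 0 < ‖a1 - a2‖ / 2 := by
    have := norm_pos_iff.2 (sub_ne_zero.2 ha); linarith
  have hall : ∀ t : ℝ, 0 < t → x + t • a1 ∈ μ.support ∧ x + t • a2 ∈ μ.support := by
    intro t ht
    have htr : 0 < t / r := by positivity
    have htend : Tendsto (fun n : ℕ => (t / r) ^ (1 / (n : ℝ))) atTop (𝓝 1) := by
      have h1 : Tendsto (fun n : ℕ => 1 / (n : ℝ)) atTop (𝓝 0) := tendsto_one_div_atTop_nhds_zero_nat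
      have h2 := (Real.continuousAt_const_rpow htr.ne' (b := 0)).tendsto.comp h1
      simpa [Function.comp_def] using h2
    obtain ⟨n, hn, hn0⟩ := ((htend.eventually (Metric.ball_mem_nhds 1 hκ)).and
      (eventually_ge_atTop 1)).exists
    set q := (t / r) ^ (1 / (n : ℝ)) with hq
    have hq0 : 0 < q := by positivity
    have hqn : q ^ n = t / r := by
      rw [hq, ← Real.rpow_natCast, ← Real.rpow_mul htr.le, one_div_mul_cancel (by
        have : n ≠ 0 := by omega
        exact_mod_cast this), Real.rpow_one]
    have hind : ∀ k : ℕ, x + (r * q ^ k) • a1 ∈ μ.support ∧ x + (r * q ^ k) • a2 ∈ μ.support := by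
      intro k
      induction k with
      | zero => simpa using ⟨hy1, hy2⟩
      | succ k ih =>
        have hp : 0 < r * q ^ k := by positivity
        have hd : |r * q ^ (k + 1) - r * q ^ k| < r * q ^ k * (‖a1 - a2‖ / 2) := by
          have : r * q ^ (k + 1) - r * q ^ k = r * q ^ k * (q - 1) := by ring
          rw [this, abs_mul, abs_of_pos hp]
          have hn' : |q - 1| < ‖a1 - a2‖ / 2 := hn
          gcongr
        exact ⟨aux_step μ hc hb hp hx ha1 ha2 ih.1 ih.2 hd,
          aux_step μ hc hb hp hx ha2 ha1 ih.2 ih.1 (by rwa [norm_sub_rev a2 a1])⟩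
    have := hind n
    rwa [hqn, mul_div_cancel₀ _ hr.ne'] at this
  refine ⟨hall, fun w hw hwx => ?_⟩
  have hd : 0 < dist w x := dist_pos.2 hwx
  obtain ⟨h1, h2⟩ := hall _ hd
  have hd1 : ∀ a : V, ‖a‖ = 1 → dist (x + dist w x • a) x = dist w x := fun a ha => by
    rw [dist_eq_norm, add_sub_cancel_left, norm_smul, ha, mul_one, Real.norm_of_nonneg hd.le]
  rcases aux_K μ hc hb hd hx h1 h2 hw (hd1 a1 ha1) (hd1 a2 ha2) (by
    rw [sub_self, abs_zero]
    refine half_pos (dist_pos.2 fun h => ha ?_)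
    exact smul_right_injective V hd.ne' (add_left_cancel h)) with h | h <;>
    rw [sub_self, abs_zero] at h
  · exact Or.inl (dist_le_zero.1 h)
  · exact Or.inr (dist_le_zero.1 h)

/-- Every sphere meets the support. -/
theorem aux_sphere (μ : Measure V) [IsLocallyFiniteMeasure μ] {c : ℝ} (hc : 0 < c)
    (hb : ∀ x ∈ μ.support, ∀ r > 0, μ.real (ball x r) = c * r) {x : V} (hx : x ∈ μ.support)
    {r : ℝ} (hr : 0 < r) : ∃ y ∈ μ.support, dist y x = r := by
  have hcpt : IsCompact (μ.support ∩ closedBall x (2 * r)) :=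
    (isCompact_closedBall _ _).inter_left Measure.isClosed_support
  have him := (hcpt.image (f := fun z => dist z x) (by fun_prop)).isClosed
  have hmem : r ∈ (fun z => dist z x) '' (μ.support ∩ closedBall x (2 * r)) := by
    rw [← him.closure_eq]
    refine Metric.mem_closure_iff.2 fun ε hε => ?_
    obtain ⟨ρ, hρ, hρ1⟩ := exists_between (lt_min hε hr)
    obtain ⟨hρ2, hρ3⟩ := lt_min_iff.1 hρ1
    have hA := aux_annulus μ hb hx hρ hρ3
    by_contra hcon
    push Not at hcon
    have hz : μ (ball x (r + ρ) \ ball x (r - ρ)) = 0 := by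
      refine measure_mono_null (t := μ.supportᶜ) (fun y hy hys => ?_) (by
        have := Measure.support_mem_ae (μ := μ)
        rwa [mem_ae_iff] at this)
      have h1 := mem_ball.1 hy.1
      have h2 := not_lt.1 (fun h => hy.2 (mem_ball.2 h))
      have := hcon _ ⟨y, ⟨hys, mem_closedBall.2 (by linarith)⟩, rfl⟩
      rw [Real.dist_eq] at this
      have h3 : |r - dist y x| ≤ ρ := by rw [abs_le]; constructor <;> linarith
      linarith
    simp only [Measure.real, hz, ENNReal.toReal_zero] at hA
    have : 0 < 2 * c * ρ := by positivity
    linarith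
  obtain ⟨y, hy, h⟩ := hmem
  exact ⟨y, hy.1, h⟩

theorem aux_pair (μ : Measure V) [IsLocallyFiniteMeasure μ] {c : ℝ} (hc : 0 < c)
    (hb : ∀ x ∈ μ.support, ∀ r > 0, μ.real (ball x r) = c * r) {x0 : V} (hx : x0 ∈ μ.support) :
    ∃ x ∈ μ.support, ∃ r > 0, ∃ y1 ∈ μ.support, ∃ y2 ∈ μ.support, dist y1 x = r ∧ dist y2 x = r ∧
      y1 ≠ y2 := by
  by_contra hcon
  push Not at hcon
  have huniq : ∀ z1 ∈ μ.support, ∀ z2 ∈ μ.support, dist z1 x0 = dist z2 x0 → z1 = z2 := by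
    intro z1 h1 z2 h2 h
    rcases eq_or_lt_of_le (dist_nonneg (x := z2) (y := x0)) with h0 | h0
    · rw [← h0] at h
      rw [dist_eq_zero.1 h, dist_eq_zero.1 h0.symm]
    · exact hcon x0 hx _ h0 z1 h1 z2 h2 h rfl
  have hex : ∀ r, 0 ≤ r → ∃ y ∈ μ.support, dist y x0 = r := by
    intro r hr
    rcases hr.eq_or_lt with h | h
    · exact ⟨x0, hx, by rw [dist_self]; exact h⟩
    · exact aux_sphere μ hc hb hx h
  obtain ⟨y, hy, hyd⟩ := hex 1 zero_le_one
  have hE : IsClosed μ.support := Measure.isClosed_support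
  let N1 : Set ℝ := (fun z => dist z x0) '' (μ.support ∩ {z | dist z y ≤ 1 / 2} ∩ closedBall x0 3)
  let N2 : Set ℝ := (fun z => dist z x0) '' (μ.support ∩ {z | 1 / 2 ≤ dist z y} ∩ closedBall x0 3)
  have hN1 : IsClosed N1 := (((isCompact_closedBall x0 3).inter_left
    (hE.inter (isClosed_le (by fun_prop) (by fun_prop)))).image (by fun_prop)).isClosed
  have hN2 : IsClosed N2 := (((isCompact_closedBall x0 3).inter_left
    (hE.inter (isClosed_le (by fun_prop) (by fun_prop)))).image (by fun_prop)).isClosed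
  have hcov : ∀ t, 0 ≤ t → t ≤ 3 → t ∈ N1 ∪ N2 := by
    intro t h0 h3
    obtain ⟨z, hz, hzd⟩ := hex t h0
    rcases le_total (dist z y) (1 / 2) with h | h
    · exact Or.inl ⟨z, ⟨⟨hz, h⟩, mem_closedBall.2 (by linarith)⟩, hzd⟩
    · exact Or.inr ⟨z, ⟨⟨hz, h⟩, mem_closedBall.2 (by linarith)⟩, hzd⟩
  have h1N : (1:ℝ) ∈ N1 := ⟨y, ⟨⟨hy, by simp⟩, mem_closedBall.2 (by linarith)⟩, hyd⟩
  have h0N : (0:ℝ) ∈ N2 := ⟨x0, ⟨⟨hx, by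
    simp only [mem_ofPred_eq]; rw [dist_comm, hyd]; norm_num⟩, mem_closedBall.2 (by simp)⟩, by simp⟩
  have h3N : (3:ℝ) ∈ N2 := by
    obtain ⟨z, hz, hzd⟩ := hex 3 (by norm_num)
    refine ⟨z, ⟨⟨hz, ?_⟩, mem_closedBall.2 hzd.le⟩, hzd⟩
    have := dist_triangle z y x0
    simp only [mem_ofPred_eq]; linarith
  have hget : ∀ t ∈ N1 ∩ N2, ∃ z ∈ μ.support, dist z x0 = t ∧ dist z y = 1 / 2 := by
    rintro t ⟨⟨z1, ⟨⟨h1, h2⟩, -⟩, h3⟩, ⟨z2, ⟨⟨h4, h5⟩, -⟩, h6⟩⟩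
    have := huniq z1 h1 z2 h4 (h3.trans h6.symm)
    subst this
    exact ⟨z1, h1, h3, le_antisymm h2 h5⟩
  obtain ⟨t1, ht1, ht1N⟩ := isPreconnected_closed_iff.1 (isPreconnected_Icc (a := (0:ℝ)) (b := 1))
    N1 N2 hN1 hN2 (fun t ht => hcov t ht.1 (by linarith [ht.2])) ⟨1, by simp, h1N⟩ ⟨0, by simp, h0N⟩
  obtain ⟨t2, ht2, ht2N⟩ := isPreconnected_closed_iff.1 (isPreconnected_Icc (a := (1:ℝ)) (b := 3))
    N1 N2 hN1 hN2 (fun t ht => hcov t (by linarith [ht.1]) ht.2) ⟨1, by norm_num, h1N⟩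
    ⟨3, by norm_num, h3N⟩
  obtain ⟨z1, hz1, hd1, hy1⟩ := hget t1 ht1N
  obtain ⟨z2, hz2, hd2, hy2⟩ := hget t2 ht2N
  have hzz := hcon y hy (1 / 2) (by norm_num) z1 hz1 z2 hz2 hy1 hy2
  have hz1y : z1 = y := huniq z1 hz1 y hy (by
    rw [hyd, hd1]
    rw [← hzz] at hd2
    have e : t1 = t2 := hd1.symm.trans hd2
    have := ht1.2
    have := ht2.1
    linarith)
  rw [hz1y, dist_self] at hy1
  norm_num at hy1

theorem aux_dir {x y : V} {r : ℝ} (hr : 0 < r) (h : dist y x = r) :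
    ‖r⁻¹ • (y - x)‖ = 1 ∧ x + r • (r⁻¹ • (y - x)) = y := by
  rw [norm_smul, ← dist_eq_norm, h, norm_inv, Real.norm_of_nonneg hr.le, inv_mul_cancel₀ hr.ne',
    smul_inv_smul₀ hr.ne']
  exact ⟨rfl, by abel⟩

theorem aux_T4 (μ : Measure V) [IsLocallyFiniteMeasure μ] {c : ℝ} (hc : 0 < c)
    (hb : ∀ x ∈ μ.support, ∀ r > 0, μ.real (ball x r) = c * r) {x0 : V} (hx0 : x0 ∈ μ.support) :
    ∃ x v : V, ‖v‖ = 1 ∧ ∀ w, w ∈ μ.support ↔ ∃ t : ℝ, w = x + t • v := by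
  obtain ⟨y, hy, r, hr, y1, hy1, y2, hy2, h1, h2, hne⟩ := aux_pair μ hc hb hx0
  obtain ⟨n1, e1⟩ := aux_dir hr h1
  obtain ⟨n2, e2⟩ := aux_dir hr h2
  set a := r⁻¹ • (y1 - y) with ha
  set b := r⁻¹ • (y2 - y) with hb'
  have hab : a ≠ b := fun h => hne (by rw [← e1, ← e2, h])
  obtain ⟨hA, -⟩ := aux_two_rays μ hc hb hr hy n1 n2 hab (by rwa [e1]) (by rwa [e2])
  have hx := (hA 1 one_pos).1
  rw [one_smul] at hx
  have hna : -a ≠ a := fun h => by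
    have : a = 0 := by
      have h3 : (2:ℝ) • a = 0 := by rw [two_smul]; nth_rewrite 1 [← h]; abel
      exact (smul_eq_zero.1 h3).resolve_left two_ne_zero
    rw [this] at n1; simp at n1
  obtain ⟨hB, hB2⟩ := aux_two_rays μ hc hb (x := y + a) (r := 1 / 2) (a1 := -a) (a2 := a)
    (by norm_num) hx (by rwa [norm_neg]) n1 hna
    (by
      have := (hA (1 / 2) (by norm_num)).1
      convert this using 1
      module)
    (by
      have := (hA (3 / 2) (by norm_num)).1
      convert this using 1
      module)
  refine ⟨y + a, a, n1, fun w => ⟨fun hw => ?_, ?_⟩⟩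
  · by_cases hwx : w = y + a
    · exact ⟨0, by simp [hwx]⟩
    · rcases hB2 w hw hwx with h | h
      · exact ⟨-dist w (y + a), by rw [neg_smul, ← smul_neg]; exact h⟩
      · exact ⟨_, h⟩
  · rintro ⟨t, rfl⟩
    rcases lt_trichotomy t 0 with ht | ht | ht
    · have := (hB (-t) (by linarith)).1
      rwa [smul_neg, neg_smul, neg_neg] at this
    · rw [ht, zero_smul, add_zero]; exact hx
    · exact (hB t ht).2
end Part7

open MeasureTheory Metric
open scoped ENNReal NNReal
open Filter Topology Set
set_option linter.unusedSectionVars false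

section Part8
variable {V : Type*} [NormedAddCommGroup V] [InnerProductSpace ℝ V] [FiniteDimensional ℝ V]
  [MeasurableSpace V] [BorelSpace V]

theorem aux_mem_support (μ : Measure V) [IsLocallyFiniteMeasure μ] (x : V) :
    x ∈ μ.support ↔ ∀ ε > 0, 0 < μ.real (ball x ε) := by
  refine ⟨fun h ε hε => aux_support_pos μ h hε, fun h => ?_⟩
  have h2 : x ∈ closure μ.support := by
    refine Metric.mem_closure_iff.2 fun ε hε => ?_
    obtain ⟨y, hy, hd⟩ := aux_exists_mem_support μ (h ε hε)
    exact ⟨y, hy, by rwa [dist_comm]⟩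
  rwa [Measure.isClosed_support.closure_eq] at h2

theorem aux_T3' (μ : Measure V) [IsLocallyFiniteMeasure μ] {x0 : V} (h0 : x0 ∈ μ.support)
    (h : ∀ x ∈ μ.support, ∀ r > 0, μ.real (ball x (2 * r)) = 2 * μ.real (ball x r)) :
    ∀ x ∈ μ.support, ∀ r > 0, μ.real (ball x r) = μ.real (ball x0 1) * r := by
  have hlf : IsLocallyFiniteMeasure (aSc μ 1 x0 1) := aSc_lf μ ENNReal.one_ne_top x0 one_pos
  have hball : ∀ z r, (aSc μ 1 x0 1).real (ball z r) = μ.real (ball (x0 + z) r) := by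
    intro z r
    simp [Measure.real, aSc_ball μ 1 x0 one_pos]
  have hs : ∀ z, z ∈ (aSc μ 1 x0 1).support ↔ x0 + z ∈ μ.support := by
    intro z
    rw [aux_mem_support, aux_mem_support]
    simp_rw [hball]
  intro x hx r hr
  have h1 := aux_T3 (aSc μ 1 x0 1) ((hs 0).2 (by simpa using h0)) (fun z hz r hr => by
    rw [hball, hball]
    exact h _ ((hs z).1 hz) r hr) hr
  rw [hball, hball, add_zero] at h1
  rw [aux_T1 μ h hx h0, h1]; ring

theorem aux_T5 (μ : Measure V) [IsLocallyFiniteMeasure μ] {c : ℝ} (hc : 0 < c)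
    (hb : ∀ x ∈ μ.support, ∀ r > 0, μ.real (ball x r) = c * r) {x v : V} (hv : ‖v‖ = 1)
    (hE : ∀ w, w ∈ μ.support ↔ ∃ t : ℝ, w = x + t • v) :
    μ = ENNReal.ofReal (c / 2) • (μH[1].restrict {y | ∃ t : ℝ, y = x + t • v}) := by
  let φ : ℝ → V := fun t => x + t • v
  let ψ : V → ℝ := fun z => inner ℝ v (z - x)
  have hφ : Isometry φ := by
    refine Isometry.of_dist_eq fun s t => ?_
    simp only [φ]
    rw [dist_add_left, dist_eq_norm, ← sub_smul, norm_smul, hv, mul_one, ← dist_eq_norm]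
  have hφm : Measurable φ := by fun_prop
  have hψm : Measurable ψ := by fun_prop
  have hψφ : ∀ t, ψ (φ t) = t := fun t => by
    simp only [ψ, φ]
    rw [add_sub_cancel_left, real_inner_smul_right, real_inner_self_eq_norm_sq, hv]; ring
  have hae : ∀ᵐ z ∂μ, φ (ψ z) = z := by
    filter_upwards [Measure.support_mem_ae (μ := μ)] with z hz
    obtain ⟨t, rfl⟩ := (hE z).1 hz
    change φ (ψ (φ t)) = φ t
    rw [hψφ]
  have hIoo : ∀ a b : ℝ, a < b → (μ.map ψ) (Ioo a b) = ENNReal.ofReal (c * ((b - a) / 2)) := by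
    intro a b hab
    have hm : φ ((a + b) / 2) ∈ μ.support := (hE _).2 ⟨_, rfl⟩
    rw [← hb _ hm _ (by linarith), ← aux_ball_ofReal, Measure.map_apply hψm measurableSet_Ioo]
    refine measure_congr ?_
    filter_upwards [hae] with z hz
    apply propext
    change ψ z ∈ Ioo a b ↔ z ∈ ball (φ ((a + b) / 2)) ((b - a) / 2)
    conv_rhs => rw [← hz]
    rw [mem_ball, hφ.dist_eq, Real.dist_eq, abs_lt, mem_Ioo]
    constructor <;> rintro ⟨h1, h2⟩ <;> constructor <;> linarith
  have hlf : IsLocallyFiniteMeasure (μ.map ψ) :=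
    ⟨fun t => ⟨Ioo (t - 1) (t + 1), Ioo_mem_nhds (by linarith) (by linarith), by
      rw [hIoo _ _ (by linarith)]; exact ENNReal.ofReal_lt_top⟩⟩
  have hmap : μ.map ψ = ENNReal.ofReal (c / 2) • (volume : Measure ℝ) := by
    refine Real.measure_ext_Ioo_rat fun a b => ?_
    rw [Measure.smul_apply, Real.volume_Ioo, smul_eq_mul]
    rcases lt_or_ge (a:ℝ) b with h | h
    · rw [hIoo _ _ h, ← ENNReal.ofReal_mul (by positivity)]
      congr 1; ring
    · rw [Ioo_eq_empty (not_lt.2 h), measure_empty, ENNReal.ofReal_of_nonpos (sub_nonpos.2 h), mul_zero]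
  have hμ : μ = (μ.map ψ).map φ := by
    rw [Measure.map_map hφm hψm]
    conv_lhs => rw [← Measure.map_id (μ := μ)]
    refine Measure.map_congr ?_
    filter_upwards [hae] with z hz
    exact hz.symm
  have hr : range φ = {y | ∃ t : ℝ, y = x + t • v} := by
    ext y; simp only [mem_range, φ, eq_comm]; rfl
  rw [← hr, ← hφ.map_hausdorffMeasure (Or.inl zero_le_one), hausdorffMeasure_real,
    ← Measure.map_smul, ← hmap]
  exact hμ

theorem aux_T (μ : Measure V) [IsLocallyFiniteMeasure μ] {x0 : V} (h0 : x0 ∈ μ.support)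
    (h : ∀ x ∈ μ.support, ∀ r > 0, μ.real (ball x (2 * r)) = 2 * μ.real (ball x r)) :
    ∃ k : ℝ, 0 ≤ k ∧ ∃ x v : V, v ≠ 0 ∧
      μ = ENNReal.ofReal k • (μH[1].restrict {y | ∃ t : ℝ, y = x + t • v}) := by
  have hc := aux_support_pos μ h0 one_pos
  have hb := aux_T3' μ h0 h
  obtain ⟨x, v, hv, hE⟩ := aux_T4 μ hc hb h0
  refine ⟨_, (half_pos hc).le, x, v, fun hv0 => ?_, aux_T5 μ hc hb hv hE⟩
  rw [hv0] at hv; simp at hv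
end Part8

open MeasureTheory Metric
open scoped ENNReal NNReal
open Filter Topology Set
set_option linter.unusedSectionVars false

section Part9
variable {V : Type*} [NormedAddCommGroup V] [InnerProductSpace ℝ V] [FiniteDimensional ℝ V]
  [MeasurableSpace V] [BorelSpace V]

/-- Density oscillation, general version. -/
noncomputable def aDl (μ : Measure V) (x : V) (r : ℝ) : ℝ :=
  |(μ (ball x r)).toReal / r - (μ (ball x (2 * r))).toReal / (2 * r)|

theorem aDl_integrable (μ : Measure V) [IsLocallyFiniteMeasure μ] (x : V) {a b : ℝ} (ha : 0 < a) :
    IntegrableOn (fun r => aDl μ x r ^ 2 / r) (Ioc a b) := by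
  have hm : Measurable fun r => (μ (ball x r)).toReal := by
    refine Monotone.measurable fun r s hrs => ?_
    exact ENNReal.toReal_mono measure_ball_lt_top.ne (measure_mono (ball_subset_ball hrs))
  have hm2 : Measurable fun r => (μ (ball x (2 * r))).toReal :=
    hm.comp (g := fun r => (μ (ball x r)).toReal) (f := fun r : ℝ => 2 * r) (by fun_prop)
  have hmeas : Measurable fun r => aDl μ x r ^ 2 / r := by
    unfold aDl
    refine Measurable.div (Measurable.pow_const (Measurable.abs ?_) 2) measurable_id
    exact (hm.div measurable_id).sub (hm2.div (by fun_prop))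
  set M := (μ (ball x b)).toReal / a + (μ (ball x (2 * b))).toReal / (2 * a) with hM
  refine Measure.integrableOn_of_bounded (M := M ^ 2 / a) (by simp) hmeas.aestronglyMeasurable ?_
  filter_upwards [ae_restrict_mem measurableSet_Ioc] with r hr
  have hr0 : 0 < r := ha.trans hr.1
  have h1 : aDl μ x r ≤ M := by
    have e1 : (μ (ball x r)).toReal / r ≤ (μ (ball x b)).toReal / a := by
      refine div_le_div₀ ENNReal.toReal_nonneg ?_ ha hr.1.le
      exact ENNReal.toReal_mono measure_ball_lt_top.ne (measure_mono (ball_subset_ball hr.2))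
    have e2 : (μ (ball x (2 * r))).toReal / (2 * r) ≤ (μ (ball x (2 * b))).toReal / (2 * a) := by
      refine div_le_div₀ ENNReal.toReal_nonneg ?_ (by positivity) (by linarith [hr.1])
      exact ENNReal.toReal_mono measure_ball_lt_top.ne
        (measure_mono (ball_subset_ball (by linarith [hr.2])))
    have e3 : 0 ≤ (μ (ball x r)).toReal / r := by positivity
    have e4 : 0 ≤ (μ (ball x (2 * r))).toReal / (2 * r) := by positivity
    unfold aDl
    rw [abs_le]; constructor <;> linarith
  have h0 : 0 ≤ aDl μ x r := abs_nonneg _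
  rw [Real.norm_of_nonneg (by positivity)]
  exact div_le_div₀ (sq_nonneg _) (pow_le_pow_left₀ h0 h1 2) ha hr.1.le

theorem aux_good (μ : Measure V) [IsLocallyFiniteMeasure μ] {y : V} {δ p q : ℝ} (hδ : 0 < δ)
    (hp : δ ≤ p) (hpq : p < q) (hq : q ≤ δ⁻¹)
    (hI : ∫ r in Ioc δ δ⁻¹, aDl μ y r ^ 2 / r ≤ δ ^ 4) :
    ∃ r ∈ Ioc p q, |2 * μ.real (ball y r) - μ.real (ball y (2 * r))| ≤
      2 * q * Real.sqrt (2 * q / (q - p)) * δ ^ 2 := by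
  have hp0 : 0 < p := hδ.trans_le hp
  have hq0 : 0 < q := hp0.trans hpq
  have hqp : 0 < q - p := sub_pos.2 hpq
  set K := δ ^ 4 * (2 * q / (q - p)) with hK
  obtain ⟨r, hr, hrK⟩ : ∃ r ∈ Ioc p q, aDl μ y r ^ 2 ≤ K := by
    by_contra hcon
    push Not at hcon
    have h1 : ∫ r in Ioc p q, aDl μ y r ^ 2 / r ≤ ∫ r in Ioc δ δ⁻¹, aDl μ y r ^ 2 / r := by
      refine setIntegral_mono_set (aDl_integrable μ y hδ) ?_
        (Eventually.of_forall (Ioc_subset_Ioc hp hq))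
      filter_upwards [ae_restrict_mem measurableSet_Ioc] with r hr
      have : 0 < r := hδ.trans hr.1
      simp only [Pi.zero_apply]; positivity
    have h2 : ∫ r in Ioc p q, K / q ≤ ∫ r in Ioc p q, aDl μ y r ^ 2 / r := by
      refine setIntegral_mono_on (by simp) (aDl_integrable μ y hp0) measurableSet_Ioc fun r hr => ?_
      exact div_le_div₀ (sq_nonneg _) (hcon r hr).le (hp0.trans hr.1) hr.2
    rw [setIntegral_const, Measure.real, Real.volume_Ioc, ENNReal.toReal_ofReal hqp.le,
      smul_eq_mul] at h2
    have h3 : (q - p) * (K / q) = 2 * δ ^ 4 := by rw [hK]; field_simp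
    have : 0 < δ ^ 4 := by positivity
    linarith
  refine ⟨r, hr, ?_⟩
  have hr0 : 0 < r := hp0.trans hr.1
  have h0 : 0 ≤ aDl μ y r := abs_nonneg _
  have h1 : aDl μ y r ≤ Real.sqrt (2 * q / (q - p)) * δ ^ 2 := by
    refine (Real.le_sqrt_of_sq_le hrK).trans (le_of_eq ?_)
    rw [hK, mul_comm, Real.sqrt_mul (by positivity), show δ ^ 4 = (δ ^ 2) ^ 2 by ring,
      Real.sqrt_sq (by positivity)]
  have h2 : |2 * μ.real (ball y r) - μ.real (ball y (2 * r))| = 2 * r * aDl μ y r := by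
    unfold aDl
    rw [← abs_of_pos (by positivity : 0 < 2 * r), ← abs_mul, abs_of_pos (by positivity : 0 < 2 * r)]
    congr 1
    simp only [Measure.real]
    field_simp
  rw [h2]
  calc 2 * r * aDl μ y r ≤ 2 * q * (Real.sqrt (2 * q / (q - p)) * δ ^ 2) := by
        gcongr; exact hr.2
    _ = _ := by ring

theorem aux_grow1 (μ : Measure V) [IsLocallyFiniteMeasure μ] {x : V} {δ R : ℝ} (hδ : 0 < δ)
    (hδ2 : δ < 1 / 2) (hR1 : 1 ≤ R) (hR : R ≤ δ⁻¹)
    (hI : ∫ r in Ioc δ δ⁻¹, aDl μ x r ^ 2 / r ≤ δ ^ 4) :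
    μ.real (ball x (3 / 2 * R)) ≤ 2 * μ.real (ball x R) + 6 := by
  obtain ⟨r, hr, h⟩ := aux_good μ (p := 3 / 4 * R) (q := R) hδ (by linarith) (by linarith) hR hI
  have h8 : Real.sqrt (2 * R / (R - 3 / 4 * R)) ≤ 3 := by
    rw [show 2 * R / (R - 3 / 4 * R) = 8 by field_simp; norm_num]
    rw [Real.sqrt_le_left (by norm_num)]; norm_num
  have h9 : 2 * R * Real.sqrt (2 * R / (R - 3 / 4 * R)) * δ ^ 2 ≤ 6 := by
    have hRd : R * δ ≤ 1 := by
      have := mul_le_mul_of_nonneg_right hR hδ.le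
      rwa [inv_mul_cancel₀ hδ.ne'] at this
    calc _ ≤ 2 * R * 3 * δ ^ 2 := by gcongr
      _ = 6 * (R * δ) * δ := by ring
      _ ≤ 6 * 1 * 1 := by gcongr; linarith
      _ = 6 := by norm_num
  have h1 : μ.real (ball x (3 / 2 * R)) ≤ μ.real (ball x (2 * r)) :=
    aux_real_ball_mono _ _ _ ball_subset_closedBall (ball_subset_ball (by linarith [hr.1]))
  have h2 : μ.real (ball x r) ≤ μ.real (ball x R) :=
    aux_real_ball_mono _ _ _ ball_subset_closedBall (ball_subset_ball hr.2)
  have := (abs_le.1 h).1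
  linarith

theorem aux_grow (μ : Measure V) [IsLocallyFiniteMeasure μ] {x : V} {δ : ℝ} (hδ : 0 < δ)
    (hδ2 : δ < 1 / 2) (h1 : μ.real (ball x 1) ≤ 1)
    (hI : ∫ r in Ioc δ δ⁻¹, aDl μ x r ^ 2 / r ≤ δ ^ 4) (n : ℕ) (hn : (3 / 2 : ℝ) ^ n ≤ 3 / 2 * δ⁻¹) :
    μ.real (ball x ((3 / 2) ^ n)) ≤ 7 * 2 ^ n - 6 := by
  induction n with
  | zero => simp; linarith
  | succ n ih =>
    rw [pow_succ'] at hn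
    have hn' : (3 / 2 : ℝ) ^ n ≤ δ⁻¹ := by linarith
    have := aux_grow1 μ hδ hδ2 (one_le_pow₀ (by norm_num)) hn' hI
    have h0 : 0 < δ⁻¹ := inv_pos.2 hδ
    have h3 := ih (by linarith)
    rw [pow_succ' (3 / 2 : ℝ), pow_succ' (2 : ℝ)]
    linarith

theorem aux_total (μ : Measure V) [IsLocallyFiniteMeasure μ] {x : V} {δ : ℝ} (hδ : 0 < δ)
    (hδ2 : δ < 1 / 2) (hx : ‖x‖ ≤ 1) (h1 : μ.real (ball x 1) ≤ 1)
    (hI : ∫ r in Ioc δ δ⁻¹, aDl μ x r ^ 2 / r ≤ δ ^ 4) :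
    μ.real (closedBall 0 δ⁻¹) ≤ 34 * (δ⁻¹) ^ 2 := by
  have hδi : 2 < δ⁻¹ := by
    rw [lt_inv_comm₀ two_pos hδ]; linarith
  obtain ⟨n, hn1, hn2⟩ := exists_nat_pow_near (x := δ⁻¹) (y := (3 / 2 : ℝ)) (by linarith)
    (by norm_num)
  have h2 := aux_grow μ hδ hδ2 h1 hI (n + 1) (by rw [pow_succ']; linarith)
  have h3 := aux_grow1 μ hδ hδ2 (by linarith) le_rfl hI
  have h4 : μ.real (ball x δ⁻¹) ≤ μ.real (ball x ((3 / 2) ^ (n + 1))) :=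
    aux_real_ball_mono _ _ _ ball_subset_closedBall (ball_subset_ball hn2.le)
  have h5 : μ.real (closedBall 0 δ⁻¹) ≤ μ.real (ball x (3 / 2 * δ⁻¹)) := by
    refine aux_real_ball_mono _ _ _ ball_subset_closedBall fun z hz => ?_
    rw [mem_closedBall, dist_zero_right] at hz
    rw [mem_ball, dist_eq_norm]
    have := norm_sub_le z x
    linarith
  have h6 : (2:ℝ) ^ n ≤ (δ⁻¹) ^ 2 := by
    calc (2:ℝ) ^ n ≤ ((3 / 2) ^ 2) ^ n := by gcongr; norm_num
      _ = ((3 / 2) ^ n) ^ 2 := by rw [← pow_mul, ← pow_mul, mul_comm]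
      _ ≤ _ := by gcongr
  have e : (2:ℝ) ^ (n + 1) = 2 * 2 ^ n := pow_succ' _ _
  rw [e] at h2
  nlinarith

end Part9

open MeasureTheory Metric
open scoped ENNReal NNReal
open Filter Topology Set
set_option linter.unusedSectionVars false

section Part10
variable {V : Type*} [NormedAddCommGroup V] [InnerProductSpace ℝ V] [FiniteDimensional ℝ V]
  [MeasurableSpace V] [BorelSpace V]

theorem aux_ev_le {𝒰 : Ultrafilter ℕ} {μ : ℕ → Measure V}
    (hμ : ∀ n, IsLocallyFiniteMeasure (μ n)) {ν : Measure V} (hν : IsLocallyFiniteMeasure ν)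
    (hlim : ∀ f : V → ℝ, Continuous f → HasCompactSupport f →
      Tendsto (fun n => ∫ x, f x ∂(μ n)) 𝒰 (𝓝 (∫ x, f x ∂ν)))
    (x : V) {r1 r2 κ : ℝ} (h : r1 < r2) (hκ : 0 < κ) :
    ∀ᶠ n in (𝒰 : Filter ℕ), (μ n).real (ball x r1) ≤ ν.real (ball x r2) + κ := by
  by_contra hcon
  rw [← Ultrafilter.eventually_not] at hcon
  have := aux_le_lim hμ hν hlim x h (C := ν.real (ball x r2) + κ)
    (hcon.mono fun n hn => (not_le.1 hn).le)
  linarith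

theorem aux_near {𝒰 : Ultrafilter ℕ} {μ : ℕ → Measure V}
    (hμ : ∀ n, IsLocallyFiniteMeasure (μ n)) {δ : ℕ → ℝ} (hδ : ∀ n, 0 < δ n)
    (hδ0 : Tendsto δ 𝒰 (𝓝 0)) {x : V}
    (hg : ∀ η > 0, ∀ᶠ n in (𝒰 : Filter ℕ), ∃ y, dist y x < η ∧
      ∫ r in Ioc (δ n) (δ n)⁻¹, aDl (μ n) y r ^ 2 / r ≤ δ n ^ 4)
    {r1 r2 κ : ℝ} (h1 : 0 < r1) (h12 : r1 < r2) (hκ : 0 < κ) :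
    ∀ᶠ n in (𝒰 : Filter ℕ),
      2 * (μ n).real (ball x r1) ≤ (μ n).real (ball x (2 * r2)) + κ ∧
      (μ n).real (ball x (2 * r1)) ≤ 2 * (μ n).real (ball x r2) + κ := by
  set η := (r2 - r1) / 8 with hη
  have hη0 : 0 < η := by rw [hη]; linarith
  set p := r1 + 3 * η with hp
  set q := r1 + 4 * η with hq
  have hd2 : Tendsto (fun n => 2 * q * Real.sqrt (2 * q / (q - p)) * δ n ^ 2) 𝒰 (𝓝 0) := by
    have := (hδ0.pow 2).const_mul (2 * q * Real.sqrt (2 * q / (q - p)))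
    simpa using this
  have hpp : 0 < p := by positivity
  have hqq : 0 < q⁻¹ := by positivity
  filter_upwards [hg η hη0, hd2.eventually_lt_const hκ, hδ0.eventually_lt_const hpp,
    hδ0.eventually_lt_const hqq] with n hn1 hn2 hn3 hn4
  obtain ⟨y, hy, hI⟩ := hn1
  have := hμ n
  obtain ⟨r, hr, hb⟩ := aux_good (μ n) (hδ n) hn3.le (by linarith : p < q)
    ((le_inv_comm₀ (by positivity) (hδ n)).2 hn4.le) hI
  have hb' := abs_le.1 (hb.trans hn2.le)
  have hy' : dist x y < η := by rwa [dist_comm]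
  have e1 : (μ n).real (ball x r1) ≤ (μ n).real (ball y r) :=
    aux_real_ball_mono _ _ _ ball_subset_closedBall (ball_subset_ball' (by linarith [hr.1]))
  have e2 : (μ n).real (ball y (2 * r)) ≤ (μ n).real (ball x (2 * r2)) :=
    aux_real_ball_mono _ _ _ ball_subset_closedBall (ball_subset_ball' (by linarith [hr.2]))
  have e3 : (μ n).real (ball x (2 * r1)) ≤ (μ n).real (ball y (2 * r)) :=
    aux_real_ball_mono _ _ _ ball_subset_closedBall (ball_subset_ball' (by linarith [hr.1]))
  have e4 : (μ n).real (ball y r) ≤ (μ n).real (ball x r2) :=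
    aux_real_ball_mono _ _ _ ball_subset_closedBall (ball_subset_ball' (by linarith [hr.2]))
  constructor <;> linarith [hb'.1, hb'.2]

theorem aux_lim_dyadic {𝒰 : Ultrafilter ℕ} {μ : ℕ → Measure V}
    (hμ : ∀ n, IsLocallyFiniteMeasure (μ n)) {ν : Measure V} (hν : IsLocallyFiniteMeasure ν)
    (hlim : ∀ f : V → ℝ, Continuous f → HasCompactSupport f →
      Tendsto (fun n => ∫ x, f x ∂(μ n)) 𝒰 (𝓝 (∫ x, f x ∂ν)))
    {δ : ℕ → ℝ} (hδ : ∀ n, 0 < δ n)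
    (hδ0 : Tendsto δ 𝒰 (𝓝 0)) {x : V}
    (hg : ∀ η > 0, ∀ᶠ n in (𝒰 : Filter ℕ), ∃ y, dist y x < η ∧
      ∫ r in Ioc (δ n) (δ n)⁻¹, aDl (μ n) y r ^ 2 / r ≤ δ n ^ 4)
    {r : ℝ} (hr : 0 < r) : ν.real (ball x (2 * r)) = 2 * ν.real (ball x r) := by
  have key : ∀ r1 r2, 0 < r1 → r1 < r2 → ∀ κ > 0,
      2 * ν.real (ball x r1) ≤ ν.real (ball x (2 * r2)) + 2 * κ ∧
      ν.real (ball x (2 * r1)) ≤ 2 * ν.real (ball x r2) + 3 * κ := by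
    intro r1 r2 h1 h12 κ hκ
    have hn := aux_near hμ hδ hδ0 hg (r1 := r1 + (r2 - r1) / 3) (r2 := r1 + 2 * (r2 - r1) / 3)
      (by linarith) (by linarith) hκ
    constructor
    · have := aux_lim_le hμ hν hlim x (r1 := r1) (r2 := r1 + (r2 - r1) / 3) (by linarith)
        (C := (ν.real (ball x (2 * r2)) + 2 * κ) / 2) (by
          filter_upwards [hn, aux_ev_le hμ hν hlim x (r1 := 2 * (r1 + 2 * (r2 - r1) / 3))
            (r2 := 2 * r2) (by linarith) hκ] with n a b
          linarith [a.1])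
      linarith
    · have := aux_lim_le hμ hν hlim x (r1 := 2 * r1) (r2 := 2 * (r1 + (r2 - r1) / 3)) (by linarith)
        (C := (2 * ν.real (ball x r2) + 3 * κ)) (by
          filter_upwards [hn, aux_ev_le hμ hν hlim x (r1 := (r1 + 2 * (r2 - r1) / 3))
            (r2 := r2) (by linarith) hκ] with n a b
          linarith [a.2])
      linarith
  have key2 : ∀ r1 r2, 0 < r1 → r1 < r2 →
      2 * ν.real (ball x r1) ≤ ν.real (ball x (2 * r2)) ∧
      ν.real (ball x (2 * r1)) ≤ 2 * ν.real (ball x r2) := by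
    intro r1 r2 h1 h12
    constructor
    · refine le_of_forall_pos_le_add fun κ hκ => ?_
      have := (key r1 r2 h1 h12 (κ / 2) (by linarith)).1
      linarith
    · refine le_of_forall_pos_le_add fun κ hκ => ?_
      have := (key r1 r2 h1 h12 (κ / 3) (by linarith)).2
      linarith
  have mono : ∀ a b, a ≤ b → ν.real (ball x a) ≤ ν.real (ball x b) := fun a b hab =>
    aux_real_ball_mono _ _ _ ball_subset_closedBall (ball_subset_ball hab)
  apply le_antisymm
  · refine aux_left_cont ν x fun s hs => ?_
    set t := max (s / 2) (r / 2) with ht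
    have h1 : 0 < t := lt_max_of_lt_right (by linarith)
    have h2 : t < r := max_lt (by linarith) (by linarith)
    have h3 : s ≤ 2 * t := by have := le_max_left (s / 2) (r / 2); linarith
    exact (mono _ _ h3).trans (key2 t r h1 h2).2
  · have := aux_left_cont ν x (r := r) (C := ν.real (ball x (2 * r)) / 2) fun s hs => by
      set t := max s (r / 2) with ht
      have h1 : 0 < t := lt_max_of_lt_right (by linarith)
      have h2 : t < r := max_lt (by linarith) (by linarith)
      have h3 : s ≤ t := le_max_left _ _
      have := (key2 t r h1 h2).1
      linarith [mono _ _ h3]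
    linarith

end Part10

open MeasureTheory Metric
open scoped ENNReal NNReal
open Filter Topology Set
set_option linter.unusedSectionVars false

section Part11
variable {V : Type*} [NormedAddCommGroup V] [InnerProductSpace ℝ V] [FiniteDimensional ℝ V]
  [MeasurableSpace V] [BorelSpace V]

theorem aux_arz [Nontrivial V] (𝒰 : Ultrafilter ℕ) (f : ℕ → V → ℝ)
    (hf : ∀ n, LipschitzWith 1 (f n)) (hs : ∀ n, Function.support (f n) ⊆ closedBall 0 2) :
    ∃ g : V → ℝ, LipschitzWith 1 g ∧ Function.support g ⊆ closedBall 0 2 ∧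
      ∀ η > 0, ∀ᶠ n in (𝒰 : Filter ℕ), ∀ x, |f n x - g x| ≤ η := by
  obtain ⟨p, hp⟩ := exists_norm_eq V (by norm_num : (0:ℝ) ≤ 3)
  have hz : ∀ n x, x ∉ closedBall (0:V) 2 → f n x = 0 := fun n x hx => by
    by_contra h; exact hx (hs n h)
  have hfp : ∀ n, f n p = 0 := fun n => hz n p (by simp [hp]; norm_num)
  have hl : ∀ x, ∃ l : ℝ, Tendsto (fun n => f n x) 𝒰 (𝓝 l) := by
    intro x
    obtain ⟨l, -, hl⟩ := (isCompact_Icc (a := -dist x p) (b := dist x p)).ultrafilter_le_nhds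
      (𝒰.map fun n => f n x) (le_principal_iff.2 (mem_map.2 (Filter.mem_of_superset univ_mem
        fun n _ => by
          have := (hf n).dist_le_mul x p
          rw [hfp, Real.dist_eq, sub_zero] at this
          simp only [NNReal.coe_one, one_mul] at this
          exact abs_le.1 this)))
    exact ⟨l, hl⟩
  choose g hg using hl
  have hgl : LipschitzWith 1 g := by
    refine LipschitzWith.of_dist_le_mul fun x y => ?_
    refine le_of_tendsto ((hg x).dist (hg y)) (Eventually.of_forall fun n => (hf n).dist_le_mul x y)
  have hgz : ∀ x, x ∉ closedBall (0:V) 2 → g x = 0 := fun x hx =>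
    tendsto_nhds_unique (hg x) (by simp [hz _ x hx])
  refine ⟨g, hgl, fun x hx => by by_contra h; exact hx (hgz x h), fun η hη => ?_⟩
  obtain ⟨t, -, htf, ht⟩ := (isCompact_closedBall (0:V) 2).finite_cover_balls
    (e := η / 3) (by positivity)
  have hev : ∀ᶠ n in (𝒰 : Filter ℕ), ∀ z ∈ t, |f n z - g z| < η / 3 := by
    rw [eventually_all_finite htf]
    intro z _
    have := (tendsto_iff_dist_tendsto_zero.1 (hg z)).eventually_lt_const
      (by positivity : 0 < η / 3)
    simpa [Real.dist_eq] using this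
  filter_upwards [hev] with n hn x
  by_cases hx : x ∈ closedBall (0:V) 2
  · obtain ⟨z, hz, hxz⟩ := mem_iUnion₂.1 (ht hx)
    have a1 := (hf n).dist_le_mul x z
    have a2 := hgl.dist_le_mul x z
    have a3 := hn z hz
    rw [mem_ball] at hxz
    rw [Real.dist_eq] at a1 a2
    simp only [NNReal.coe_one, one_mul] at a1 a2
    rw [abs_le] at a1 a2 ⊢
    rw [abs_lt] at a3
    constructor <;> linarith [a1.1, a1.2, a2.1, a2.2, a3.1, a3.2]
  · rw [hz n x hx, hgz x hx]; simp [hη.le]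

theorem aux_cs {f : V → ℝ} (hs : Function.support f ⊆ closedBall 0 2) : HasCompactSupport f :=
  HasCompactSupport.of_support_subset_isCompact (isCompact_closedBall _ _) hs

theorem aux_int_diff (m : Measure V) [IsLocallyFiniteMeasure m] {f g : V → ℝ} (hf : Continuous f)
    (hg : Continuous g) (hfs : Function.support f ⊆ closedBall 0 2)
    (hgs : Function.support g ⊆ closedBall 0 2) {η : ℝ} (h : ∀ x, |f x - g x| ≤ η) :
    |∫ x, f x ∂m - ∫ x, g x ∂m| ≤ η * m.real (closedBall 0 2) := by
  rw [← integral_sub (hf.integrable_of_hasCompactSupport (aux_cs hfs))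
    (hg.integrable_of_hasCompactSupport (aux_cs hgs))]
  rw [← setIntegral_eq_integral_of_forall_compl_eq_zero (s := closedBall (0:V) 2)]
  · exact norm_setIntegral_le_of_norm_le_const (f := fun x => f x - g x)
      (measure_closedBall_lt_top) fun x _ => (Real.norm_eq_abs _).trans_le (h x)
  · intro x hx
    have h1 : f x = 0 := by by_contra h; exact hx (hfs h)
    have h2 : g x = 0 := by by_contra h; exact hx (hgs h)
    rw [h1, h2, sub_zero]

theorem aux_weak [Nontrivial V] {𝒰 : Ultrafilter ℕ} {μ : ℕ → Measure V}
    (hμ : ∀ n, IsLocallyFiniteMeasure (μ n)) {ν : Measure V} (hν : IsLocallyFiniteMeasure ν)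
    (hlim : ∀ f : V → ℝ, Continuous f → HasCompactSupport f →
      Tendsto (fun n => ∫ x, f x ∂(μ n)) 𝒰 (𝓝 (∫ x, f x ∂ν)))
    (hm : ∀ n, (μ n).real (closedBall 0 2) ≤ 1) (f : ℕ → V → ℝ)
    (hf : ∀ n, LipschitzWith 1 (f n)) (hs : ∀ n, Function.support (f n) ⊆ closedBall 0 2)
    {ε : ℝ} (hε : 0 < ε) :
    ∀ᶠ n in (𝒰 : Filter ℕ), |∫ x, f n x ∂(μ n) - ∫ x, f n x ∂ν| ≤ ε := by
  obtain ⟨g, hg, hgs, hu⟩ := aux_arz 𝒰 f hf hs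
  set K := ν.real (closedBall (0:V) 2) with hK
  have hK0 : 0 ≤ K := measureReal_nonneg
  set η := ε / (K + 2) with hη
  have hη0 : 0 < η := by positivity
  have h1 := (tendsto_iff_dist_tendsto_zero.1 (hlim g hg.continuous
    (aux_cs hgs))).eventually_lt_const hη0
  filter_upwards [hu η hη0, h1] with n hn h1
  rw [Real.dist_eq] at h1
  have := hμ n
  have a1 := aux_int_diff (μ n) (hf n).continuous hg.continuous (hs n) hgs hn
  have a2 := aux_int_diff ν (hf n).continuous hg.continuous (hs n) hgs hn
  have a3 : η * (μ n).real (closedBall 0 2) ≤ η * 1 := by gcongr; exact hm n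
  have a4 : η * (K + 2) = ε := by rw [hη]; field_simp
  have a5 := a1.trans a3
  rw [abs_le] at a5 a2 ⊢
  rw [abs_lt] at h1
  constructor <;> linarith [a5.1, a5.2, a2.1, a2.2, h1.1, h1.2]

theorem aux_main [Nontrivial V] {ε : ℝ} (hε : 0 < ε) : ∃ δ0 : ℝ, 0 < δ0 ∧
    ∀ δ : ℝ, 0 < δ → δ < δ0 → ∀ (ν : Measure V), IsLocallyFiniteMeasure ν → ∀ G : Set V,
      ν.real (closedBall 0 2) = 1 → (closedBall 0 1 ∩ G).Nonempty →
      ν (closedBall 0 δ⁻¹ \ G) ≤ ENNReal.ofReal (δ ^ 4) * ν (closedBall 0 δ⁻¹) →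
      (∀ y ∈ G, ∫ r in Ioc δ δ⁻¹, aDl ν y r ^ 2 / r ≤ δ ^ 4) →
      ∃ k : ℝ, 0 ≤ k ∧ ∃ x v : V, v ≠ 0 ∧ ∀ f : V → ℝ, LipschitzWith 1 f →
        Function.support f ⊆ closedBall 0 2 →
        |∫ z, f z ∂ν - ∫ z, f z ∂(ENNReal.ofReal k •
          (μH[1].restrict {y : V | ∃ t : ℝ, y = x + t • v}))| ≤ ε := by
  by_contra hcon
  push Not at hcon
  choose δ hδ hδlt μ hμ G hmass hne hbad hG hviol using fun m : ℕ =>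
    hcon (1 / ((m:ℝ) + 3)) (by positivity)
  let 𝒰 : Ultrafilter ℕ := hyperfilter ℕ
  have hU : (𝒰 : Filter ℕ) ≤ atTop := by
    rw [← Nat.cofinite_eq_atTop]; exact hyperfilter_le_cofinite
  have hδ0 : Tendsto δ 𝒰 (𝓝 0) := by
    refine Tendsto.mono_left ?_ hU
    refine squeeze_zero (fun n => (hδ n).le) (fun n => (hδlt n).le.trans ?_)
      tendsto_one_div_add_atTop_nhds_zero_nat
    exact one_div_le_one_div_of_le (by positivity) (by linarith)
  have hδ2 : ∀ n, δ n < 1 / 2 := fun n => (hδlt n).trans_le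
    (one_div_le_one_div_of_le (by positivity) (by
      have : (0:ℝ) ≤ n := by positivity
      linarith))
  have hδi : ∀ R : ℝ, ∀ᶠ n in (𝒰 : Filter ℕ), R ≤ (δ n)⁻¹ := by
    intro R
    have : 0 < (max R 1)⁻¹ := by positivity
    filter_upwards [hδ0.eventually_lt_const this] with n hn
    exact (le_max_left _ _).trans ((le_inv_comm₀ (by positivity) (hδ n)).2 hn.le)
  choose x hx using hne
  have hx1 : ∀ n, ‖x n‖ ≤ 1 := fun n => by simpa using (hx n).1
  have hball : ∀ n, (μ n).real (ball (x n) 1) ≤ 1 := fun n => by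
    have := hμ n
    refine le_trans ?_ (hmass n).le
    refine aux_real_ball_mono _ 0 2 subset_rfl (ball_subset_closedBall.trans
      (closedBall_subset_closedBall' ?_))
    rw [dist_zero_right]; linarith [hx1 n]
  have hloc : ∀ R : ℝ, ∃ C : ℝ, ∀ᶠ n in (𝒰 : Filter ℕ), (μ n).real (closedBall 0 R) ≤ C := by
    intro R
    obtain ⟨N, hN⟩ := pow_unbounded_of_one_lt (R + 1) (by norm_num : (1:ℝ) < 3 / 2)
    refine ⟨7 * 2 ^ N - 6, ?_⟩
    filter_upwards [hδi ((3 / 2) ^ N)] with n hn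
    have := hμ n
    refine le_trans ?_ (aux_grow (μ n) (hδ n) (hδ2 n) (hball n) (hG n _ (hx n).2) N
      (by have := inv_pos.2 (hδ n); linarith))
    refine aux_real_ball_mono _ _ _ ball_subset_closedBall fun z hz => ?_
    rw [mem_closedBall, dist_zero_right] at hz
    rw [mem_ball, dist_eq_norm]
    have := norm_sub_le z (x n)
    linarith [hx1 n]
  obtain ⟨ν, hν, hlim⟩ := aux_ultralimit 𝒰 μ hμ hloc
  have hbadr : ∀ n, (μ n).real (closedBall 0 (δ n)⁻¹ \ G n) ≤ 34 * δ n ^ 2 := by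
    intro n
    have := hμ n
    have h1 := aux_total (μ n) (hδ n) (hδ2 n) (hx1 n) (hball n) (hG n _ (hx n).2)
    have h2 := ENNReal.toReal_mono (ENNReal.mul_ne_top ENNReal.ofReal_ne_top
      measure_closedBall_lt_top.ne) (hbad n)
    rw [ENNReal.toReal_mul, ENNReal.toReal_ofReal (by have := hδ n; positivity)] at h2
    calc _ ≤ _ := h2
      _ ≤ δ n ^ 4 * (34 * (δ n)⁻¹ ^ 2) := by have := hδ n; gcongr; exact h1
      _ = _ := by have := (hδ n).ne'; field_simp
  have hgood : ∀ z ∈ ν.support, ∀ η > 0, ∀ᶠ n in (𝒰 : Filter ℕ), ∃ y, dist y z < η ∧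
      ∫ r in Ioc (δ n) (δ n)⁻¹, aDl (μ n) y r ^ 2 / r ≤ δ n ^ 4 := by
    intro z hz η hη
    have h1 := aux_support_pos ν hz (half_pos hη)
    set a := ν.real (ball z (η / 2)) with ha
    have h2 : ∀ᶠ n in (𝒰 : Filter ℕ), a / 2 < (μ n).real (ball z η) := by
      by_contra hc
      rw [← Ultrafilter.eventually_not] at hc
      have := aux_lim_le hμ hν hlim z (by linarith : η / 2 < η) (C := a / 2)
        (hc.mono fun n hn => not_lt.1 hn)
      linarith
    have h3 : Tendsto (fun n => 34 * δ n ^ 2) 𝒰 (𝓝 0) := by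
      simpa using (hδ0.pow 2).const_mul 34
    filter_upwards [h2, h3.eventually_lt_const (half_pos h1), hδi (‖z‖ + η)] with n a1 a2 a3
    by_contra hc
    push Not at hc
    have := hμ n
    have h4 : ball z η ⊆ closedBall 0 (δ n)⁻¹ \ G n := by
      intro y hy
      refine ⟨?_, fun hyG => ?_⟩
      · refine closedBall_subset_closedBall' ?_ (ball_subset_closedBall hy)
        rw [dist_zero_right]; linarith
      · exact absurd (hG n y hyG) (not_le.2 (hc y hy))
    have h5 := aux_real_ball_mono (μ n) 0 (δ n)⁻¹ sdiff_subset h4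
    linarith [hbadr n]
  have hdy : ∀ z ∈ ν.support, ∀ r > 0, ν.real (ball z (2 * r)) = 2 * ν.real (ball z r) :=
    fun z hz r hr => aux_lim_dyadic hμ hν hlim hδ hδ0 (hgood z hz) hr
  obtain ⟨k, hk, z, v, hv, hkν⟩ : ∃ k, 0 ≤ k ∧ ∃ x v : V, v ≠ 0 ∧
      ν = ENNReal.ofReal k • (μH[1].restrict {y | ∃ t : ℝ, y = x + t • v}) := by
    by_cases he : ν.support.Nonempty
    · obtain ⟨z0, hz0⟩ := he
      exact aux_T ν hz0 hdy
    · obtain ⟨v, hv⟩ := exists_ne (0 : V)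
      refine ⟨0, le_rfl, 0, v, hv, ?_⟩
      have : ν = 0 := by
        have := Measure.measure_compl_support (μ := ν)
        rw [not_nonempty_iff_eq_empty.1 he, compl_empty] at this
        exact Measure.measure_univ_eq_zero.1 this
      simp [this]
  choose f hf hs hfv using fun n => hviol n k hk z v hv
  have := aux_weak hμ hν hlim (fun n => (hmass n).le) f hf hs hε
  obtain ⟨n, hn⟩ := this.exists
  have h2 := hfv n
  rw [← hkν] at h2
  exact absurd hn (not_le.2 h2)

end Part11

open MeasureTheory Metric
open scoped ENNReal NNReal
open Filter Topology Set
open scoped Pointwise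
set_option linter.unusedSectionVars false

section Part12
variable {V : Type*} [NormedAddCommGroup V] [InnerProductSpace ℝ V] [FiniteDimensional ℝ V]
  [MeasurableSpace V] [BorelSpace V]

theorem aSc_mono_real (μ : Measure V) (x0 : V) {r0 M : ℝ} (hr : 0 < r0) (hM : 0 < M) (z : V)
    (r : ℝ) : (aSc μ (ENNReal.ofReal M⁻¹) x0 r0⁻¹ (ball z r)).toReal =
      M⁻¹ * (μ (ball (x0 + r0 • z) (r0 * r))).toReal := by
  rw [aSc_ball μ _ x0 (inv_pos.2 hr), inv_inv, ENNReal.toReal_mul,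
    ENNReal.toReal_ofReal (by positivity), div_inv_eq_mul, mul_comm r]

theorem aDl_scale (μ : Measure V) (x0 : V) {r0 M : ℝ} (hr : 0 < r0) (hM : 0 < M) (z : V)
    {r : ℝ} : aDl (aSc μ (ENNReal.ofReal M⁻¹) x0 r0⁻¹) z r =
      r0 / M * aDl μ (x0 + r0 • z) (r0 * r) := by
  unfold aDl
  rw [aSc_mono_real μ x0 hr hM, aSc_mono_real μ x0 hr hM]
  conv_rhs => rw [← abs_of_pos (by positivity : 0 < r0 / M), ← abs_mul]
  rw [show r0 * (2 * r) = 2 * (r0 * r) by ring]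
  congr 1
  by_cases h : r = 0
  · simp [h]
  · field_simp

theorem aux_int_scale (μ : Measure V) (x0 : V) {r0 M δ : ℝ} (hr : 0 < r0) (hM : 0 < M)
    (hδ : 0 < δ) (hδ1 : δ ≤ 1) (z : V) :
    ∫ r in Ioc δ δ⁻¹, aDl (aSc μ (ENNReal.ofReal M⁻¹) x0 r0⁻¹) z r ^ 2 / r =
      (r0 / M) ^ 2 * ∫ r in Ioc (δ * r0) (δ⁻¹ * r0), aDl μ (x0 + r0 • z) r ^ 2 / r := by
  have h1 : δ ≤ δ⁻¹ := hδ1.trans ((one_le_inv₀ hδ).2 hδ1)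
  rw [← intervalIntegral.integral_of_le h1,
    ← intervalIntegral.integral_of_le (mul_le_mul_of_nonneg_right h1 hr.le)]
  have := intervalIntegral.smul_integral_comp_mul_left
    (fun r => aDl μ (x0 + r0 • z) r ^ 2 / r) (a := δ) (b := δ⁻¹) r0
  rw [mul_comm δ r0, mul_comm δ⁻¹ r0, ← this, smul_eq_mul, ← mul_assoc,
    ← intervalIntegral.integral_const_mul]
  congr 1
  ext r
  rw [aDl_scale μ x0 hr hM]
  by_cases h : r = 0
  · simp [h]
  · field_simp

theorem aux_haus (x0 : V) {r0 : ℝ} (hr : 0 < r0) (L : Set V) (f : V → ℝ) :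
    ∫ y, f (x0 + r0 • y) ∂((μH[1] : Measure V).restrict L) =
      r0⁻¹ * ∫ y, f y ∂((μH[1] : Measure V).restrict ((fun y => x0 + r0 • y) '' L)) := by
  let T : V ≃ₜ V := (Homeomorph.smulOfNeZero r0 hr.ne').trans (Homeomorph.addLeft x0)
  have hT : ∀ y, T y = x0 + r0 • y := fun y => rfl
  have hTe : MeasurableEmbedding T := T.measurableEmbedding
  have hm : (μH[1] : Measure V).map T = ENNReal.ofReal r0⁻¹ • μH[1] := by
    ext s hs
    rw [hTe.map_apply, Measure.smul_apply]
    have e : T ⁻¹' s = r0⁻¹ • ((fun y => -x0 + y) '' s) := by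
      ext y
      rw [mem_preimage, hT, Set.mem_inv_smul_set_iff₀ hr.ne']
      constructor
      · intro h; exact ⟨_, h, by simp⟩
      · rintro ⟨w, hw, he⟩
        have : w = x0 + r0 • y := by rw [← he]; simp
        rwa [← this]
    rw [e, Measure.hausdorffMeasure_smul₀ zero_le_one (inv_ne_zero hr.ne'),
      (IsometryEquiv.addLeft (-x0) : V ≃ᵢ V).isometry.hausdorffMeasure_image
        (Or.inl zero_le_one) s |> fun h => (h : μH[1] ((fun y => -x0 + y) '' s) = _)]
    rw [ENNReal.smul_def, NNReal.rpow_one]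
    congr 1
    rw [ENNReal.ofReal, ENNReal.coe_inj]
    ext
    rw [coe_nnnorm, Real.norm_of_nonneg (by positivity), Real.coe_toNNReal _ (by positivity)]
  have e1 : (fun y => x0 + r0 • y) '' L = T '' L := rfl
  calc ∫ y, f (x0 + r0 • y) ∂((μH[1] : Measure V).restrict L)
      = ∫ y, f (T y) ∂((μH[1] : Measure V).restrict (T ⁻¹' (T '' L))) := by
        rw [preimage_image_eq _ T.injective]; rfl
    _ = ∫ y, f y ∂(((μH[1] : Measure V).map T).restrict (T '' L)) := by
        rw [hTe.restrict_map, hTe.integral_map]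
    _ = _ := by
        rw [hm, e1, Measure.restrict_smul, integral_smul_measure,
          ENNReal.toReal_ofReal (by positivity), smul_eq_mul]

theorem aux_scaled [Nontrivial V] {ε : ℝ} (hε : 0 < ε) : ∃ δ0 : ℝ, 0 < δ0 ∧
    ∀ δ : ℝ, 0 < δ → δ < δ0 → ∀ (μ : Measure V), IsLocallyFiniteMeasure μ → ∀ (G : Set V)
      (x0 : V) (r0 : ℝ), 0 < r0 → 0 < μ (closedBall x0 r0 ∩ G) →
      μ (closedBall x0 (δ⁻¹ * r0) \ G) ≤ ENNReal.ofReal (δ ^ 4) * μ (closedBall x0 (δ⁻¹ * r0)) →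
      (∀ y ∈ G, ∫ r in Ioc (δ * r0) (δ⁻¹ * r0), aDl μ y r ^ 2 / r ≤
        δ ^ 4 * ((μ (closedBall x0 r0)).toReal / r0) ^ 2) →
      0 < μ.real (closedBall x0 (2 * r0)) ∧
      ∃ k : ℝ, 0 ≤ k ∧ ∃ x v : V, v ≠ 0 ∧ ∀ f : V → ℝ, LipschitzWith 1 f →
        Function.support f ⊆ closedBall x0 (2 * r0) →
        |∫ z, f z ∂μ - ∫ z, f z ∂(ENNReal.ofReal k •
          (μH[1].restrict {y : V | ∃ t : ℝ, y = x + t • v}))| ≤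
          ε * r0 * μ.real (closedBall x0 (2 * r0)) := by
  obtain ⟨δ0, hδ0, H⟩ := aux_main (V := V) hε
  refine ⟨min δ0 1, lt_min hδ0 one_pos, fun δ hδ hδlt μ hμ G x0 r0 hr hpos hbad hG => ?_⟩
  have hδ1 : δ < 1 := hδlt.trans_le (min_le_right _ _)
  set M := μ.real (closedBall x0 (2 * r0)) with hMdef
  have hsub : closedBall x0 r0 ⊆ closedBall x0 (2 * r0) := closedBall_subset_closedBall (by linarith)
  have hM : 0 < M := ENNReal.toReal_pos
    (hpos.trans_le (measure_mono (inter_subset_left.trans hsub))).ne'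
    measure_closedBall_lt_top.ne
  refine ⟨hM, ?_⟩
  set ν := aSc μ (ENNReal.ofReal M⁻¹) x0 r0⁻¹ with hν
  have hri : 0 < r0⁻¹ := inv_pos.2 hr
  have hνlf : IsLocallyFiniteMeasure ν := aSc_lf μ ENNReal.ofReal_ne_top x0 hri
  set T : V → V := fun y => x0 + r0 • y with hT
  have hcb : ∀ r, ν (closedBall 0 r) = ENNReal.ofReal M⁻¹ * μ (closedBall x0 (r * r0)) := by
    intro r
    rw [hν, aSc_closedBall μ _ x0 hri, smul_zero, add_zero, div_inv_eq_mul]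
  have hTS : ∀ y, T (r0⁻¹ • (y - x0)) = y := fun y => by
    simp [hT, smul_smul, hr.ne']
  let S : V ≃ₜ V := (Homeomorph.subRight x0).trans (Homeomorph.smulOfNeZero r0⁻¹ hri.ne')
  have hS : ∀ y, S y = r0⁻¹ • (y - x0) := fun y => rfl
  have hSe : MeasurableEmbedding S := S.measurableEmbedding
  have hνS : ν = ENNReal.ofReal M⁻¹ • μ.map S := rfl
  have hTS' : ∀ y, T (S y) = y := hTS
  have hSd : ∀ y r, S y ∈ closedBall (0:V) r ↔ y ∈ closedBall x0 (r * r0) := by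
    intro y r
    rw [mem_closedBall, mem_closedBall, hS, aux_dist_scale x0 0 y hri, smul_zero, add_zero,
      inv_mul_le_iff₀ hr, mul_comm]
  have hν1 : ν.real (closedBall 0 2) = 1 := by
    rw [Measure.real, hcb, ENNReal.toReal_mul, ENNReal.toReal_ofReal (by positivity)]
    exact inv_mul_cancel₀ hM.ne'
  obtain ⟨k, hk, x, v, hv, hf⟩ := H δ hδ (hδlt.trans_le (min_le_left _ _)) ν hνlf (T ⁻¹' G) hν1
    (by
      obtain ⟨y, hy1, hy2⟩ := nonempty_of_measure_ne_zero hpos.ne'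
      refine ⟨S y, (hSd y 1).2 (by simpa using hy1), ?_⟩
      rw [mem_preimage, hTS']; exact hy2)
    (by
      have e : S ⁻¹' (closedBall 0 δ⁻¹ \ T ⁻¹' G) = closedBall x0 (δ⁻¹ * r0) \ G := by
        ext y
        rw [mem_preimage, Set.mem_sdiff, Set.mem_sdiff, hSd, mem_preimage, hTS']
      rw [hcb, hνS, Measure.smul_apply, hSe.map_apply, e, smul_eq_mul, mul_left_comm]
      gcongr)
    (by
      intro y hy
      rw [hν, aux_int_scale μ x0 hr hM hδ hδ1.le]
      have h1 := hG _ hy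
      have h2 : (μ (closedBall x0 r0)).toReal ≤ M := aux_real_ball_mono μ _ _ subset_rfl hsub
      calc _ ≤ (r0 / M) ^ 2 * (δ ^ 4 * ((μ (closedBall x0 r0)).toReal / r0) ^ 2) := by gcongr
        _ = δ ^ 4 * ((μ (closedBall x0 r0)).toReal / M) ^ 2 := by field_simp
        _ ≤ δ ^ 4 * 1 ^ 2 := by gcongr; exact (div_le_one hM).2 h2
        _ = δ ^ 4 := by ring)
  refine ⟨k * M / r0, by positivity, x0 + r0 • x, v, hv, fun f hfl hfs => ?_⟩
  have h1 := hf (fun y => r0⁻¹ * f (T y)) (by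
      refine LipschitzWith.of_dist_le_mul fun a b => ?_
      have := hfl.dist_le_mul (T a) (T b)
      rw [hT, dist_add_left, dist_smul₀, Real.norm_of_nonneg hr.le] at this
      rw [Real.dist_eq, ← mul_sub, abs_mul, abs_of_pos hri, ← Real.dist_eq, NNReal.coe_one, one_mul]
      rw [NNReal.coe_one, one_mul] at this
      rw [inv_mul_le_iff₀ hr]; exact this)
    (by
      intro y hy
      have : f (T y) ≠ 0 := fun h => hy (by simp [h])
      have := hfs this
      have e : S (T y) = y := by simp [hS, hT, smul_smul, hr.ne']
      rw [← e, hSd]; exact this)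
  have hL : (fun y => x0 + r0 • y) '' {y : V | ∃ t : ℝ, y = x + t • v} =
      {y : V | ∃ t : ℝ, y = x0 + r0 • x + t • v} := by
    ext y
    constructor
    · rintro ⟨w, ⟨t, rfl⟩, rfl⟩
      exact ⟨r0 * t, by simp only [smul_add, smul_smul, add_assoc]⟩
    · rintro ⟨t, rfl⟩
      refine ⟨x + (r0⁻¹ * t) • v, ⟨_, rfl⟩, ?_⟩
      simp only [smul_add, smul_smul, add_assoc]
      rw [mul_inv_cancel_left₀ hr.ne']
  rw [integral_const_mul, integral_const_mul, integral_smul_measure, aux_haus x0 hr, hL, hνS,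
    integral_smul_measure, hSe.integral_map] at h1
  simp only [hTS'] at h1
  rw [ENNReal.toReal_ofReal (by positivity), ENNReal.toReal_ofReal hk] at h1
  rw [integral_smul_measure, ENNReal.toReal_ofReal (by positivity)]
  simp only [smul_eq_mul] at h1 ⊢
  set A := ∫ z, f z ∂μ
  set B := ∫ z, f z ∂(μH[1].restrict {y : V | ∃ t : ℝ, y = x0 + r0 • x + t • v})
  have e : A - k * M / r0 * B = (r0 * M) * (r0⁻¹ * (M⁻¹ * A) - r0⁻¹ * (k * (r0⁻¹ * B))) := by
    field_simp
  rw [e, abs_mul, abs_of_pos (by positivity)]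
  calc _ ≤ r0 * M * ε := by gcongr
    _ = _ := by ring

end Part12

end AuxAll

theorem stmt5 {d : ℕ} (hd : 1 ≤ d) (ε : ℝ) (hε : 0 < ε) :
    ∃ δ₀ : ℝ, 0 < δ₀ ∧
      ∀ δ : ℝ, 0 < δ → δ < δ₀ →
      ∀ μ : Measure (EuclideanSpace ℝ (Fin d)), IsLocallyFiniteMeasure μ →
      ∀ (x₀ : EuclideanSpace ℝ (Fin d)) (r₀ : ℝ), 0 < r₀ →
      0 < μ (closedBall x₀ r₀ ∩
          Gset μ (δ * r₀) (δ⁻¹ * r₀) (δ ^ 4 * ((μ (closedBall x₀ r₀)).toReal / r₀) ^ 2)) →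
      μ (closedBall x₀ (δ⁻¹ * r₀) \
          Gset μ (δ * r₀) (δ⁻¹ * r₀) (δ ^ 4 * ((μ (closedBall x₀ r₀)).toReal / r₀) ^ 2)) ≤
        ENNReal.ofReal (δ ^ 4) * μ (closedBall x₀ (δ⁻¹ * r₀)) →
      alphaMu μ (closedBall x₀ (2 * r₀)) (2 * r₀) < ε := by
  have : Nonempty (Fin d) := ⟨⟨0, hd⟩⟩
  obtain ⟨δ0, hδ0, H⟩ := aux_scaled (V := EuclideanSpace ℝ (Fin d)) hε
  refine ⟨δ0, hδ0, fun δ hδ hδlt μ hμ x₀ r₀ hr hpos hbad => ?_⟩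
  obtain ⟨hM, k, hk, x, v, hv, hf⟩ := H δ hδ hδlt μ hμ _ x₀ r₀ hr hpos hbad (fun y hy => hy)
  set M := μ.real (closedBall x₀ (2 * r₀)) with hMdef
  have hbdd : BddBelow (Set.range fun p : {p : ℝ × Set (EuclideanSpace ℝ (Fin d)) //
      0 ≤ p.1 ∧ IsLine p.2} => distB (closedBall x₀ (2 * r₀)) μ
        ((ENNReal.ofReal p.1.1) • (μH[1].restrict p.1.2))) := by
    refine ⟨0, ?_⟩
    rintro _ ⟨p, rfl⟩
    exact Real.iSup_nonneg fun f => abs_nonneg _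
  have h1 := ciInf_le hbdd ⟨(k, {y | ∃ t : ℝ, y = x + t • v}), hk, x, v, hv, rfl⟩
  have h2 : distB (closedBall x₀ (2 * r₀)) μ
      ((ENNReal.ofReal k) • (μH[1].restrict {y | ∃ t : ℝ, y = x + t • v})) ≤ ε * r₀ * M :=
    Real.iSup_le (fun f => hf f.1 f.2.1 f.2.2) (by positivity)
  have h3 := h1.trans h2
  unfold alphaMu
  have hM' : (μ (closedBall x₀ (2 * r₀))).toReal = M := rfl
  rw [hM']
  calc _ ≤ 1 / (2 * r₀ * M) * (ε * r₀ * M) := mul_le_mul_of_nonneg_left h3 (by positivity)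
    _ = ε / 2 := by field_simp
    _ < ε := by linarith
end

section
/- Let φ : [0,∞) → ℝ be a C^∞ function supported in [0,2] which is constant on [0,1/2]. For t > 0 set φ_t(y) = t^{-1}·φ(|y|/t) for y ∈ ℝ^d, and for a Radon measure μ on ℝ^d set Δ_{μ,φ}(x,t) = ∫ (φ_t(y−x) − φ_{2t}(y−x)) dμ(y). Then for every 1 ≤ p < ∞ there is a constant c, depending only on φ and p, such that for every Radon measure μ on ℝ^d, every x ∈ ℝ^d and all 0 ≤ r₁ < r₂: ∫_{r₁}^{r₂} |Δ_{μ,φ}(x,r)|^p (dr/r) ≤ c·∫_{r₁/2}^{2 r₂} Δ_μ(x,r)^p (dr/r). -/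
open MeasureTheory Metric
open scoped ENNReal NNReal

/-- `Δ_{μ,φ}(x,t) = ∫ (φ_t(y−x) − φ_{2t}(y−x)) dμ(y)` with `φ_t(y) = t⁻¹ φ(|y|/t)`. -/
noncomputable def phiDelta {d : ℕ} (φ : ℝ → ℝ) (μ : Measure (EuclideanSpace ℝ (Fin d)))
    (x : EuclideanSpace ℝ (Fin d)) (t : ℝ) : ℝ :=
  ∫ y, ((1 / t) * φ (‖y - x‖ / t) - (1 / (2 * t)) * φ (‖y - x‖ / (2 * t))) ∂μ


lemma F_eq {d : ℕ} (φ : ℝ → ℝ) (hsmooth : ContDiff ℝ (⊤ : ℕ∞) φ)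
    (hsupp : ∀ s : ℝ, 2 ≤ s → φ s = 0)
    (hconst : ∀ s : ℝ, s ≤ 1 / 2 → φ s = φ 0)
    (μ : Measure (EuclideanSpace ℝ (Fin d))) [IsLocallyFiniteMeasure μ]
    (x : EuclideanSpace ℝ (Fin d)) (t : ℝ) (ht : 0 < t) (C : ℝ)
    (hC : ∀ u ∈ Set.Ioc (1/2 : ℝ) 2, |deriv φ u| ≤ C) :
    ∫ y, φ (‖y - x‖ / t) ∂μ =
      ∫ u in Set.Ioc (1/2 : ℝ) 2, - (deriv φ u * (μ (ball x (t * u))).toReal) := by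
  have hd : Continuous (deriv φ) := hsmooth.continuous_deriv (by simp)
  have hdiff : Differentiable ℝ φ := hsmooth.differentiable (by simp)
  have hrep : ∀ s : ℝ, φ s = ∫ u in Set.Ioc (1/2 : ℝ) 2, (Set.Ioi s).indicator (fun u => - deriv φ u) u := by
    intro s
    rw [setIntegral_indicator measurableSet_Ioi, integral_neg]
    have ftc : ∀ a ≤ (2:ℝ), ∫ u in Set.Ioc a 2, deriv φ u = φ 2 - φ a := by
      intro a ha
      rw [← intervalIntegral.integral_of_le ha]
      exact intervalIntegral.integral_deriv_eq_sub (fun x _ => hdiff x) (hd.intervalIntegrable _ _)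
    rcases le_total s (1/2) with h | h
    · have : Set.Ioc (1/2 : ℝ) 2 ∩ Set.Ioi s = Set.Ioc (1/2) 2 := by
        ext u; simp only [Set.mem_inter_iff, Set.mem_Ioc, Set.mem_Ioi]
        constructor
        · exact fun h => h.1
        · exact fun h' => ⟨h', by linarith [h'.1]⟩
      rw [this, ftc _ (by norm_num), hsupp 2 le_rfl, hconst s h, hconst (1/2) le_rfl]; ring
    · rcases le_total s 2 with h2 | h2
      · have : Set.Ioc (1/2 : ℝ) 2 ∩ Set.Ioi s = Set.Ioc s 2 := by
          ext u; simp only [Set.mem_inter_iff, Set.mem_Ioc, Set.mem_Ioi]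
          constructor
          · exact fun h => ⟨h.2, h.1.2⟩
          · exact fun h' => ⟨⟨by linarith [h'.1], h'.2⟩, h'.1⟩
        rw [this, ftc _ h2, hsupp 2 le_rfl]; ring
      · have : Set.Ioc (1/2 : ℝ) 2 ∩ Set.Ioi s = ∅ := by
          ext u; simp only [Set.mem_inter_iff, Set.mem_Ioc, Set.mem_Ioi, Set.mem_empty_iff_false, iff_false]
          intro h'; linarith [h'.1.2, h'.2]
        rw [this, hsupp s h2]; simp
  have hfin : IsFiniteMeasure (μ.restrict (ball x (2 * t))) :=
    ⟨by rw [Measure.restrict_apply_univ]; exact measure_ball_lt_top⟩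
  have h1 : ∫ y, φ (‖y - x‖ / t) ∂μ = ∫ y in ball x (2 * t), φ (‖y - x‖ / t) ∂μ := by
    symm
    apply setIntegral_eq_integral_of_forall_compl_eq_zero
    intro y hy
    apply hsupp
    rw [mem_ball, not_lt, dist_eq_norm] at hy
    rwa [le_div_iff₀ ht]
  rw [h1]
  simp_rw [fun y => hrep (‖y - x‖ / t)]
  rw [integral_integral_swap]
  · apply setIntegral_congr_fun measurableSet_Ioc
    intro u hu
    have : ∀ y, (Set.Ioi (‖y - x‖ / t)).indicator (fun u => - deriv φ u) u
        = (ball x (t * u)).indicator (fun _ => - deriv φ u) y := by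
      intro y
      simp only [Set.indicator, Set.mem_Ioi, mem_ball, dist_eq_norm, div_lt_iff₀ ht, mul_comm]
    simp only [this]
    rw [integral_indicator measurableSet_ball, Measure.restrict_restrict measurableSet_ball,
      Set.inter_eq_left.2 (ball_subset_ball (by nlinarith [hu.2])), setIntegral_const]
    simp [Measure.real, mul_comm]
  · have hset : MeasurableSet {q : EuclideanSpace ℝ (Fin d) × ℝ | ‖q.1 - x‖ / t < q.2} := by
      apply measurableSet_lt <;> fun_prop
    have hm : Measurable (Function.uncurry fun (y : EuclideanSpace ℝ (Fin d)) u =>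
        (Set.Ioi (‖y - x‖ / t)).indicator (fun u => - deriv φ u) u) := by
      have : (Function.uncurry fun (y : EuclideanSpace ℝ (Fin d)) u =>
        (Set.Ioi (‖y - x‖ / t)).indicator (fun u => - deriv φ u) u) =
        {q : EuclideanSpace ℝ (Fin d) × ℝ | ‖q.1 - x‖ / t < q.2}.indicator
          (fun q => - deriv φ q.2) := by
        ext q; simp [Set.indicator, Function.uncurry]
      rw [this]
      exact Measurable.indicator (by fun_prop) hset
    refine Integrable.of_bound hm.aestronglyMeasurable C ?_
    rw [Measure.prod_restrict]
    filter_upwards [ae_restrict_mem (measurableSet_ball.prod measurableSet_Ioc)] with q hq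
    have := hC q.2 hq.2
    simp only [Function.uncurry, Set.indicator]
    split_ifs
    · simpa using this
    · simpa using (abs_nonneg _).trans this

lemma int_phi {d : ℕ} (φ : ℝ → ℝ) (hφ : Continuous φ)
    (hsupp : ∀ s : ℝ, 2 ≤ s → φ s = 0)
    (μ : Measure (EuclideanSpace ℝ (Fin d))) [IsLocallyFiniteMeasure μ]
    (x : EuclideanSpace ℝ (Fin d)) (t : ℝ) (ht : 0 < t) :
    Integrable (fun y => φ (‖y - x‖ / t)) μ := by
  apply Continuous.integrable_of_hasCompactSupport
  · fun_prop
  · apply HasCompactSupport.intro (isCompact_closedBall x (2 * t))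
    intro y hy
    apply hsupp
    rw [mem_closedBall, not_le, dist_eq_norm] at hy
    rw [le_div_iff₀ ht]; exact hy.le

lemma meas_ball {d : ℕ} (μ : Measure (EuclideanSpace ℝ (Fin d))) [IsLocallyFiniteMeasure μ]
    (x : EuclideanSpace ℝ (Fin d)) : Measurable (fun r : ℝ => (μ (ball x r)).toReal) := by
  apply Monotone.measurable
  intro a b h
  exact ENNReal.toReal_mono measure_ball_lt_top.ne (measure_mono (ball_subset_ball h))

lemma meas_delta {d : ℕ} (μ : Measure (EuclideanSpace ℝ (Fin d))) [IsLocallyFiniteMeasure μ]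
    (x : EuclideanSpace ℝ (Fin d)) : Measurable (fun r : ℝ => ballDelta μ x r) := by
  unfold ballDelta
  have h := meas_ball μ x
  have h2 : Measurable (fun r : ℝ => (μ (ball x (2 * r))).toReal) :=
    h.comp (measurable_const_mul 2)
  have := (h.div measurable_id).sub (h2.div (measurable_const_mul 2))
  exact continuous_abs.measurable.comp this

lemma int_ball {d : ℕ} (φ : ℝ → ℝ) (hd : Continuous (deriv φ))
    (μ : Measure (EuclideanSpace ℝ (Fin d))) [IsLocallyFiniteMeasure μ]
    (x : EuclideanSpace ℝ (Fin d)) (t : ℝ) (ht : 0 < t) (C : ℝ)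
    (hC : ∀ u ∈ Set.Ioc (1/2 : ℝ) 2, |deriv φ u| ≤ C) :
    IntegrableOn (fun u => - (deriv φ u * (μ (ball x (t * u))).toReal)) (Set.Ioc (1/2 : ℝ) 2) := by
  have hm : Measurable (fun u => - (deriv φ u * (μ (ball x (t * u))).toReal)) :=
    (hd.measurable.mul ((meas_ball μ x).comp (measurable_const_mul t))).neg
  refine Integrable.of_bound hm.aestronglyMeasurable (C * (μ (ball x (t * 2))).toReal) ?_
  filter_upwards [ae_restrict_mem measurableSet_Ioc] with u hu
  rw [norm_neg, norm_mul, Real.norm_eq_abs, Real.norm_eq_abs, abs_of_nonneg ENNReal.toReal_nonneg]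
  refine mul_le_mul (hC u hu) ?_ ENNReal.toReal_nonneg ((abs_nonneg _).trans (hC u hu))
  exact ENNReal.toReal_mono measure_ball_lt_top.ne
    (measure_mono (ball_subset_ball (by nlinarith [hu.2])))

lemma phiDelta_le {d : ℕ} (φ : ℝ → ℝ) (hsmooth : ContDiff ℝ (⊤ : ℕ∞) φ)
    (hsupp : ∀ s : ℝ, 2 ≤ s → φ s = 0)
    (hconst : ∀ s : ℝ, s ≤ 1 / 2 → φ s = φ 0)
    (μ : Measure (EuclideanSpace ℝ (Fin d))) [IsLocallyFiniteMeasure μ]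
    (x : EuclideanSpace ℝ (Fin d)) (t : ℝ) (ht : 0 < t) (C : ℝ)
    (hC : ∀ u ∈ Set.Ioc (1/2 : ℝ) 2, |deriv φ u| ≤ C) :
    ENNReal.ofReal |phiDelta φ μ x t| ≤
      ENNReal.ofReal (C * 2) *
        ∫⁻ u in Set.Ioc (1/2 : ℝ) 2, ENNReal.ofReal (ballDelta μ x (t * u)) := by
  have hd : Continuous (deriv φ) := hsmooth.continuous_deriv (by simp)
  have h2t : 0 < 2 * t := by positivity
  have key : phiDelta φ μ x t = ∫ u in Set.Ioc (1/2 : ℝ) 2,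
      ((1 / t) * (- (deriv φ u * (μ (ball x (t * u))).toReal)) -
       (1 / (2 * t)) * (- (deriv φ u * (μ (ball x (2 * t * u))).toReal))) := by
    unfold phiDelta
    rw [integral_sub ((int_phi φ hsmooth.continuous hsupp μ x t ht).const_mul _)
      ((int_phi φ hsmooth.continuous hsupp μ x _ h2t).const_mul _),
      integral_sub ((int_ball φ hd μ x t ht C hC).const_mul _)
      ((int_ball φ hd μ x _ h2t C hC).const_mul _), integral_const_mul, integral_const_mul,
      integral_const_mul, integral_const_mul, F_eq φ hsmooth hsupp hconst μ x t ht C hC,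
      F_eq φ hsmooth hsupp hconst μ x _ h2t C hC]
  rw [key, ← Real.norm_eq_abs, ofReal_norm]
  refine (enorm_integral_le_lintegral_enorm _).trans ?_
  rw [← lintegral_const_mul']
  swap
  · exact ENNReal.ofReal_ne_top
  apply setLIntegral_mono' measurableSet_Ioc
  intro u hu
  have hu0 : 0 < u := by linarith [hu.1]
  rw [← ofReal_norm, Real.norm_eq_abs]
  have hC0 := (abs_nonneg _).trans (hC u hu)
  rw [← ENNReal.ofReal_mul (by positivity)]
  apply ENNReal.ofReal_le_ofReal
  unfold ballDelta
  have e : ((1 / t) * (- (deriv φ u * (μ (ball x (t * u))).toReal)) -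
       (1 / (2 * t)) * (- (deriv φ u * (μ (ball x (2 * t * u))).toReal))) =
      - (deriv φ u * u) * ((μ (ball x (t * u))).toReal / (t * u) -
        (μ (ball x (2 * (t * u)))).toReal / (2 * (t * u))) := by
    rw [mul_assoc 2 t u]
    field_simp
    ring
  rw [e, abs_mul, abs_neg, abs_mul, abs_of_pos hu0]
  gcongr
  · exact hC u hu
  · exact hu.2

lemma jensen {ν : Measure ℝ} (f : ℝ → ℝ≥0∞) (hf : Measurable f) (p : ℝ) (hp : 1 ≤ p) :
    (∫⁻ u, f u ∂ν) ^ p ≤ ν Set.univ ^ (p - 1) * ∫⁻ u, f u ^ p ∂ν := by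
  have h := eLpNorm'_le_eLpNorm'_mul_rpow_measure_univ (μ := ν) (f := f) zero_lt_one hp
    hf.aestronglyMeasurable
  have hp0 : 0 < p := by linarith
  simp only [eLpNorm', enorm_eq_self, ENNReal.rpow_one, div_one] at h
  refine (ENNReal.rpow_le_rpow h hp0.le).trans ?_
  rw [ENNReal.mul_rpow_of_nonneg _ _ hp0.le, ← ENNReal.rpow_mul, ← ENNReal.rpow_mul, mul_comm]
  rw [one_div_mul_cancel hp0.ne', ENNReal.rpow_one]
  have : (1 - 1 / p) * p = p - 1 := by field_simp
  rw [this]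

lemma chvar (G : ℝ → ℝ≥0∞) (hG : Measurable G) (u a b : ℝ) (hu : 0 < u) :
    ∫⁻ r in Set.Ioc a b, ENNReal.ofReal u * G (r * u) = ∫⁻ s in Set.Ioc (a * u) (b * u), G s := by
  conv_rhs => rw [← Real.smul_map_volume_mul_right hu.ne']
  rw [Measure.restrict_smul, lintegral_smul_measure, abs_of_pos hu,
    setLIntegral_map measurableSet_Ioc hG (by fun_prop), lintegral_const_mul _ (by fun_prop),
    smul_eq_mul]
  congr 3
  ext r; simp [hu, hu.ne']

theorem stmt6 {d : ℕ} (φ : ℝ → ℝ) (hsmooth : ContDiff ℝ (⊤ : ℕ∞) φ)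
    (hsupp : ∀ s : ℝ, 2 ≤ s → φ s = 0)
    (hconst : ∀ s : ℝ, s ≤ 1 / 2 → φ s = φ 0)
    (p : ℝ) (hp : 1 ≤ p) :
    ∃ c : ℝ, 0 < c ∧
      ∀ μ : Measure (EuclideanSpace ℝ (Fin d)), IsLocallyFiniteMeasure μ →
      ∀ (x : EuclideanSpace ℝ (Fin d)) (r₁ r₂ : ℝ), 0 ≤ r₁ → r₁ < r₂ →
        (∫⁻ r in Set.Ioc r₁ r₂, ENNReal.ofReal (|phiDelta φ μ x r| ^ p / r)) ≤
          ENNReal.ofReal c *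
            ∫⁻ r in Set.Ioc (r₁ / 2) (2 * r₂),
              ENNReal.ofReal ((ballDelta μ x r) ^ p / r) := by
  have hd : Continuous (deriv φ) := hsmooth.continuous_deriv (by simp)
  have hp0 : 0 < p := by linarith
  obtain ⟨C, hC0, hC⟩ : ∃ C : ℝ, 0 < C ∧ ∀ u ∈ Set.Ioc (1/2 : ℝ) 2, |deriv φ u| ≤ C := by
    obtain ⟨C, hC⟩ := (isCompact_Icc (a := (1/2 : ℝ)) (b := 2)).exists_bound_of_continuousOn
      hd.continuousOn
    exact ⟨max C 1, by positivity, fun u hu => (hC u ⟨hu.1.le, hu.2⟩).trans (le_max_left _ _)⟩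
  refine ⟨(C * 2) ^ p * (3/2) ^ (p - 1) * (2 * (3/2)), by positivity, ?_⟩
  intro μ hμ x r₁ r₂ h1 h12
  set ν : Measure ℝ := volume.restrict (Set.Ioc (1/2 : ℝ) 2) with hν
  have hνu : ν Set.univ = ENNReal.ofReal (3/2) := by
    rw [hν, Measure.restrict_apply_univ, Real.volume_Ioc]; norm_num
  set G : ℝ → ℝ≥0∞ := fun r => ENNReal.ofReal ((ballDelta μ x r) ^ p / r) with hGdef
  have hG : Measurable G := by
    have := meas_delta μ x
    fun_prop
  have hB : ∀ r, 0 ≤ ballDelta μ x r := fun r => abs_nonneg _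
  set K : ℝ≥0∞ := ENNReal.ofReal ((C * 2) ^ p * (3/2) ^ (p - 1)) with hK
  have pt : ∀ r ∈ Set.Ioc r₁ r₂, ENNReal.ofReal (|phiDelta φ μ x r| ^ p / r) ≤
      K * ∫⁻ u, ENNReal.ofReal u * G (r * u) ∂ν := by
    intro r hr
    have hr0 : 0 < r := by linarith [hr.1]
    have hmd : Measurable (fun u => ENNReal.ofReal (ballDelta μ x (r * u))) :=
      ENNReal.measurable_ofReal.comp ((meas_delta μ x).comp (measurable_const_mul r))
    rw [div_eq_mul_inv, ENNReal.ofReal_mul (by positivity), ← ENNReal.ofReal_rpow_of_nonneg (abs_nonneg _) hp0.le]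
    have h := ENNReal.rpow_le_rpow (phiDelta_le φ hsmooth hsupp hconst μ x r hr0 C hC) hp0.le
    rw [ENNReal.mul_rpow_of_nonneg _ _ hp0.le] at h
    have hj := jensen (ν := ν) _ hmd p hp
    rw [hνu, ENNReal.ofReal_rpow_of_nonneg (by norm_num) (by linarith)] at hj
    rw [ENNReal.ofReal_rpow_of_nonneg (p := p) (x := C * 2) (by positivity) hp0.le] at h
    have h' := h.trans (mul_le_mul_right hj _)
    rw [← mul_assoc, ← ENNReal.ofReal_mul (by positivity)] at h'
    refine (mul_le_mul_left h' _).trans ?_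
    rw [mul_assoc]
    refine mul_le_mul_right ?_ _
    rw [← lintegral_mul_const' _ _ ENNReal.ofReal_ne_top]
    apply setLIntegral_mono' measurableSet_Ioc
    intro u hu
    have hu0 : 0 < u := by linarith [hu.1]
    rw [hGdef, ENNReal.ofReal_rpow_of_nonneg (hB _) hp0.le, ← ENNReal.ofReal_mul (by have := hB (r*u); positivity),
      ← ENNReal.ofReal_mul hu0.le]
    apply le_of_eq
    congr 1
    field_simp
  calc _ ≤ ∫⁻ r in Set.Ioc r₁ r₂, K * ∫⁻ u, ENNReal.ofReal u * G (r * u) ∂ν :=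
        setLIntegral_mono' measurableSet_Ioc pt
    _ = K * ∫⁻ r in Set.Ioc r₁ r₂, ∫⁻ u, ENNReal.ofReal u * G (r * u) ∂ν :=
        lintegral_const_mul' _ _ ENNReal.ofReal_ne_top
    _ = K * ∫⁻ u, (∫⁻ r in Set.Ioc r₁ r₂, ENNReal.ofReal u * G (r * u)) ∂ν := by
        rw [lintegral_lintegral_swap]
        apply Measurable.aemeasurable
        unfold Function.uncurry
        fun_prop
    _ ≤ K * ∫⁻ u, (∫⁻ s in Set.Ioc (r₁ / 2) (2 * r₂), G s) ∂ν := by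
        refine mul_le_mul_right ?_ _
        apply setLIntegral_mono' measurableSet_Ioc
        intro u hu
        have hu0 : 0 < u := by linarith [hu.1]
        rw [chvar G hG u _ _ hu0]
        apply lintegral_mono_set
        apply Set.Ioc_subset_Ioc
        · nlinarith [hu.1]
        · nlinarith [hu.2]
    _ ≤ _ := by
        rw [lintegral_const, hνu, mul_comm (lintegral _ _), ← mul_assoc, hK,
          ← ENNReal.ofReal_mul (by positivity)]
        refine mul_le_mul_left (ENNReal.ofReal_le_ofReal ?_) _
        have : 0 ≤ (C * 2) ^ p * (3/2 : ℝ) ^ (p - 1) := by positivity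
        nlinarith
end
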